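/- arXiv:2304.11991 — 4 statements merged into one kernel-verified Lean document; each statement's English description precedes it below -/
import Mathlib

section
/- Let n ≥ 2 and let G be an imprimitive transitive subgroup of S_n. Then there is a constant c(n) such that for all X ≥ 2, F_n(X;G) ≤ c(n) · X^{(n+4)/8}. -/
open Polynomial

noncomputable section

/-- A fixed algebraic closure of `ℚ`. -/
abbrev Qbar : Type := AlgebraicClosure ℚ

/-- The discriminant of a subfield of `ℚ̄` (zero if it is not a number field). -/
def fieldDiscr (K : IntermediateField ℚ Qbar) : ℤ := by
  by_cases h : FiniteDimensional ℚ K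
  · exact @NumberField.discr K _ ⟨⟩
  · exact 0

/-- The action of `Gal(ℚ̄/ℚ)` on the embeddings of `K` into `ℚ̄`; its image is the
Galois group of the Galois closure of `K`, acting on the embeddings of `K`. -/
def galAct (K : IntermediateField ℚ Qbar) :
    (Qbar ≃ₐ[ℚ] Qbar) →* Equiv.Perm (K →ₐ[ℚ] Qbar) where
  toFun σ :=
    { toFun := fun ι => σ.toAlgHom.comp ι
      invFun := fun ι => σ.symm.toAlgHom.comp ι
      left_inv := fun ι => by ext x; simp
      right_inv := fun ι => by ext x; simp }
  map_one' := by
    apply Equiv.ext; intro ι; ext x; simp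
  map_mul' := fun σ τ => by
    apply Equiv.ext; intro ι; ext x; simp

/-- `K` has Galois group (of its Galois closure, acting on the `n` embeddings of `K` in `ℚ̄`)
equal to `G`, up to conjugacy; this is encoded by an identification of the embeddings
with `Fin n` under which the image of the Galois action is exactly `G`. -/
def HasGalGroup (n : ℕ) (K : IntermediateField ℚ Qbar)
    (G : Subgroup (Equiv.Perm (Fin n))) : Prop :=
  ∃ e : (K →ₐ[ℚ] Qbar) ≃ Fin n, ∀ σ : Equiv.Perm (Fin n),
    σ ∈ G ↔ ∃ g : Qbar ≃ₐ[ℚ] Qbar, Equiv.permCongr e (galAct K g) = σ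

/-- The number of number fields of degree `n`, absolute discriminant at most `X`,
and Galois group (as a permutation group on the embeddings) conjugate to `G`. -/
def FnG (n : ℕ) (X : ℝ) (G : Subgroup (Equiv.Perm (Fin n))) : ℕ :=
  Nat.card {K : IntermediateField ℚ Qbar //
    Module.finrank ℚ K = n ∧ |(fieldDiscr K : ℝ)| ≤ X ∧ HasGalGroup n K G}

/-- The number of number fields of degree `n` and absolute discriminant at most `X`. -/
def FnAll (n : ℕ) (X : ℝ) : ℕ :=
  Nat.card {K : IntermediateField ℚ Qbar //
    Module.finrank ℚ K = n ∧ |(fieldDiscr K : ℝ)| ≤ X}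

/-- A subgroup of the permutations of `β` is transitive. -/
def IsTransitiveSub {β : Type*} (G : Subgroup (Equiv.Perm β)) : Prop :=
  ∀ x y : β, ∃ σ ∈ G, σ x = y

/-- `G` admits a nontrivial block system: a partition of `β` into `k ≥ 2` nonempty parts,
some part having at least two elements, whose parts are permuted by every element of `G`. -/
def HasBlockSystem {β : Type*} (G : Subgroup (Equiv.Perm β)) : Prop :=
  ∃ (k : ℕ) (R : Fin k → Set β), 2 ≤ k ∧
    (∀ j, (R j).Nonempty) ∧
    (∃ j, 2 ≤ Nat.card (R j)) ∧
    (∀ x : β, ∃! j, x ∈ R j) ∧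
    (∀ σ ∈ G, ∀ i, ∃ j, (fun x => σ x) '' R i = R j)

/-- An imprimitive permutation group: transitive with a nontrivial block system. -/
def IsImprimitiveSub {β : Type*} (G : Subgroup (Equiv.Perm β)) : Prop :=
  IsTransitiveSub G ∧ HasBlockSystem G

/-- A primitive permutation group: transitive with no nontrivial block system. -/
def IsPrimitiveSub {β : Type*} (G : Subgroup (Equiv.Perm β)) : Prop :=
  IsTransitiveSub G ∧ ¬ HasBlockSystem G

end

section

open Matrix MeasureTheory

theorem exists_int_vec_mulVec_lt {ι : Type*} [Fintype ι] [DecidableEq ι] (B : Matrix ι ι ℝ)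
    (c : ℝ) (hc : 0 < c) (hB : B.det ≠ 0) (h : |B.det| < c ^ Fintype.card ι) :
    ∃ y : ι → ℤ, y ≠ 0 ∧ ∀ i, |(B *ᵥ fun j => (y j : ℝ)) i| < c := by
  classical
  set b := Pi.basisFun ℝ ι
  set s : Set (ι → ℝ) := (Matrix.toLin' B) ⁻¹' (Set.pi Set.univ fun _ => Set.Ioo (-c) c) with hs
  have hmem : ∀ x, x ∈ s ↔ ∀ i, |(B *ᵥ x) i| < c := by
    intro x
    simp [hs, abs_lt]
  have hconv : Convex ℝ s := by
    apply Convex.linear_preimage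
    exact convex_pi fun _ _ => convex_Ioo _ _
  have hsymm : ∀ x ∈ s, -x ∈ s := by
    intro x hx
    rw [hmem] at hx ⊢
    intro i
    simpa [Matrix.mulVec_neg] using hx i
  have hdet : LinearMap.det (Matrix.toLin' B) = B.det := LinearMap.det_toLin' B
  have hvol : volume s = ENNReal.ofReal |B.det|⁻¹ * ENNReal.ofReal (2 * c) ^ Fintype.card ι := by
    rw [hs, Measure.addHaar_preimage_linearMap _ (by rwa [hdet]), hdet, Real.volume_pi_Ioo, abs_inv]
    simp [two_mul]
  have fund := ZSpan.isAddFundamentalDomain' b volume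
  have : Countable (Submodule.span ℤ (Set.range b)).toAddSubgroup := by
    change Countable (Submodule.span ℤ (Set.range b))
    infer_instance
  have hF : volume (ZSpan.fundamentalDomain b) = 1 := by
    rw [ZSpan.fundamentalDomain_pi_basisFun, Real.volume_pi_Ico]
    simp
  obtain ⟨x, hx0, hxs⟩ := exists_ne_zero_mem_lattice_of_measure_mul_two_pow_lt_measure
    fund hsymm hconv (by
      rw [hF, hvol, one_mul, Module.finrank_fintype_fun_eq_card, ENNReal.ofReal_mul (by norm_num),
        mul_pow, mul_left_comm, ← ENNReal.ofReal_pow hc.le, ← ENNReal.ofReal_mul (by positivity)]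
      have h1 : 1 < |B.det|⁻¹ * c ^ Fintype.card ι := by
        rw [inv_mul_eq_div, one_lt_div (abs_pos.2 hB)]
        exact h
      conv_lhs => rw [← mul_one ((2 : ENNReal) ^ Fintype.card ι)]
      rw [ENNReal.ofReal_ofNat]
      refine ENNReal.mul_lt_mul_right (by simp) (by simp) ?_
      exact ENNReal.one_lt_ofReal.2 h1)
  have hxm : (x : ι → ℝ) ∈ Submodule.span ℤ (Set.range b) := x.2
  have hy : ∀ i, ∃ k : ℤ, (k : ℝ) = (x : ι → ℝ) i := by
    intro i
    have := (b.mem_span_iff_repr_mem ℤ (x : ι → ℝ)).1 hxm i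
    simpa [b] using this
  choose y hy using hy
  have hyx : (fun j => (y j : ℝ)) = (x : ι → ℝ) := funext hy
  refine ⟨y, ?_, ?_⟩
  · rintro rfl
    apply hx0
    ext i
    simp [← hyx]
  · rw [hyx]
    exact (hmem _).1 hxs

open scoped MatrixOrder in
theorem Matrix.PosDef.exists_int_vec_le {ι : Type*} [Fintype ι] [DecidableEq ι] [Nonempty ι]
    {S : Matrix ι ι ℝ} (hS : S.PosDef) :
    ∃ y : ι → ℤ, y ≠ 0 ∧ (fun j => (y j : ℝ)) ⬝ᵥ (S *ᵥ fun j => (y j : ℝ)) ≤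
      4 * Fintype.card ι * S.det ^ ((Fintype.card ι : ℝ)⁻¹) := by
  obtain ⟨B, hB⟩ := (CStarAlgebra.nonneg_iff_eq_star_mul_self (a := S)).1 hS.posSemidef.nonneg
  rw [Matrix.star_eq_conjTranspose, Matrix.conjTranspose_eq_transpose_of_trivial] at hB
  have hdet : S.det = B.det ^ 2 := by rw [hB]; simp [sq]
  have hpos : 0 < S.det := hS.det_pos
  have hB0 : B.det ≠ 0 := by
    intro h
    rw [hdet, h] at hpos
    simp at hpos
  have hr : 0 < Fintype.card ι := Fintype.card_pos
  set r := Fintype.card ι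
  set c : ℝ := |B.det| ^ ((r : ℝ)⁻¹) with hc
  have habs : 0 < |B.det| := abs_pos.2 hB0
  have hcpos : 0 < c := Real.rpow_pos_of_pos habs _
  have hcr : c ^ r = |B.det| := Real.rpow_inv_natCast_pow habs.le hr.ne'
  have hc2 : c ^ 2 = S.det ^ ((r : ℝ)⁻¹) := by
    rw [hdet, ← sq_abs B.det, hc, ← Real.rpow_natCast, ← Real.rpow_natCast, ← Real.rpow_mul habs.le,
      ← Real.rpow_mul habs.le, mul_comm]
  obtain ⟨y, hy0, hy⟩ := exists_int_vec_mulVec_lt B (2 * c) (by positivity) hB0 (by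
    rw [mul_pow, hcr]
    have : (1 : ℝ) < 2 ^ r := one_lt_pow₀ (by norm_num) hr.ne'
    nlinarith)
  refine ⟨y, hy0, ?_⟩
  have : (fun j => (y j : ℝ)) ⬝ᵥ (S *ᵥ fun j => (y j : ℝ)) =
      ∑ i, ((B *ᵥ fun j => (y j : ℝ)) i) ^ 2 := by
    rw [hB, ← Matrix.mulVec_mulVec, Matrix.dotProduct_mulVec, Matrix.vecMul_transpose]
    simp [dotProduct, sq]
  rw [this]
  calc _ ≤ ∑ i : ι, (2 * c) ^ 2 := Finset.sum_le_sum fun i _ => by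
        rw [← sq_abs]; exact pow_le_pow_left₀ (abs_nonneg _) (hy i).le 2
    _ = _ := by
        rw [← hc2]; simp; ring

theorem exists_real_int_vec_le {ι κ : Type*} [Fintype ι] [DecidableEq ι] [Fintype κ]
    [DecidableEq κ] [Nonempty κ] {A : Matrix (ι ⊕ κ) (ι ⊕ κ) ℝ} (hA : A.PosDef) :
    ∃ (z : ι → ℝ) (y : κ → ℤ), y ≠ 0 ∧
      (Sum.elim z fun j => (y j : ℝ)) ⬝ᵥ (A *ᵥ Sum.elim z fun j => (y j : ℝ)) ≤
      4 * Fintype.card κ * (A.det / A.toBlocks₁₁.det) ^ ((Fintype.card κ : ℝ)⁻¹) := by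
  have hP : A.toBlocks₁₁.PosDef := hA.submatrix Sum.inl_injective
  have hdetP := hP.det_pos
  let _ : Invertible A.toBlocks₁₁ := A.toBlocks₁₁.invertibleOfIsUnitDet hdetP.ne'.isUnit
  set P := A.toBlocks₁₁ with hPd
  set Q := A.toBlocks₁₂ with hQd
  set R := A.toBlocks₂₂ with hRd
  have hQ : A.toBlocks₂₁ = Qᴴ := by
    ext i j
    have := hA.isHermitian.apply (Sum.inr i) (Sum.inl j)
    simpa [toBlocks₂₁, toBlocks₁₂, hQd] using this.symm
  have hblk : A = fromBlocks P Q Qᴴ R := by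
    rw [← hQ]; exact (fromBlocks_toBlocks A).symm
  set S := R - Qᴴ * P⁻¹ * Q with hSd
  have hform := fun x y => schur_complement_eq₁₁ Q R x y hP.isHermitian
  have hdet : S.det = A.det / P.det := by
    rw [hblk, det_fromBlocks₁₁, invOf_eq_nonsing_inv]
    field_simp
    rfl
  have key : ∀ y : κ → ℝ, (Sum.elim (-((P⁻¹ * Q) *ᵥ y)) y) ⬝ᵥ
      (A *ᵥ (Sum.elim (-((P⁻¹ * Q) *ᵥ y)) y)) = y ⬝ᵥ (S *ᵥ y) := by
    intro y
    have := hform (-((P⁻¹ * Q) *ᵥ y)) y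
    rw [← hblk] at this
    simpa [dotProduct_mulVec, hSd] using this
  have hSpd : S.PosDef := by
    refine Matrix.PosDef.of_dotProduct_mulVec_pos ?_ fun y hy => ?_
    · rw [hSd, ← Matrix.IsHermitian.fromBlocks₁₁ _ _ hP.isHermitian, ← hblk]
      exact hA.isHermitian
    · have : (star y) ⬝ᵥ (S *ᵥ y) = y ⬝ᵥ (S *ᵥ y) := by simp
      rw [this, ← key]
      have h2 := hA.dotProduct_mulVec_pos (x := Sum.elim (-((P⁻¹ * Q) *ᵥ y)) y) (by
        intro h
        apply hy
        ext i
        exact congrFun h (Sum.inr i))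
      simpa using h2
  obtain ⟨y, hy0, hy⟩ := hSpd.exists_int_vec_le
  refine ⟨-((P⁻¹ * Q) *ᵥ fun j => (y j : ℝ)), y, hy0, ?_⟩
  rw [key, ← hdet]
  exact hy

end

section

open Matrix NumberField
open scoped ComplexConjugate

theorem algebraDiscr_rat_integral_basis {K : Type*} [Field K] [NumberField K] {ι : Type*} [Fintype ι]
    [DecidableEq ι] (b : Module.Basis ι ℤ (𝓞 K)) :
    Algebra.discr ℚ (fun i => (b i : K)) = discr K := by
  rw [← discr_eq_discr K b]
  change _ = algebraMap ℤ ℚ _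
  rw [← Algebra.discr_localizationLocalization ℤ (nonZeroDivisors ℤ) K]
  congr 1
  ext i
  simp

/-- The Gram matrix of a family in a number field for the form `∑ σ, σ x * conj (σ y)`. -/
noncomputable def embeddingGram {K : Type*} [Field K] [NumberField K] {ι : Type*} (v : ι → K) :
    Matrix ι ι ℝ :=
  Matrix.of fun i j => ∑ σ : K →+* ℂ, (σ (v i) * conj (σ (v j))).re

theorem dotProduct_embeddingGram_mulVec {K : Type*} [Field K] [NumberField K] {ι : Type*} [Fintype ι]
    (v : ι → K) (x : ι → ℝ) :
    x ⬝ᵥ (embeddingGram v *ᵥ x) = ∑ σ : K →+* ℂ, ‖∑ i, (x i : ℂ) * σ (v i)‖ ^ 2 := by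
  have h : ∀ σ : K →+* ℂ, ‖∑ i, (x i : ℂ) * σ (v i)‖ ^ 2 =
      ∑ i, ∑ j, x i * (x j * (σ (v i) * conj (σ (v j))).re) := by
    intro σ
    have : ((‖∑ i, (x i : ℂ) * σ (v i)‖ ^ 2 : ℝ) : ℂ) =
        ∑ i, ∑ j, (x i : ℂ) * ((x j : ℂ) * (σ (v i) * conj (σ (v j)))) := by
      push_cast
      rw [← Complex.mul_conj', map_sum, Finset.sum_mul_sum]
      refine Finset.sum_congr rfl fun i _ => Finset.sum_congr rfl fun j _ => ?_
      simp
      ring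
    have h2 := congrArg Complex.re this
    rw [Complex.ofReal_re] at h2
    rw [h2]
    simp only [Complex.re_sum, Complex.re_ofReal_mul]
  simp_rw [h]
  rw [Finset.sum_comm]
  refine Finset.sum_congr rfl fun i _ => ?_
  rw [Finset.sum_comm, mulVec, dotProduct, Finset.mul_sum]
  refine Finset.sum_congr rfl fun j _ => ?_
  rw [embeddingGram, of_apply, Finset.sum_mul, Finset.mul_sum]
  refine Finset.sum_congr rfl fun σ _ => ?_
  ring

theorem ofReal_det_embeddingGram {K : Type*} [Field K] [NumberField K] {ι : Type*} [Fintype ι]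
    [DecidableEq ι] (b : Module.Basis ι ℤ (𝓞 K)) :
    (embeddingGram fun i => (b i : K)).det = |(discr K : ℝ)| := by
  classical
  have hcard : Fintype.card ι = Fintype.card (K →ₐ[ℚ] ℂ) := by
    rw [AlgHom.card, ← RingOfIntegers.rank, Module.finrank_eq_card_basis b]
  let e : ι ≃ (K →ₐ[ℚ] ℂ) := Fintype.equivOfCardEq hcard
  set M := Algebra.embeddingsMatrixReindex ℚ ℂ (fun i => (b i : K)) e with hM
  have hd : M.det ^ 2 = discr K := by
    rw [hM, ← Algebra.discr_eq_det_embeddingsMatrixReindex_pow_two, algebraDiscr_rat_integral_basis]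
    simp
  have hG : (embeddingGram fun i => (b i : K)).map Complex.ofReal = M * Mᴴ := by
    ext i j
    have h1 : (M * Mᴴ) i j = ∑ σ : K →+* ℂ, σ (b i) * conj (σ (b j)) := by
      rw [Matrix.mul_apply]
      refine Fintype.sum_equiv (e.trans (RingHom.equivRatAlgHom K ℂ).symm) _ _ fun k => ?_
      simp [hM, Algebra.embeddingsMatrixReindex, Algebra.embeddingsMatrix]
    rw [h1, map_apply]
    have h2 : conj (∑ σ : K →+* ℂ, σ (b i) * conj (σ (b j))) =
        ∑ σ : K →+* ℂ, σ (b i) * conj (σ (b j)) := by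
      rw [map_sum]
      refine Fintype.sum_equiv (ComplexEmbedding.involutive_conjugate K).toPerm _ _ fun σ => ?_
      simp
    rw [← Complex.conj_eq_iff_re.1 h2]
    simp [embeddingGram, Complex.re_sum]
  have hdet := congrArg Matrix.det hG
  rw [det_mul, det_conjTranspose] at hdet
  have h3 : ((embeddingGram fun i => (b i : K)).det : ℂ) = M.det * star M.det := by
    rw [← hdet]
    exact (RingHom.map_det Complex.ofRealHom _)
  have h4 : M.det * star M.det = ((‖M.det‖ ^ 2 : ℝ) : ℂ) := by
    push_cast
    rw [← Complex.mul_conj']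
    simp
  rw [h4] at h3
  have h5 := Complex.ofReal_injective h3
  rw [h5, ← norm_pow, hd]
  simp

theorem posDef_embeddingGram {K : Type*} [Field K] [NumberField K] {ι : Type*} [Fintype ι]
    [DecidableEq ι] (b : Module.Basis ι ℤ (𝓞 K)) :
    (embeddingGram fun i => (b i : K)).PosDef := by
  have hps : (embeddingGram fun i => (b i : K)).PosSemidef := by
    refine Matrix.PosSemidef.of_dotProduct_mulVec_nonneg ?_ fun x => ?_
    · ext i j
      simp only [embeddingGram, conjTranspose_apply, of_apply, star_trivial]
      refine Finset.sum_congr rfl fun σ _ => ?_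
      simp
      ring
    · rw [star_trivial, dotProduct_embeddingGram_mulVec]
      positivity
  rw [hps.posDef_iff_det_ne_zero, ofReal_det_embeddingGram]
  simpa using discr_ne_zero K

theorem sum_comp_algebraMap {F K : Type*} [Field F] [Field K] [NumberField F] [NumberField K]
    [Algebra F K] {R : Type*} [Semiring R] (f : (F →+* ℂ) → R) :
    ∑ σ : K →+* ℂ, f (σ.comp (algebraMap F K)) = Module.finrank F K * ∑ τ : F →+* ℂ, f τ := by
  classical
  rw [Finset.sum_comp f (fun σ : K →+* ℂ => σ.comp (algebraMap F K)), Finset.mul_sum]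
  have hcard : ∀ τ : F →+* ℂ,
      (Finset.univ.filter fun σ : K →+* ℂ => σ.comp (algebraMap F K) = τ).card =
        Module.finrank F K := by
    intro τ
    let _ := τ.toAlgebra
    rw [← AlgHom.card F K ℂ, ← Fintype.card_subtype]
    refine Fintype.card_congr ⟨fun σ => { σ.1 with commutes' := fun r => ?_ },
      fun σ => ⟨σ.toRingHom, ?_⟩, fun σ => ?_, fun σ => ?_⟩
    · exact RingHom.congr_fun σ.2 r
    · ext r
      exact σ.commutes r
    · rfl
    · rfl
  have himg : (Finset.univ.image fun σ : K →+* ℂ => σ.comp (algebraMap F K)) = Finset.univ := by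
    rw [Finset.eq_univ_iff_forall]
    intro τ
    have h := hcard τ
    have hp : 0 < Module.finrank F K := Module.finrank_pos
    rw [← h, Finset.card_pos] at hp
    obtain ⟨σ, hσ⟩ := hp
    exact Finset.mem_image.2 ⟨σ, Finset.mem_univ _, by simpa using hσ⟩
  rw [himg]
  refine Finset.sum_congr rfl fun τ _ => ?_
  rw [hcard, nsmul_eq_mul]

theorem isTorsionFree_quotient_range_ringOfIntegers (F K : Type*) [Field F] [Field K] [NumberField F]
    [NumberField K] [Algebra F K] :
    Module.IsTorsionFree ℤ
      (𝓞 K ⧸ LinearMap.range (algebraMap (𝓞 F) (𝓞 K)).toIntAlgHom.toLinearMap) := by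
  rw [Module.isTorsionFree_iff_smul_eq_zero]
  intro k q h
  induction q using Submodule.Quotient.induction_on with
  | H x =>
  by_cases hk : k = 0
  · exact Or.inl hk
  right
  rw [← Submodule.Quotient.mk_smul, Submodule.Quotient.mk_eq_zero] at h
  obtain ⟨a, ha⟩ := h
  rw [Submodule.Quotient.mk_eq_zero]
  have hx : algebraMap F K ((a : F) / k) = (x : K) := by
    have h1 := congrArg (algebraMap (𝓞 K) K) ha
    have h2 : algebraMap F K (a : F) = (k : K) * (x : K) := by
      simpa [← IsScalarTower.algebraMap_apply] using h1
    rw [map_div₀, h2, map_intCast]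
    field_simp
  have hint : IsIntegral ℤ ((a : F) / k) := by
    rw [← isIntegral_algebraMap_iff (algebraMap F K).injective, hx]
    exact x.isIntegral_coe
  refine ⟨⟨_, hint⟩, ?_⟩
  apply RingOfIntegers.ext
  exact hx

theorem exists_adapted_integral_basis (F K : Type*) [Field F] [Field K] [NumberField F]
    [NumberField K] [Algebra F K] {ι : Type*} (bF : Module.Basis ι ℤ (𝓞 F)) :
    ∃ (r : ℕ) (b : Module.Basis (ι ⊕ Fin r) ℤ (𝓞 K)),
      ∀ i, b (Sum.inl i) = algebraMap (𝓞 F) (𝓞 K) (bF i) := by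
  have := isTorsionFree_quotient_range_ringOfIntegers F K
  set f := (algebraMap (𝓞 F) (𝓞 K)).toIntAlgHom.toLinearMap
  have hf : Function.Injective f := FaithfulSMul.algebraMap_injective (𝓞 F) (𝓞 K)
  obtain ⟨r, bQ⟩ := Module.basisOfFiniteTypeTorsionFree' (R := ℤ) (M := 𝓞 K ⧸ LinearMap.range f)
  refine ⟨r, Module.Basis.sumQuot (bF.map (LinearEquiv.ofInjective f hf)) bQ, fun i => ?_⟩
  simp [f]

theorem exists_isIntegral_notMem_range_sub_le (F K : Type*) [Field F] [Field K] [NumberField F]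
    [NumberField K] [Algebra F K] (hm : 2 ≤ Module.finrank F K) (r : ℕ)
    (hr : r = Module.finrank ℚ F * (Module.finrank F K - 1)) :
    ∃ x : K, IsIntegral ℤ x ∧ x ∉ Set.range (algebraMap F K) ∧
      ∀ σ σ' : K →+* ℂ, σ.comp (algebraMap F K) = σ'.comp (algebraMap F K) →
        ‖σ x - σ' x‖ ^ 2 ≤ 16 * r * (|(discr K : ℝ)| / |(discr F : ℝ)|) ^ ((r : ℝ)⁻¹) := by
  classical
  let bF := RingOfIntegers.basis F
  obtain ⟨s, b, hb⟩ := exists_adapted_integral_basis F K bF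
  set d := Module.finrank ℚ F with hd
  set m := Module.finrank F K with hmdef
  have hdpos : 0 < d := Module.finrank_pos
  have hsr : s = r := by
    have h1 : Module.finrank ℚ K = d + s := by
      rw [← RingOfIntegers.rank, Module.finrank_eq_card_basis b, Fintype.card_sum, Fintype.card_fin,
        ← Module.finrank_eq_card_basis bF, RingOfIntegers.rank]
    have h2 : d * m = Module.finrank ℚ K := Module.finrank_mul_finrank ℚ F K
    obtain ⟨k, hk⟩ : ∃ k, m = k + 1 := ⟨m - 1, by omega⟩
    rw [hk] at h2 hr
    rw [hr]
    simp only [Nat.add_sub_cancel]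
    linarith [mul_add d k 1]
  subst hsr
  have hs : 0 < s := by rw [hr]; exact Nat.mul_pos hdpos (by omega)
  have : Nonempty (Fin s) := ⟨⟨0, hs⟩⟩
  set A := embeddingGram fun i => (b i : K) with hA
  have hP : A.toBlocks₁₁ = (m : ℝ) • embeddingGram fun i => (bF i : F) := by
    ext i j
    rw [Matrix.smul_apply, smul_eq_mul]
    simp only [hA, toBlocks₁₁, embeddingGram, of_apply, hb]
    rw [← sum_comp_algebraMap (fun τ : F →+* ℂ => (τ (bF i) * conj (τ (bF j))).re)]
    rfl
  have hdetP : |(discr F : ℝ)| ≤ A.toBlocks₁₁.det := by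
    rw [hP, det_smul, ofReal_det_embeddingGram]
    have : (1 : ℝ) ≤ (m : ℝ) := by exact_mod_cast (by omega : 1 ≤ m)
    exact le_mul_of_one_le_left (abs_nonneg _) (one_le_pow₀ this)
  have hDF : 0 < |(discr F : ℝ)| := abs_pos.2 (by exact_mod_cast discr_ne_zero F)
  obtain ⟨z, y, hy0, hy⟩ := exists_real_int_vec_le (posDef_embeddingGram b)
  rw [dotProduct_embeddingGram_mulVec, ofReal_det_embeddingGram, Fintype.card_fin] at hy
  set x : 𝓞 K := ∑ j, y j • b (Sum.inr j) with hx
  refine ⟨x, x.isIntegral_coe, ?_, ?_⟩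
  · rintro ⟨a, ha⟩
    have hint : IsIntegral ℤ a := by
      rw [← isIntegral_algebraMap_iff (algebraMap F K).injective, ha]
      exact x.isIntegral_coe
    set a' : 𝓞 F := ⟨a, hint⟩
    have h1 : algebraMap (𝓞 F) (𝓞 K) a' = x := RingOfIntegers.ext ha
    have h2 : ∑ i, bF.repr a' i • b (Sum.inl i) = x := by
      rw [← h1]
      conv_rhs => rw [← bF.sum_repr a', map_sum]
      refine Finset.sum_congr rfl fun i _ => ?_
      rw [hb, map_zsmul]
    have h3 : ∑ k, (Sum.elim (fun i => bF.repr a' i) (fun j => - y j)) k • b k = 0 := by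
      rw [Fintype.sum_sum_type]
      simp only [Sum.elim_inl, Sum.elim_inr, neg_smul, Finset.sum_neg_distrib]
      rw [h2, hx, add_neg_cancel]
    apply hy0
    ext j
    have := Fintype.linearIndependent_iff.1 b.linearIndependent _ h3 (Sum.inr j)
    simpa using this
  · intro σ σ' hσ
    set w : (K →+* ℂ) → ℂ := fun σ => ∑ i, (z i : ℂ) * σ (b (Sum.inl i) : K) with hw
    have hw' : w σ = w σ' := by
      refine Finset.sum_congr rfl fun i _ => ?_
      rw [hb]
      congr 1
      exact RingHom.congr_fun hσ (bF i : F)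
    have hsum : ∀ σ : K →+* ℂ, ∑ i, ((Sum.elim z fun j => (y j : ℝ)) i : ℂ) * σ (b i : K) =
        w σ + σ x := by
      intro σ
      rw [Fintype.sum_sum_type, hw, hx]
      simp
    simp_rw [hsum] at hy
    set C := 4 * (s : ℝ) * (|(discr K : ℝ)| / A.toBlocks₁₁.det) ^ ((s : ℝ)⁻¹) with hC
    have hle : ∀ σ, ‖w σ + σ x‖ ^ 2 ≤ C := fun σ =>
      (Finset.single_le_sum (f := fun σ : K →+* ℂ => ‖w σ + σ x‖ ^ 2)
        (fun _ _ => by positivity) (Finset.mem_univ σ)).trans hy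
    have hCle : C ≤ 4 * (s : ℝ) * (|(discr K : ℝ)| / |(discr F : ℝ)|) ^ ((s : ℝ)⁻¹) := by
      have h0 : 0 ≤ |(discr K : ℝ)| / A.toBlocks₁₁.det :=
        div_nonneg (abs_nonneg _) (hDF.le.trans hdetP)
      rw [hC]
      gcongr
    have heq : σ x - σ' x = (w σ + σ x) - (w σ' + σ' x) := by rw [hw']; ring
    rw [heq]
    have h1 := hle σ
    have h2 := hle σ'
    have h3 := norm_sub_le (w σ + σ x) (w σ' + σ' x)
    have h4 : ‖(w σ + σ x) - (w σ' + σ' x)‖ ^ 2 ≤ (‖w σ + σ x‖ + ‖w σ' + σ' x‖) ^ 2 :=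
      pow_le_pow_left₀ (norm_nonneg _) h3 2
    nlinarith [sq_nonneg (‖w σ + σ x‖ - ‖w σ' + σ' x‖)]

theorem exists_isIntegral_trace_eq_zero (F K : Type*) [Field F] [Field K] [NumberField F]
    [NumberField K] [Algebra F K] (hm : 2 ≤ Module.finrank F K) (r : ℕ)
    (hr : r = Module.finrank ℚ F * (Module.finrank F K - 1)) :
    ∃ x : K, IsIntegral ℤ x ∧ x ∉ Set.range (algebraMap F K) ∧ Algebra.trace F K x = 0 ∧
      ∀ σ : K →+* ℂ, ‖σ x‖ ≤ 4 * Module.finrank F K * r *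
        (|(discr K : ℝ)| / |(discr F : ℝ)|) ^ ((2 * r : ℝ)⁻¹) := by
  obtain ⟨x, hxi, hxF, hx⟩ := exists_isIntegral_notMem_range_sub_le F K hm r hr
  set m := Module.finrank F K with hmdef
  set q := |(discr K : ℝ)| / |(discr F : ℝ)| with hq
  have hq0 : 0 ≤ q := by positivity
  have hm0 : (m : K) ≠ 0 := by exact_mod_cast (by omega : m ≠ 0)
  refine ⟨m * x - algebraMap F K (Algebra.trace F K x), ?_, ?_, ?_, ?_⟩
  · have hmi : IsIntegral ℤ (m : K) := by
      simpa using isIntegral_algebraMap (R := ℤ) (A := K) (x := (m : ℤ))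
    exact (hmi.mul hxi).sub (Algebra.isIntegral_trace hxi).algebraMap
  · rintro ⟨a, ha⟩
    apply hxF
    refine ⟨(a + Algebra.trace F K x) / m, ?_⟩
    rw [map_div₀, map_add, ha]
    simp only [map_natCast]
    field_simp
    ring
  · rw [map_sub, Algebra.trace_algebraMap]
    have : (m : K) * x = (m : F) • x := by rw [Algebra.smul_def, map_natCast]
    rw [this, map_smul]
    simp [hmdef]
  · intro σ
    let _ := (σ.comp (algebraMap F K)).toAlgebra
    have h1 : σ (algebraMap F K (Algebra.trace F K x)) = ∑ τ : K →ₐ[F] ℂ, τ x :=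
      trace_eq_sum_embeddings ℂ (K := F) (x := x)
    have hcard : Fintype.card (K →ₐ[F] ℂ) = m := AlgHom.card F K ℂ
    have h2 : σ (m * x - algebraMap F K (Algebra.trace F K x)) =
        ∑ τ : K →ₐ[F] ℂ, (σ x - τ x) := by
      rw [map_sub, h1, Finset.sum_sub_distrib]
      simp [hcard]
    have h3 : ∀ τ : K →ₐ[F] ℂ, ‖σ x - τ x‖ ≤ 4 * r * q ^ ((2 * r : ℝ)⁻¹) := by
      intro τ
      have h := hx σ τ.toRingHom (by
        ext a
        exact (τ.commutes a).symm)
      refine (sq_le_sq₀ (norm_nonneg _) (by positivity)).1 (h.trans ?_)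
      have h4 : (q ^ ((2 * r : ℝ)⁻¹)) ^ 2 = q ^ ((r : ℝ)⁻¹) := by
        rw [← Real.rpow_natCast, ← Real.rpow_mul hq0]
        congr 1
        rcases eq_or_ne (r : ℝ) 0 with h0 | h0
        · simp [h0]
        · field_simp
          norm_num
      rw [mul_pow, h4]
      have h5 : (r : ℝ) ≤ (r : ℝ) ^ 2 := by
        exact_mod_cast Nat.le_self_pow (by norm_num) r
      have h6 : 0 ≤ q ^ ((r : ℝ)⁻¹) := by positivity
      nlinarith [mul_le_mul_of_nonneg_right h5 h6]
    rw [h2]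
    refine (norm_sum_le_of_le _ fun τ _ => h3 τ).trans ?_
    rw [Finset.sum_const, Finset.card_univ, hcard, nsmul_eq_mul]
    apply le_of_eq
    ring

theorem ringOfIntegers_eq_zero_of_norm_lt_one {F : Type*} [Field F] [NumberField F] (a : 𝓞 F)
    (h : ∀ φ : F →+* ℂ, ‖φ a‖ < 1) : a = 0 := by
  by_contra ha
  have ha' : (a : F) ≠ 0 := RingOfIntegers.coe_ne_zero_iff.2 ha
  obtain ⟨φ₀⟩ : Nonempty (F →+* ℂ) := inferInstance
  have h1 : ‖((Algebra.norm ℚ (a : F) : ℚ) : ℂ)‖ < 1 := by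
    have h2 : ((Algebra.norm ℚ (a : F) : ℚ) : ℂ) = ∏ σ : F →ₐ[ℚ] ℂ, σ a :=
      Algebra.norm_eq_prod_embeddings ℚ ℂ (a : F)
    rw [h2, norm_prod]
    calc ∏ σ : F →ₐ[ℚ] ℂ, ‖σ a‖ < ∏ σ : F →ₐ[ℚ] ℂ, 1 := by
          refine Finset.prod_lt_prod_of_nonempty (fun σ _ => ?_) (fun σ _ => h σ.toRingHom)
            ⟨φ₀.toRatAlgHom, Finset.mem_univ _⟩
          exact norm_pos_iff.2 ((map_ne_zero σ).2 ha')
      _ = 1 := by simp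
  have h3 : Algebra.norm ℚ (a : F) = ((Algebra.norm ℤ a : ℤ) : ℚ) := by
    rw [← Algebra.coe_norm_int]
  rw [h3] at h1
  simp only [Rat.cast_intCast, Complex.norm_intCast] at h1
  have h4 : Algebra.norm ℤ a = 0 := by
    have : |Algebra.norm ℤ a| < 1 := by exact_mod_cast h1
    simpa using this
  exact ha (Algebra.norm_eq_zero_iff.1 h4)

theorem Complex.norm_lt_one_of_abs_add_abs_sub {z : ℂ} (h1 : |2 * (z.re + z.im)| < 1)
    (h2 : |2 * (z.re - z.im)| < 1) : ‖z‖ < 1 := by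
  rw [abs_lt] at h1 h2
  refine (sq_lt_one_iff₀ (norm_nonneg z)).1 ?_
  rw [Complex.sq_norm, Complex.normSq_apply]
  nlinarith

theorem finite_and_ncard_forall_norm_le {F : Type*} [Field F] [NumberField F] {B : ℝ} (hB : 1 ≤ B) :
    {a : 𝓞 F | ∀ φ : F →+* ℂ, ‖φ a‖ ≤ B}.Finite ∧
      ({a : 𝓞 F | ∀ φ : F →+* ℂ, ‖φ a‖ ≤ B}.ncard : ℝ) ≤ (10 * B) ^ Module.finrank ℚ F := by
  classical
  set S := {a : 𝓞 F | ∀ φ : F →+* ℂ, ‖φ a‖ ≤ B} with hS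
  let f : 𝓞 F → (F →+* ℂ) → ℤ := fun a φ => ⌊2 * ((φ a).re + (φ a).im)⌋
  have hinj : Function.Injective f := by
    intro a b hab
    have hφ : ∀ φ : F →+* ℂ, |2 * ((φ (a - b : F)).re + (φ (a - b : F)).im)| < 1 := by
      intro φ
      have h := Int.abs_sub_lt_one_of_floor_eq_floor (congrFun hab φ)
      rw [map_sub, Complex.sub_re, Complex.sub_im]
      rwa [← mul_sub, add_sub_add_comm] at h
    rw [← sub_eq_zero]
    refine ringOfIntegers_eq_zero_of_norm_lt_one _ fun φ => ?_
    refine Complex.norm_lt_one_of_abs_add_abs_sub (hφ φ) ?_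
    have h := hφ (ComplexEmbedding.conjugate φ)
    rwa [ComplexEmbedding.conjugate_coe_eq, Complex.conj_re, Complex.conj_im,
      ← sub_eq_add_neg] at h
  let T : Finset ((F →+* ℂ) → ℤ) := Fintype.piFinset fun _ => Finset.Icc ⌊-(4 * B)⌋ ⌊4 * B⌋
  have hmaps : Set.MapsTo f S T := by
    intro a ha
    simp only [T, Fintype.coe_piFinset, Set.mem_pi, Finset.coe_Icc, Set.mem_univ, true_implies]
    intro φ
    have h0 : ‖φ a‖ ≤ B := ha φ
    have h1 := abs_le.1 ((Complex.abs_re_le_norm (φ a)).trans h0)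
    have h2 := abs_le.1 ((Complex.abs_im_le_norm (φ a)).trans h0)
    exact ⟨Int.floor_le_floor (by linarith [h1.1, h2.1]), Int.floor_le_floor (by linarith [h1.2, h2.2])⟩
  have hfin : S.Finite := Set.Finite.of_injOn hmaps hinj.injOn T.finite_toSet
  refine ⟨hfin, ?_⟩
  have hle : S.ncard ≤ T.card := by
    rw [← Set.ncard_coe_finset]
    exact Set.ncard_le_ncard_of_injOn f hmaps hinj.injOn T.finite_toSet
  have hT : T.card = (Finset.Icc ⌊-(4 * B)⌋ ⌊4 * B⌋).card ^ Module.finrank ℚ F := by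
    rw [Fintype.card_piFinset, Finset.prod_const, Finset.card_univ, Embeddings.card]
  have hI : ((Finset.Icc ⌊-(4 * B)⌋ ⌊4 * B⌋).card : ℝ) ≤ 10 * B := by
    rw [Int.card_Icc]
    have h1 : ⌊-(4 * B)⌋ ≤ ⌊4 * B⌋ + 1 := by
      have := Int.floor_le_floor (show -(4 * B) ≤ 4 * B by linarith)
      omega
    have h2 : (((⌊4 * B⌋ + 1 - ⌊-(4 * B)⌋).toNat : ℤ) : ℝ) = ⌊4 * B⌋ + 1 - ⌊-(4 * B)⌋ := by
      rw [Int.toNat_of_nonneg (by omega)]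
      push_cast
      ring
    have h3 := Int.floor_le (4 * B)
    have h4 := Int.lt_floor_add_one (-(4 * B))
    rw [Int.cast_natCast] at h2
    rw [h2]
    linarith
  calc (S.ncard : ℝ) ≤ (T.card : ℝ) := by exact_mod_cast hle
    _ = ((Finset.Icc ⌊-(4 * B)⌋ ⌊4 * B⌋).card : ℝ) ^ Module.finrank ℚ F := by
      rw [hT, Nat.cast_pow]
    _ ≤ _ := by gcongr

theorem ncard_forall_norm_le_of_finrank_eq_two {F : Type*} [Field F] [NumberField F]
    (hF : Module.finrank ℚ F = 2) {B : ℝ} (hB : 1 ≤ B) :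
    ({a : 𝓞 F | ∀ φ : F →+* ℂ, ‖φ a‖ ≤ B}.ncard : ℝ) ≤
      5 * B * (4 * B / √|(discr F : ℝ)| + 1) := by
  classical
  set S := {a : 𝓞 F | ∀ φ : F →+* ℂ, ‖φ a‖ ≤ B} with hS
  obtain ⟨b⟩ : Nonempty (Module.Basis (Fin 2) ℤ (𝓞 F)) :=
    ⟨Module.finBasisOfFinrankEq ℤ (𝓞 F) (by rw [RingOfIntegers.rank, hF])⟩
  obtain ⟨e⟩ : Nonempty (Fin 2 ≃ (F →ₐ[ℚ] ℂ)) :=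
    ⟨Fintype.equivOfCardEq (by rw [AlgHom.card, hF, Fintype.card_fin])⟩
  set M := Algebra.embeddingsMatrixReindex ℚ ℂ (fun i => (b i : F)) e with hM
  have hd : M.det ^ 2 = discr F := by
    have := Algebra.discr_eq_det_embeddingsMatrixReindex_pow_two ℚ ℂ (fun i => (b i : F)) e
    rw [algebraDiscr_rat_integral_basis] at this
    rw [hM, ← this]
    simp
  have hDF : 0 < |(discr F : ℝ)| := abs_pos.2 (by exact_mod_cast discr_ne_zero F)
  have hMd : ‖M.det‖ = √|(discr F : ℝ)| := by
    rw [Eq.comm, Real.sqrt_eq_iff_mul_self_eq hDF.le (norm_nonneg _), ← norm_mul, ← sq, hd]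
    simp
  let k : 𝓞 F → ℤ := fun a => b.repr 1 0 * b.repr a 1 - b.repr 1 1 * b.repr a 0
  have hcoord : ∀ (a : 𝓞 F) (i : Fin 2),
      e i (a : F) = b.repr a 0 * e i (b 0 : F) + b.repr a 1 * e i (b 1 : F) := by
    intro a i
    have h := congrArg (fun x : 𝓞 F => e i (x : F)) (b.sum_repr a)
    rw [← h]
    simp [Fin.sum_univ_two]
  have hk : ∀ a : 𝓞 F, e 1 (a : F) - e 0 (a : F) = M.det * k a := by
    intro a
    have h10 := hcoord 1 0
    have h11 := hcoord 1 1
    simp only [map_one] at h10 h11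
    have h20 := hcoord a 0
    have h21 := hcoord a 1
    have hdet : M.det = e 0 (b 0 : F) * e 1 (b 1 : F) - e 0 (b 1 : F) * e 1 (b 0 : F) := by
      rw [Matrix.det_fin_two]
      simp [hM, Algebra.embeddingsMatrixReindex, Algebra.embeddingsMatrix]
      ring
    rw [hdet]
    simp only [k]
    push_cast
    linear_combination e 1 (a : F) * h10 - e 0 (a : F) * h11 +
      (b.repr 1 0 * e 0 (b 0 : F) + b.repr 1 1 * e 0 (b 1 : F)) * h21 -
      (b.repr 1 0 * e 1 (b 0 : F) + b.repr 1 1 * e 1 (b 1 : F)) * h20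
  have htr : ∀ a : 𝓞 F, ((Algebra.trace ℤ (𝓞 F) a : ℤ) : ℂ) = e 0 (a : F) + e 1 (a : F) := by
    intro a
    have h1 : ((Algebra.trace ℚ F (a : F) : ℚ) : ℂ) = ∑ σ : F →ₐ[ℚ] ℂ, σ (a : F) :=
      trace_eq_sum_embeddings ℂ (K := ℚ) (x := (a : F))
    rw [← Algebra.coe_trace_int, ← e.sum_comp, Fin.sum_univ_two] at h1
    simpa using h1
  let f : 𝓞 F → ℤ × ℤ := fun a => (Algebra.trace ℤ (𝓞 F) a, k a)
  have hinj : Function.Injective f := by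
    intro x y hxy
    simp only [f, Prod.mk.injEq] at hxy
    have h1 := htr x
    have h2 := hk x
    rw [hxy.1, htr y] at h1
    rw [hxy.2, ← hk y] at h2
    have h3 : e 0 (x : F) = e 0 (y : F) := by linear_combination (-1/2) * h1 - (1/2) * h2
    exact RingOfIntegers.ext ((e 0).injective h3)
  let I : ℝ → Finset ℤ := fun t => Finset.Icc (-⌊t⌋) ⌊t⌋
  have hmem : ∀ (t : ℝ) (z : ℤ), |(z : ℝ)| ≤ t → z ∈ I t := by
    intro t z h
    rw [abs_le] at h
    rw [Finset.mem_Icc, neg_le, Int.le_floor, Int.le_floor]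
    push_cast
    exact ⟨by linarith, h.2⟩
  have hIcard : ∀ t : ℝ, 0 ≤ t → ((I t).card : ℝ) ≤ 2 * t + 1 := by
    intro t ht
    have h0 : 0 ≤ ⌊t⌋ := Int.floor_nonneg.2 ht
    have h2 : (((⌊t⌋ + 1 - -⌊t⌋).toNat : ℤ) : ℝ) = 2 * ⌊t⌋ + 1 := by
      rw [Int.toNat_of_nonneg (by omega)]
      push_cast
      ring
    rw [Int.card_Icc]
    rw [Int.cast_natCast] at h2
    rw [h2]
    linarith [Int.floor_le t]
  set q := √|(discr F : ℝ)| with hq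
  have hq0 : 0 < q := Real.sqrt_pos.2 hDF
  have hmaps : Set.MapsTo f S (I (2 * B) ×ˢ I (2 * B / q) : Finset (ℤ × ℤ)) := by
    intro a ha
    have h0 : ‖e 0 (a : F)‖ ≤ B := ha (e 0).toRingHom
    have h1 : ‖e 1 (a : F)‖ ≤ B := ha (e 1).toRingHom
    rw [Finset.mem_coe, Finset.mem_product]
    refine ⟨hmem _ _ ?_, hmem _ _ ?_⟩
    · have h2 := congrArg norm (htr a)
      rw [Complex.norm_intCast] at h2
      rw [h2]
      linarith [norm_add_le (e 0 (a : F)) (e 1 (a : F))]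
    · have h2 := congrArg norm (hk a)
      rw [norm_mul, hMd, Complex.norm_intCast] at h2
      rw [le_div_iff₀ hq0, mul_comm, ← h2]
      linarith [norm_sub_le (e 1 (a : F)) (e 0 (a : F))]
  have hle := Set.ncard_le_ncard_of_injOn f hmaps hinj.injOn (Finset.finite_toSet _)
  rw [Set.ncard_coe_finset, Finset.card_product] at hle
  calc (S.ncard : ℝ) ≤ ((I (2 * B)).card : ℝ) * (I (2 * B / q)).card := by exact_mod_cast hle
    _ ≤ (2 * (2 * B) + 1) * (2 * (2 * B / q) + 1) := by
      exact mul_le_mul (hIcard _ (by linarith)) (hIcard _ (by positivity)) (Nat.cast_nonneg _)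
        (by linarith)
    _ ≤ 5 * B * (4 * B / q + 1) := by
      have h1 : 2 * (2 * B / q) = 4 * B / q := by ring
      rw [h1]
      exact mul_le_mul_of_nonneg_right (by linarith) (by positivity)

end

section

open NumberField

open Polynomial IntermediateField in
theorem exists_notMem_range_minpoly_eq (F K : Type*) [Field F] [Field K] [NumberField F]
    [NumberField K] [Algebra F K] {k : ℕ} (hk : 1 ≤ k) (hm : Module.finrank F K = k + 1)
    (hK : ∀ x : K, x ∉ Set.range (algebraMap F K) → F⟮x⟯ = ⊤) {r : ℕ}
    (hr : r = Module.finrank ℚ F * k) {R : ℝ}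
    (hR : R = 4 * (k + 1 : ℕ) * r * (|(discr K : ℝ)| / |(discr F : ℝ)|) ^ ((2 * r : ℝ)⁻¹)) :
    ∃ (x : K) (c : Fin k → 𝓞 F), x ∉ Set.range (algebraMap F K) ∧
      minpoly F x = X ^ (k + 1) + ∑ j, C (c j : F) * X ^ (j : ℕ) ∧
      ∀ j, ∀ φ : F →+* ℂ, ‖φ (c j)‖ ≤ R ^ (k + 1 - (j : ℕ)) * (k + 1).choose j := by
  obtain ⟨x, hxi, hxF, htr, hx⟩ := exists_isIntegral_trace_eq_zero F K (by omega) r (by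
    rw [hr, hm, Nat.add_sub_cancel])
  rw [hm, ← hR] at hx
  have hxF' : IsIntegral F x := Algebra.IsIntegral.isIntegral x
  have htop := hK x hxF
  have hdeg : (minpoly F x).natDegree = k + 1 := by
    rw [← hm, ← adjoin.finrank hxF', htop, finrank_top']
  have hmonic := minpoly.monic hxF'
  have hcoeff : (minpoly F x).coeff k = 0 := by
    have h1 := trace_eq_finrank_mul_minpoly_nextCoeff F x
    rw [htr, htop, nextCoeff_of_natDegree_pos (by omega), hdeg, Nat.add_sub_cancel] at h1
    simpa using h1
  have hint : ∀ i, IsIntegral ℤ ((minpoly F x).coeff i) := by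
    intro i
    rw [minpoly.isIntegrallyClosed_eq_field_fractions' (R := 𝓞 F) F hxi.tower_top, coeff_map]
    exact RingOfIntegers.isIntegral_coe _
  refine ⟨x, fun j => ⟨_, hint j⟩, hxF, ?_, ?_⟩
  · conv_lhs => rw [hmonic.as_sum, hdeg, Finset.sum_range_succ, hcoeff, Finset.sum_range,
      C_0, zero_mul, add_zero]
    rfl
  · intro j φ
    let _ := φ.toAlgebra
    have h := coeff_le_of_roots_le (p := minpoly F x) (f := φ) (B := R) (j : ℕ) hmonic
      (IsAlgClosed.splits _) (fun z hz => by
        have hz' : z ∈ (minpoly F x).rootSet ℂ := by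
          rw [mem_rootSet']
          exact mem_roots'.1 hz |>.imp id fun h => by
            rwa [IsRoot, eval_map] at h
        rw [← Algebra.IsAlgebraic.range_eval_eq_rootSet_minpoly (K := K)] at hz'
        obtain ⟨ψ, rfl⟩ := hz'
        exact hx ψ.toRingHom)
    rw [hdeg, coeff_map] at h
    exact h

end

section

open NumberField

theorem finiteDimensional_of_finrank_ne_zero {K : IntermediateField ℚ Qbar}
    (h : Module.finrank ℚ K ≠ 0) : FiniteDimensional ℚ K :=
  Module.finite_of_finrank_pos (Nat.pos_of_ne_zero h)

theorem fieldDiscr_eq (K : IntermediateField ℚ Qbar) [NumberField K] : fieldDiscr K = discr K := by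
  have h : FiniteDimensional ℚ K := inferInstance
  rw [fieldDiscr, dif_pos h]

/-- The extensions of `F` inside `ℚ̄` of absolute degree `n` and discriminant at most `X`
that have no proper intermediate field over `F`. -/
def coverSet (F : IntermediateField ℚ Qbar) (n : ℕ) (X : ℝ) : Set (IntermediateField ℚ Qbar) :=
  {K | F ⋖ K ∧ Module.finrank ℚ K = n ∧ |(fieldDiscr K : ℝ)| ≤ X}

theorem discr_ne_zero_of_finrank {K : IntermediateField ℚ Qbar} (h : Module.finrank ℚ K ≠ 0) :
    1 ≤ |(fieldDiscr K : ℝ)| := by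
  have := finiteDimensional_of_finrank_ne_zero h
  have : NumberField K := ⟨⟩
  rw [fieldDiscr_eq]
  exact_mod_cast Int.one_le_abs (discr_ne_zero K)

theorem abs_fieldDiscr_le_of_le {F K : IntermediateField ℚ Qbar} (hFK : F ≤ K)
    (hK : Module.finrank ℚ K ≠ 0) : |(fieldDiscr F : ℝ)| ≤ |(fieldDiscr K : ℝ)| := by
  have := finiteDimensional_of_finrank_ne_zero hK
  have : NumberField K := ⟨⟩
  let _ : Algebra F K := (IntermediateField.inclusion hFK).toAlgebra
  have : FiniteDimensional ℚ F :=
    FiniteDimensional.of_injective (IntermediateField.inclusion hFK).toLinearMap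
      (IntermediateField.inclusion hFK).injective
  have : NumberField F := ⟨⟩
  rw [fieldDiscr_eq, fieldDiscr_eq]
  have h := Int.natAbs_le_of_dvd_ne_zero (discr_dvd_discr F K) (discr_ne_zero K)
  rw [← Nat.cast_le (α := ℝ), Nat.cast_natAbs, Nat.cast_natAbs] at h
  exact_mod_cast h

open Polynomial IntermediateField in
theorem exists_eq_sup_adjoin_of_covBy {F K : IntermediateField ℚ Qbar} [NumberField F] {d k : ℕ}
    (hd : Module.finrank ℚ F = d) (hk : 1 ≤ k) (hcov : F ⋖ K)
    (hn : Module.finrank ℚ K = d * (k + 1)) {r : ℕ} (hr : r = d * k) {R Y : ℝ}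
    (hY : |(fieldDiscr K : ℝ)| ≤ Y)
    (hR : R = 4 * (k + 1 : ℕ) * r * (Y / |(discr F : ℝ)|) ^ ((2 * r : ℝ)⁻¹)) :
    ∃ (x : Qbar) (c : Fin k → 𝓞 F), K = F ⊔ ℚ⟮x⟯ ∧
      aeval x (X ^ (k + 1) + ∑ j, C (c j : F) * X ^ (j : ℕ)) = 0 ∧
      ∀ j, ∀ φ : F →+* ℂ, ‖φ (c j)‖ ≤ R ^ (k + 1 - (j : ℕ)) * (k + 1).choose j := by
  have hd0 : 0 < d := hd ▸ Module.finrank_pos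
  have := finiteDimensional_of_finrank_ne_zero (K := K) (by rw [hn]; positivity)
  have : NumberField K := ⟨⟩
  let _ : Algebra F K := (inclusion hcov.le).toAlgebra
  have : IsScalarTower F K Qbar := IsScalarTower.of_algebraMap_eq fun _ => rfl
  have hm : Module.finrank F K = k + 1 := by
    have := Module.finrank_mul_finrank ℚ F K
    rw [hd, hn] at this
    exact Nat.eq_of_mul_eq_mul_left hd0 this
  have hsup : ∀ x : K, x ∉ Set.range (algebraMap F K) → K = F ⊔ ℚ⟮(x : Qbar)⟯ := by
    intro x hx
    rcases hcov.eq_or_eq (c := F ⊔ ℚ⟮(x : Qbar)⟯) le_sup_left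
      (sup_le hcov.le (adjoin_simple_le_iff.2 x.2)) with h | h
    · exfalso
      have hxF : (x : Qbar) ∈ F := by
        rw [← h]
        exact le_sup_right (a := F) (mem_adjoin_simple_self ℚ _)
      exact hx ⟨⟨x, hxF⟩, rfl⟩
    · exact h.symm
  have hK : ∀ x : K, x ∉ Set.range (algebraMap F K) → F⟮x⟯ = ⊤ := by
    intro x hx
    rw [eq_top_iff]
    intro y _
    have hle : F ⊔ ℚ⟮(x : Qbar)⟯ ≤
        (F⟮x⟯.map (IsScalarTower.toAlgHom F K Qbar)).restrictScalars ℚ := by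
      refine sup_le (fun a ha => ?_) (adjoin_simple_le_iff.2 ?_)
      · exact (F⟮x⟯.map (IsScalarTower.toAlgHom F K Qbar)).algebraMap_mem ⟨a, ha⟩
      · exact ⟨x, mem_adjoin_simple_self F x, rfl⟩
    rw [← hsup x hx] at hle
    obtain ⟨z, hz, hzy⟩ := hle y.2
    have : z = y := Subtype.ext hzy
    exact this ▸ hz
  obtain ⟨x, c, hx, hmin, hc⟩ := exists_notMem_range_minpoly_eq F K hk hm hK (r := r)
    (by rw [hr, hd]) rfl
  refine ⟨x, c, hsup x hx, ?_, fun j φ => (hc j φ).trans ?_⟩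
  · rw [← hmin]
    have := minpoly.aeval F x
    have h2 := aeval_algebraMap_apply Qbar x (minpoly F x)
    rw [this, map_zero] at h2
    exact h2
  · rw [hR]
    rw [fieldDiscr_eq] at hY
    gcongr

open Polynomial IntermediateField in
theorem coverSet_finite_and_ncard_le {F : IntermediateField ℚ Qbar} [NumberField F] {d k : ℕ}
    (hd : Module.finrank ℚ F = d) (hk : 1 ≤ k) {r : ℕ} (hr : r = d * k) {R Y : ℝ}
    (hY : |(discr F : ℝ)| ≤ Y)
    (hR : R = 4 * (k + 1 : ℕ) * r * (Y / |(discr F : ℝ)|) ^ ((2 * r : ℝ)⁻¹)) :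
    (coverSet F (d * (k + 1)) Y).Finite ∧ (coverSet F (d * (k + 1)) Y).ncard ≤
      (k + 1) * ∏ j : Fin k, {a : 𝓞 F |
        ∀ φ : F →+* ℂ, ‖φ a‖ ≤ R ^ (k + 1 - (j : ℕ)) * (k + 1).choose j}.ncard := by
  classical
  have hd0 : 0 < d := hd ▸ Module.finrank_pos
  have hDF : 0 < |(discr F : ℝ)| := abs_pos.2 (by exact_mod_cast discr_ne_zero F)
  have hR1 : 1 ≤ R := by
    have h1 : 1 ≤ (Y / |(discr F : ℝ)|) ^ ((2 * r : ℝ)⁻¹) :=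
      Real.one_le_rpow ((one_le_div hDF).2 hY) (by positivity)
    have h2 : (1 : ℝ) ≤ r := by
      rw [hr]
      exact_mod_cast Nat.one_le_iff_ne_zero.2 (by positivity)
    have h3 : (1 : ℝ) ≤ (k + 1 : ℕ) := by exact_mod_cast Nat.le_add_left 1 k
    rw [hR]
    exact one_le_mul_of_one_le_of_one_le (one_le_mul_of_one_le_of_one_le
      (one_le_mul_of_one_le_of_one_le (by norm_num) h3) h2) h1
  set T : Fin k → Set (𝓞 F) := fun j => {a : 𝓞 F |
        ∀ φ : F →+* ℂ, ‖φ a‖ ≤ R ^ (k + 1 - (j : ℕ)) * (k + 1).choose j} with hT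
  have hTfin : ∀ j, (T j).Finite := fun j => (finite_and_ncard_forall_norm_le (by
    have h1 : (1 : ℝ) ≤ (k + 1).choose j := by
      exact_mod_cast Nat.choose_pos (by omega)
    exact one_le_mul_of_one_le_of_one_le (one_le_pow₀ hR1) h1)).1
  let f : (Fin k → 𝓞 F) → F[X] := fun c => X ^ (k + 1) + ∑ j, C (c j : F) * X ^ (j : ℕ)
  have hlow : ∀ c : Fin k → 𝓞 F, (∑ j, C (c j : F) * X ^ (j : ℕ)).degree < ((k + 1 : ℕ) : WithBot ℕ) := by
    intro c
    refine (degree_sum_le _ _).trans_lt ?_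
    rw [Finset.sup_lt_iff (WithBot.bot_lt_coe _)]
    intro j _
    refine (degree_C_mul_X_pow_le _ _).trans_lt ?_
    exact_mod_cast j.2.trans (Nat.lt_succ_self k)
  have hfm : ∀ c, (f c).Monic := fun c => monic_X_pow_add (hlow c)
  have hfd : ∀ c, (f c).natDegree = k + 1 := fun c => by
    rw [natDegree_eq_of_degree_eq (degree_add_eq_left_of_degree_lt (by
      rw [degree_X_pow]; exact hlow c)), natDegree_X_pow]
  let P : Finset (Fin k → 𝓞 F) := Fintype.piFinset fun j => (hTfin j).toFinset
  let Q : Finset (IntermediateField ℚ Qbar) :=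
    (P.biUnion fun c => ((f c).aroots Qbar).toFinset).image fun x => F ⊔ ℚ⟮x⟯
  have hsub : coverSet F (d * (k + 1)) Y ⊆ Q := by
    rintro K ⟨hcov, hn, hKY⟩
    obtain ⟨x, c, hK, hx, hc⟩ := exists_eq_sup_adjoin_of_covBy hd hk hcov hn hr hKY hR
    simp only [Q, Finset.coe_image, Set.mem_image, Finset.mem_coe, Finset.mem_biUnion,
      Multiset.mem_toFinset, P, Fintype.mem_piFinset, Set.Finite.mem_toFinset]
    exact ⟨x, ⟨c, hc, (mem_aroots).2 ⟨(hfm c).ne_zero, hx⟩⟩, hK.symm⟩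
  refine ⟨Q.finite_toSet.subset hsub, ?_⟩
  calc (coverSet F (d * (k + 1)) Y).ncard ≤ Q.card := by
        rw [← Set.ncard_coe_finset]
        exact Set.ncard_le_ncard hsub Q.finite_toSet
    _ ≤ _ := Finset.card_image_le
    _ ≤ P.card * (k + 1) := by
        refine Finset.card_biUnion_le_card_mul _ _ _ fun c _ => ?_
        refine (Multiset.toFinset_card_le _).trans ?_
        refine (card_roots' _).trans ?_
        rw [natDegree_map, hfd]
    _ = _ := by
        rw [mul_comm, Fintype.card_piFinset]
        congr 1
        exact Finset.prod_congr rfl fun j _ => (Set.ncard_eq_toFinset_card _ (hTfin j)).symm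

theorem sum_fin_add_one_sub (k : ℕ) : 2 * ∑ j : Fin k, (k + 1 - (j : ℕ)) = k * (k + 3) := by
  rw [Finset.sum_fin_eq_sum_range, ← Finset.sum_range_reflect, Finset.mul_sum]
  induction k with
  | zero => simp
  | succ k ih =>
    rw [Finset.sum_range_succ]
    have h : ∀ i ∈ Finset.range k,
        2 * (if h : k + 1 - 1 - i < k + 1 then k + 1 + 1 - (k + 1 - 1 - i) else 0) =
        2 * (if h : k - 1 - i < k then k + 1 - (k - 1 - i) else 0) := by
      intro i hi
      rw [Finset.mem_range] at hi
      rw [dif_pos (by omega), dif_pos (by omega)]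
      omega
    rw [Finset.sum_congr rfl h, ih, dif_pos (by omega)]
    have : k + 1 + 1 - (k + 1 - 1 - k) = k + 2 := by omega
    rw [this]
    ring

theorem coverSet_eq_empty {F : IntermediateField ℚ Qbar} {n : ℕ} (hn : n ≠ 0) {Y : ℝ}
    (h : Y < |(fieldDiscr F : ℝ)|) : coverSet F n Y = ∅ := by
  rw [Set.eq_empty_iff_forall_notMem]
  rintro K ⟨hcov, hK, hY⟩
  exact absurd (abs_fieldDiscr_le_of_le hcov.le (by rwa [hK])) (not_le.2 (hY.trans_lt h))

theorem coverSet_finite {F : IntermediateField ℚ Qbar} {d k : ℕ} (hd : Module.finrank ℚ F = d)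
    (hd0 : d ≠ 0) (hk : 1 ≤ k) (Y : ℝ) : (coverSet F (d * (k + 1)) Y).Finite := by
  have := finiteDimensional_of_finrank_ne_zero (hd ▸ hd0)
  have : NumberField F := ⟨⟩
  rcases lt_or_ge Y |(fieldDiscr F : ℝ)| with h | h
  · rw [coverSet_eq_empty (by positivity) h]
    exact Set.finite_empty
  · rw [fieldDiscr_eq] at h
    exact (coverSet_finite_and_ncard_le hd hk rfl h rfl).1

theorem exists_ncard_coverSet_le {d k : ℕ} (hd0 : d ≠ 0) (hk : 1 ≤ k) :
    ∃ A : ℝ, 0 < A ∧ ∀ F : IntermediateField ℚ Qbar, Module.finrank ℚ F = d → ∀ Y : ℝ,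
      |(fieldDiscr F : ℝ)| ≤ Y →
      ((coverSet F (d * (k + 1)) Y).ncard : ℝ) ≤
        A * (Y / |(fieldDiscr F : ℝ)|) ^ (((k : ℝ) + 3) / 4) := by
  set a : ℝ := 4 * (k + 1 : ℕ) * (d * k : ℕ) with ha
  have ha1 : 1 ≤ a := by
    have h1 : 1 ≤ 4 * (k + 1) * (d * k) := Nat.one_le_iff_ne_zero.2 (by positivity)
    rw [ha]
    exact_mod_cast h1
  refine ⟨(k + 1) * ∏ j : Fin k, (10 * (a ^ (k + 1 - (j : ℕ)) * (k + 1).choose j)) ^ d,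
    ?_, fun F hd Y hY => ?_⟩
  · refine mul_pos (by positivity) (Finset.prod_pos fun j _ => ?_)
    have : 0 < (k + 1).choose j := Nat.choose_pos (by omega)
    positivity
  have := finiteDimensional_of_finrank_ne_zero (hd ▸ hd0)
  have : NumberField F := ⟨⟩
  have h1F := discr_ne_zero_of_finrank (hd ▸ hd0)
  rw [fieldDiscr_eq] at h1F hY ⊢
  set q := Y / |(discr F : ℝ)| with hq
  have hq1 : 1 ≤ q := (one_le_div (by linarith)).2 hY
  set t := q ^ ((2 * (d * k : ℕ) : ℝ)⁻¹) with ht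
  have ht1 : 1 ≤ t := Real.one_le_rpow hq1 (by positivity)
  obtain ⟨-, hle⟩ := coverSet_finite_and_ncard_le hd hk rfl hY rfl
  have hle' : ((coverSet F (d * (k + 1)) Y).ncard : ℝ) ≤ (k + 1) * ∏ j : Fin k,
      (10 * ((a * t) ^ (k + 1 - (j : ℕ)) * (k + 1).choose j)) ^ d := by
    refine (Nat.cast_le.2 hle).trans ?_
    push_cast
    refine mul_le_mul_of_nonneg_left ?_ (by positivity)
    refine Finset.prod_le_prod (fun j _ => Nat.cast_nonneg _) fun j _ => ?_
    have h1 : (1 : ℝ) ≤ (k + 1).choose j := by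
      exact_mod_cast Nat.choose_pos (by omega)
    have h2 := (finite_and_ncard_forall_norm_le (F := F)
      (one_le_mul_of_one_le_of_one_le (one_le_pow₀ (one_le_mul_of_one_le_of_one_le ha1 ht1)
        (n := k + 1 - (j : ℕ))) h1)).2
    rw [hd] at h2
    rw [ha, ht, hq] at h2
    rw [ha, ht, hq]
    push_cast at h2 ⊢
    exact h2
  refine hle'.trans (le_of_eq ?_)
  have h3 : ∀ j : Fin k, (10 * ((a * t) ^ (k + 1 - (j : ℕ)) * (k + 1).choose j)) ^ d =
      (10 * (a ^ (k + 1 - (j : ℕ)) * (k + 1).choose j)) ^ d * (t ^ d) ^ (k + 1 - (j : ℕ)) := by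
    intro j
    rw [← pow_mul, mul_comm d, pow_mul, ← mul_pow]
    ring
  simp_rw [h3]
  rw [Finset.prod_mul_distrib, Finset.prod_pow_eq_pow_sum, ← mul_assoc]
  congr 1
  rw [ht, ← pow_mul, ← Real.rpow_natCast, ← Real.rpow_mul (by linarith)]
  congr 1
  have h4 : (2 : ℝ) * ((∑ j : Fin k, (k + 1 - (j : ℕ)) : ℕ) : ℝ) = k * (k + 3) := by
    exact_mod_cast sum_fin_add_one_sub k
  have hk' : (k : ℝ) ≠ 0 := by exact_mod_cast (by omega : k ≠ 0)
  have hd' : (d : ℝ) ≠ 0 := by exact_mod_cast hd0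
  rw [Nat.cast_mul, Nat.cast_mul]
  field_simp
  linarith

theorem exists_ncard_coverSet_quadratic_le :
    ∃ A : ℝ, 0 < A ∧ ∀ F : IntermediateField ℚ Qbar, Module.finrank ℚ F = 2 → ∀ Y : ℝ,
      |(fieldDiscr F : ℝ)| ≤ Y →
      ((coverSet F 4 Y).ncard : ℝ) ≤
        A * (Y ^ (1 / 2 : ℝ) * |(fieldDiscr F : ℝ)| ^ (-(1 / 2) : ℝ) +
          Y * |(fieldDiscr F : ℝ)| ^ (-(3 / 2) : ℝ)) := by
  refine ⟨10 * 256 * 1024, by norm_num, fun F hd Y hY => ?_⟩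
  have := finiteDimensional_of_finrank_ne_zero (K := F) (by omega)
  have : NumberField F := ⟨⟩
  have h1F := discr_ne_zero_of_finrank (K := F) (by omega)
  rw [fieldDiscr_eq] at h1F hY ⊢
  set D := |(discr F : ℝ)| with hD
  have hD0 : 0 < D := by linarith
  have hq1 : 1 ≤ Y / D := (one_le_div hD0).2 hY
  obtain ⟨-, hle⟩ := coverSet_finite_and_ncard_le (k := 1) hd le_rfl (r := 2) rfl hY rfl
  have hs1 : 1 ≤ √(Y / D) := Real.one_le_sqrt.2 hq1
  have hR : (4 * ((1 + 1 : ℕ) : ℝ) * (2 : ℕ) * (Y / D) ^ ((2 * (2 : ℕ) : ℝ)⁻¹)) ^ (1 + 1 - 0) *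
      ((1 + 1).choose 0 : ℕ) = 256 * √(Y / D) := by
    have h : ((Y / D) ^ ((2 * (2 : ℕ) : ℝ)⁻¹)) ^ 2 = √(Y / D) := by
      rw [← Real.rpow_natCast, ← Real.rpow_mul (by linarith), Real.sqrt_eq_rpow]
      norm_num
    norm_num [mul_pow] at h ⊢
    rw [h]
  rw [Fin.prod_univ_one] at hle
  have h2 := ncard_forall_norm_le_of_finrank_eq_two hd (B := 256 * √(Y / D)) (by linarith)
  rw [← hR] at h2
  have hle' := (Nat.cast_le (α := ℝ).2 hle)
  rw [Nat.cast_mul] at hle'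
  have h3 := hle'.trans (mul_le_mul_of_nonneg_left h2 (Nat.cast_nonneg _))
  rw [hR] at h3
  refine h3.trans ?_
  have e1 : √(Y / D) = Y ^ (1 / 2 : ℝ) * D ^ (-(1 / 2) : ℝ) := by
    rw [Real.sqrt_eq_rpow, Real.div_rpow (by linarith) hD0.le, Real.rpow_neg hD0.le,
      div_eq_mul_inv]
  have e2 : √(Y / D) * (√(Y / D) / √D) = Y * D ^ (-(3 / 2) : ℝ) := by
    rw [← mul_div_assoc, Real.mul_self_sqrt (by linarith), div_div, div_eq_mul_inv,
      Real.rpow_neg hD0.le, Real.sqrt_eq_rpow, ← Real.rpow_one_add' hD0.le (by norm_num)]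
    norm_num
  rw [← e1, ← e2]
  set s := √(Y / D)
  have h4 : ((1 + 1 : ℕ) : ℝ) * (5 * (256 * s) * (4 * (256 * s) / √D + 1)) =
     10 * 256 * (1024 * (s * (s / √D)) + s) := by
    push_cast
    ring
  rw [h4]
  have h5 : 0 ≤ s := by linarith
  linarith

theorem sum_rpow_neg_le_dyadic {ι : Type*} (T : Finset ι) (D : ι → ℝ) {A a s Y : ℝ}
    (hs : 0 ≤ s) (hD : ∀ i ∈ T, 1 ≤ D i) (hDY : ∀ i ∈ T, D i ≤ Y)
    (hT : ∀ Z, 1 ≤ Z → (((T.filter fun i => D i ≤ Z).card : ℕ) : ℝ) ≤ A * Z ^ a)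
    (hY : 1 ≤ Y) :
    ∃ L : ℕ, (2 : ℝ) ^ L ≤ Y ∧
      ∑ i ∈ T, D i ^ (-s) ≤ A * 2 ^ a * ∑ l ∈ Finset.range (L + 1), ((2 : ℝ) ^ (a - s)) ^ l := by
  classical
  have hl : ∀ i, ∃ l : ℕ, i ∈ T → (2 : ℝ) ^ l ≤ D i ∧ D i < 2 ^ (l + 1) := by
    intro i
    by_cases hi : i ∈ T
    · obtain ⟨l, h⟩ := exists_nat_pow_near (hD i hi) one_lt_two
      exact ⟨l, fun _ => h⟩
    · exact ⟨0, fun h => absurd h hi⟩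
  choose l hl using hl
  obtain ⟨L, hL1, hL2⟩ := exists_nat_pow_near hY one_lt_two
  refine ⟨L, hL1, ?_⟩
  have hmaps : ∀ i ∈ T, l i ∈ Finset.range (L + 1) := by
    intro i hi
    have h1 := (hl i hi).1.trans_lt ((hDY i hi).trans_lt hL2)
    exact Finset.mem_range.2 ((pow_lt_pow_iff_right₀ one_lt_two).1 h1)
  rw [← Finset.sum_fiberwise_of_maps_to hmaps, Finset.mul_sum]
  refine Finset.sum_le_sum fun j _ => ?_
  have h2 : ∀ i ∈ T.filter fun i => l i = j, D i ^ (-s) ≤ ((2 : ℝ) ^ j) ^ (-s) := by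
    intro i hi
    obtain ⟨hiT, rfl⟩ := Finset.mem_filter.1 hi
    exact Real.rpow_le_rpow_of_nonpos (by positivity) (hl i hiT).1 (by linarith)
  have h3 : (((T.filter fun i => l i = j).card : ℕ) : ℝ) ≤ A * ((2 : ℝ) ^ (j + 1)) ^ a := by
    refine le_trans ?_ (hT _ (one_le_pow₀ one_le_two))
    refine Nat.cast_le.2 (Finset.card_le_card fun i hi => ?_)
    obtain ⟨hiT, rfl⟩ := Finset.mem_filter.1 hi
    exact Finset.mem_filter.2 ⟨hiT, (hl i hiT).2.le⟩
  calc ∑ i ∈ T with l i = j, D i ^ (-s) ≤ (T.filter fun i => l i = j).card • ((2 : ℝ) ^ j) ^ (-s) :=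
        Finset.sum_le_card_nsmul _ _ _ h2
    _ ≤ A * ((2 : ℝ) ^ (j + 1)) ^ a * ((2 : ℝ) ^ j) ^ (-s) := by
        rw [nsmul_eq_mul]
        gcongr
    _ = A * 2 ^ a * ((2 : ℝ) ^ (a - s)) ^ j := by
        rw [pow_succ, Real.mul_rpow (by positivity) (by positivity), ← Real.rpow_natCast,
          ← Real.rpow_mul (by positivity), ← Real.rpow_mul (by positivity),
          ← Real.rpow_natCast, ← Real.rpow_mul (by positivity), mul_assoc, mul_assoc, mul_assoc,
          mul_comm ((2 : ℝ) ^ (j * a)), mul_assoc, ← Real.rpow_add (by positivity)]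
        ring_nf

theorem sum_rpow_neg_le_of_lt {ι : Type*} (D : ι → ℝ) {A a s : ℝ} (hA : 0 ≤ A)
    (hs : 0 ≤ s) (has : a < s) {T : Finset ι} {Y : ℝ} (hY : 1 ≤ Y) (hD : ∀ i ∈ T, 1 ≤ D i)
    (hDY : ∀ i ∈ T, D i ≤ Y)
    (hT : ∀ Z, 1 ≤ Z → (((T.filter fun i => D i ≤ Z).card : ℕ) : ℝ) ≤ A * Z ^ a) :
    ∑ i ∈ T, D i ^ (-s) ≤ A * 2 ^ a * (1 - 2 ^ (a - s))⁻¹ := by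
  obtain ⟨L, -, h⟩ := sum_rpow_neg_le_dyadic T D hs hD hDY hT hY
  refine h.trans (mul_le_mul_of_nonneg_left ?_ (by positivity))
  have h1 : (2 : ℝ) ^ (a - s) < 1 := Real.rpow_lt_one_of_one_lt_of_neg one_lt_two (by linarith)
  rw [← tsum_geometric_of_lt_one (by positivity) h1]
  exact (summable_geometric_of_lt_one (by positivity) h1).sum_le_tsum _ fun _ _ => by positivity

theorem sum_rpow_neg_le_of_gt {ι : Type*} (D : ι → ℝ) {A a s : ℝ} (hA : 0 ≤ A)
    (hs : 0 ≤ s) (has : s < a) {T : Finset ι} {Y : ℝ} (hY : 1 ≤ Y) (hD : ∀ i ∈ T, 1 ≤ D i)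
    (hDY : ∀ i ∈ T, D i ≤ Y)
    (hT : ∀ Z, 1 ≤ Z → (((T.filter fun i => D i ≤ Z).card : ℕ) : ℝ) ≤ A * Z ^ a) :
    ∑ i ∈ T, D i ^ (-s) ≤ A * 2 ^ a * (2 ^ (a - s) / (2 ^ (a - s) - 1)) * Y ^ (a - s) := by
  obtain ⟨L, hL, h⟩ := sum_rpow_neg_le_dyadic T D hs hD hDY hT hY
  rw [mul_assoc]
  refine h.trans (mul_le_mul_of_nonneg_left ?_ (by positivity))
  have h1 : 1 < (2 : ℝ) ^ (a - s) := Real.one_lt_rpow one_lt_two (by linarith)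
  have h2 : ((2 : ℝ) ^ (a - s)) ^ L ≤ Y ^ (a - s) := by
    rw [← Real.rpow_natCast, ← Real.rpow_mul (by positivity), mul_comm,
      Real.rpow_mul (by positivity), Real.rpow_natCast]
    exact Real.rpow_le_rpow (by positivity) hL (by linarith)
  have h3 : 0 < (2 : ℝ) ^ (a - s) - 1 := by linarith
  rw [geom_sum_eq h1.ne', div_mul_eq_mul_div]
  gcongr
  rw [pow_succ]
  nlinarith

theorem exists_le_covBy {K : IntermediateField ℚ Qbar} [FiniteDimensional ℚ K]
    {E : IntermediateField ℚ Qbar} (h : E < K) : ∃ F, E ≤ F ∧ F ⋖ K := by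
  have hfin : ∀ F, F ≤ K → Module.finrank ℚ F ≤ Module.finrank ℚ K := fun F hF =>
    LinearMap.finrank_le_finrank_of_injective (f := (IntermediateField.inclusion hF).toLinearMap)
      (IntermediateField.inclusion hF).injective
  induction hk : Module.finrank ℚ K - Module.finrank ℚ E using Nat.strong_induction_on
    generalizing E with
  | _ k ih =>
    by_cases hcov : E ⋖ K
    · exact ⟨E, le_rfl, hcov⟩
    · obtain ⟨H, hEH, hHK⟩ := (not_covBy_iff h).1 hcov
      have : FiniteDimensional ℚ H :=
        FiniteDimensional.of_injective (IntermediateField.inclusion hHK.le).toLinearMap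
          (IntermediateField.inclusion hHK.le).injective
      have h1 : Module.finrank ℚ E < Module.finrank ℚ H := by
        by_contra hle
        exact hEH.ne (IntermediateField.eq_of_le_of_finrank_le hEH.le (not_lt.1 hle))
      obtain ⟨F, hF, hFK⟩ := ih _ (by have := hfin H hHK.le; omega) hHK rfl
      exact ⟨F, hEH.le.trans hF, hFK⟩

theorem finrank_eq_mul_of_covBy {F K : IntermediateField ℚ Qbar} [FiniteDimensional ℚ K]
    (h : F < K) : Module.finrank ℚ F ≠ 0 ∧
      ∃ k, 1 ≤ k ∧ Module.finrank ℚ K = Module.finrank ℚ F * (k + 1) := by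
  have : FiniteDimensional ℚ F :=
    FiniteDimensional.of_injective (IntermediateField.inclusion h.le).toLinearMap
      (IntermediateField.inclusion h.le).injective
  let _ : Algebra F K := (IntermediateField.inclusion h.le).toAlgebra
  have h1 := Module.finrank_mul_finrank ℚ F K
  have h2 : 0 < Module.finrank ℚ K := Module.finrank_pos
  have h3 : Module.finrank F K ≠ 1 := by
    intro h3
    rw [h3, mul_one] at h1
    exact h.ne (IntermediateField.eq_of_le_of_finrank_eq h.le h1)
  have h4 : Module.finrank F K ≠ 0 := by
    intro h4
    rw [h4] at h1
    omega
  refine ⟨Module.finrank_pos.ne', Module.finrank F K - 1, by omega, ?_⟩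
  rw [← h1]
  congr 1
  omega

/-- The subfields of `ℚ̄` of degree `n` and discriminant at most `X` having a maximal proper
subfield of degree `d`. -/
def coverUnion (d n : ℕ) (X : ℝ) : Set (IntermediateField ℚ Qbar) :=
  {K | Module.finrank ℚ K = n ∧ |(fieldDiscr K : ℝ)| ≤ X ∧
    ∃ F : IntermediateField ℚ Qbar, Module.finrank ℚ F = d ∧ F ⋖ K}

/-- The subfields of `ℚ̄` of degree `n` and discriminant at most `X`. -/
def fieldSet (n : ℕ) (X : ℝ) : Set (IntermediateField ℚ Qbar) :=
  {K | Module.finrank ℚ K = n ∧ |(fieldDiscr K : ℝ)| ≤ X}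

theorem coverUnion_ncard_le {d k : ℕ} (hd : d ≠ 0) (hk : 1 ≤ k) {Y : ℝ}
    (hfin : (fieldSet d Y).Finite) :
    (coverUnion d (d * (k + 1)) Y).Finite ∧
      (coverUnion d (d * (k + 1)) Y).ncard ≤
        ∑ F ∈ hfin.toFinset, (coverSet F (d * (k + 1)) Y).ncard := by
  have hsub : coverUnion d (d * (k + 1)) Y ⊆
      ⋃ F ∈ hfin.toFinset, coverSet F (d * (k + 1)) Y := by
    rintro K ⟨hn, hY, F, hF, hcov⟩
    simp only [Set.mem_iUnion, Set.Finite.mem_toFinset]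
    refine ⟨F, ⟨hF, (abs_fieldDiscr_le_of_le hcov.le ?_).trans hY⟩, hcov, hn, hY⟩
    rw [hn]
    positivity
  have hU : (⋃ F ∈ hfin.toFinset, coverSet F (d * (k + 1)) Y).Finite :=
    hfin.toFinset.finite_toSet.biUnion fun F hF =>
      coverSet_finite (hfin.mem_toFinset.1 hF).1 hd hk Y
  exact ⟨hU.subset hsub, (Set.ncard_le_ncard hsub hU).trans (Finset.set_ncard_biUnion_le _ _)⟩

/-- Finiteness of `fieldSet d Y`, with the bound `O(Y ^ ((d + 2) / 4))` on its size. -/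
def CountBound (d : ℕ) : Prop :=
  ∃ A : ℝ, 0 < A ∧ ∀ Y : ℝ, 1 ≤ Y →
    (fieldSet d Y).Finite ∧ ((fieldSet d Y).ncard : ℝ) ≤ A * Y ^ (((d : ℝ) + 2) / 4)

theorem card_filter_le_of_countBound {d : ℕ} {A Y : ℝ}
    (hA : ∀ Y : ℝ, 1 ≤ Y →
      (fieldSet d Y).Finite ∧ ((fieldSet d Y).ncard : ℝ) ≤ A * Y ^ (((d : ℝ) + 2) / 4))
    (hfin : (fieldSet d Y).Finite) {Z : ℝ} (hZ : 1 ≤ Z) :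
    (((hfin.toFinset.filter fun F => |(fieldDiscr F : ℝ)| ≤ Z).card : ℕ) : ℝ) ≤
      A * Z ^ (((d : ℝ) + 2) / 4) := by
  refine le_trans (Nat.cast_le.2 ?_) (hA Z hZ).2
  rw [← Set.ncard_coe_finset]
  refine Set.ncard_le_ncard (fun F hF => ?_) (hA Z hZ).1
  obtain ⟨h1, h2⟩ := Finset.mem_filter.1 (Finset.mem_coe.1 hF)
  exact ⟨(hfin.mem_toFinset.1 h1).1, h2⟩

theorem div_abs_rpow_eq {Y D s : ℝ} (hY : 0 ≤ Y) (hD : 0 ≤ D) :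
    (Y / D) ^ s = Y ^ s * D ^ (-s) := by
  rw [Real.div_rpow hY hD, Real.rpow_neg hD, div_eq_mul_inv]

theorem exists_ncard_coverUnion_le_of_three_le {d k : ℕ} (hd : 3 ≤ d) (hk : 1 ≤ k)
    (hc : CountBound d) :
    ∃ A : ℝ, 0 < A ∧ ∀ Y : ℝ, 1 ≤ Y → ((coverUnion d (d * (k + 1)) Y).ncard : ℝ) ≤
      A * Y ^ (((d * (k + 1) : ℕ) + 4 : ℝ) / 8) := by
  obtain ⟨A, hA0, hA⟩ := hc
  obtain ⟨B, hB0, hB⟩ := exists_ncard_coverSet_le (d := d) (by omega) hk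
  set a : ℝ := ((d * (k + 1) : ℕ) + 4 : ℝ) / 8 with ha
  set s : ℝ := ((k : ℝ) + 3) / 4 with hs
  have hk' : (1 : ℝ) ≤ k := by exact_mod_cast hk
  have hd' : (3 : ℝ) ≤ d := by exact_mod_cast hd
  have hs0 : 0 ≤ s := by positivity
  have hsa : s < a := by
    rw [hs, ha]
    push_cast
    nlinarith
  have hda : ((d : ℝ) + 2) / 4 ≤ a := by
    rw [ha]
    push_cast
    nlinarith
  have h1 : 1 < (2 : ℝ) ^ (a - s) := Real.one_lt_rpow one_lt_two (by linarith)
  have h2 : 0 < (2 : ℝ) ^ (a - s) - 1 := by linarith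
  refine ⟨B * (A * 2 ^ a * (2 ^ (a - s) / (2 ^ (a - s) - 1))), by positivity, fun Y hY => ?_⟩
  have hfin := (hA Y hY).1
  have hsum := sum_rpow_neg_le_of_gt (T := hfin.toFinset) (fun F => |(fieldDiscr F : ℝ)|)
    hA0.le hs0 hsa hY
    (fun F hF => discr_ne_zero_of_finrank (by rw [(hfin.mem_toFinset.1 hF).1]; omega))
    (fun F hF => (hfin.mem_toFinset.1 hF).2)
    (fun Z hZ => (card_filter_le_of_countBound hA hfin hZ).trans
      (mul_le_mul_of_nonneg_left (Real.rpow_le_rpow_of_exponent_le hZ hda) hA0.le))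
  have hle := Nat.cast_le (α := ℝ).2 (coverUnion_ncard_le (by omega) hk hfin).2
  rw [Nat.cast_sum] at hle
  calc _ ≤ _ := hle
    _ ≤ ∑ F ∈ hfin.toFinset, B * Y ^ s * |(fieldDiscr F : ℝ)| ^ (-s) := by
      refine Finset.sum_le_sum fun F hF => ?_
      have hF' := hfin.mem_toFinset.1 hF
      rw [mul_assoc, ← div_abs_rpow_eq (by linarith) (abs_nonneg _)]
      exact hB F hF'.1 Y hF'.2
    _ ≤ B * Y ^ s * (A * 2 ^ a * (2 ^ (a - s) / (2 ^ (a - s) - 1)) * Y ^ (a - s)) := by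
      rw [← Finset.mul_sum]
      exact mul_le_mul_of_nonneg_left hsum (by positivity)
    _ = B * (A * 2 ^ a * (2 ^ (a - s) / (2 ^ (a - s) - 1))) * (Y ^ s * Y ^ (a - s)) := by ring
    _ = _ := by rw [← Real.rpow_add (by linarith), add_sub_cancel]

theorem exists_ncard_coverUnion_le_of_two {k : ℕ} (hk : 2 ≤ k) (hc : CountBound 2) :
    ∃ A : ℝ, 0 < A ∧ ∀ Y : ℝ, 1 ≤ Y → ((coverUnion 2 (2 * (k + 1)) Y).ncard : ℝ) ≤
      A * Y ^ (((2 * (k + 1) : ℕ) + 4 : ℝ) / 8) := by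
  obtain ⟨A, hA0, hA⟩ := hc
  obtain ⟨B, hB0, hB⟩ := exists_ncard_coverSet_le (d := 2) (k := k) (by omega) (by omega)
  set a : ℝ := (((2 : ℕ) : ℝ) + 2) / 4 with ha
  set s : ℝ := ((k : ℝ) + 3) / 4 with hs
  have hk' : (2 : ℝ) ≤ k := by exact_mod_cast hk
  have hs0 : 0 ≤ s := by positivity
  have hsa : a < s := by
    rw [hs, ha]
    push_cast
    linarith
  have hexp : ((2 * (k + 1) : ℕ) + 4 : ℝ) / 8 = s := by
    rw [hs]
    push_cast
    ring
  rw [hexp]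
  have h1 : (2 : ℝ) ^ (a - s) < 1 := Real.rpow_lt_one_of_one_lt_of_neg one_lt_two (by linarith)
  have h2 : 0 < 1 - (2 : ℝ) ^ (a - s) := by linarith
  refine ⟨B * (A * 2 ^ a * (1 - 2 ^ (a - s))⁻¹), by positivity, fun Y hY => ?_⟩
  have hfin := (hA Y hY).1
  have hsum := sum_rpow_neg_le_of_lt (T := hfin.toFinset) (fun F => |(fieldDiscr F : ℝ)|)
    hA0.le hs0 hsa hY
    (fun F hF => discr_ne_zero_of_finrank (by rw [(hfin.mem_toFinset.1 hF).1]; omega))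
    (fun F hF => (hfin.mem_toFinset.1 hF).2)
    (fun Z hZ => card_filter_le_of_countBound hA hfin hZ)
  have hle := Nat.cast_le (α := ℝ).2 (coverUnion_ncard_le two_ne_zero (by omega) hfin (k := k)).2
  rw [Nat.cast_sum] at hle
  calc _ ≤ _ := hle
    _ ≤ ∑ F ∈ hfin.toFinset, B * Y ^ s * |(fieldDiscr F : ℝ)| ^ (-s) := by
      refine Finset.sum_le_sum fun F hF => ?_
      have hF' := hfin.mem_toFinset.1 hF
      rw [mul_assoc, ← div_abs_rpow_eq (by linarith) (abs_nonneg _)]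
      exact hB F hF'.1 Y hF'.2
    _ ≤ B * Y ^ s * (A * 2 ^ a * (1 - 2 ^ (a - s))⁻¹) := by
      rw [← Finset.mul_sum]
      exact mul_le_mul_of_nonneg_left hsum (by positivity)
    _ = _ := by ring

theorem exists_ncard_coverUnion_two_four_le (hc : CountBound 2) :
    ∃ A : ℝ, 0 < A ∧ ∀ Y : ℝ, 1 ≤ Y → ((coverUnion 2 4 Y).ncard : ℝ) ≤ A * Y := by
  obtain ⟨A, hA0, hA⟩ := hc
  obtain ⟨B, hB0, hB⟩ := exists_ncard_coverSet_quadratic_le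
  set a : ℝ := (((2 : ℕ) : ℝ) + 2) / 4 with ha
  have ha1 : a = 1 := by rw [ha]; norm_num
  have h1 : 1 < (2 : ℝ) ^ (a - 1 / 2) := Real.one_lt_rpow one_lt_two (by linarith)
  have h2 : (2 : ℝ) ^ (a - 3 / 2) < 1 :=
    Real.rpow_lt_one_of_one_lt_of_neg one_lt_two (by linarith)
  have h1' : 0 < (2 : ℝ) ^ (a - 1 / 2) - 1 := by linarith
  have h2' : 0 < 1 - (2 : ℝ) ^ (a - 3 / 2) := by linarith
  set C₁ := A * 2 ^ a * (2 ^ (a - 1 / 2) / (2 ^ (a - 1 / 2) - 1)) with hC₁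
  set C₂ := A * 2 ^ a * (1 - 2 ^ (a - 3 / 2))⁻¹ with hC₂
  refine ⟨B * (C₁ + C₂), by positivity, fun Y hY => ?_⟩
  have hfin := (hA Y hY).1
  have hD1 : ∀ F ∈ hfin.toFinset, 1 ≤ |(fieldDiscr F : ℝ)| := fun F hF =>
    discr_ne_zero_of_finrank (by rw [(hfin.mem_toFinset.1 hF).1]; omega)
  have hDY : ∀ F ∈ hfin.toFinset, |(fieldDiscr F : ℝ)| ≤ Y := fun F hF =>
    (hfin.mem_toFinset.1 hF).2
  have hcard := fun (Z : ℝ) (hZ : 1 ≤ Z) => card_filter_le_of_countBound hA hfin hZ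
  have hsum1 := sum_rpow_neg_le_of_gt (s := 1 / 2) (fun F => |(fieldDiscr F : ℝ)|)
    hA0.le (by norm_num) (by linarith) hY hD1 hDY hcard
  have hsum2 := sum_rpow_neg_le_of_lt (s := 3 / 2) (fun F => |(fieldDiscr F : ℝ)|)
    hA0.le (by norm_num) (by linarith) hY hD1 hDY hcard
  have hle := Nat.cast_le (α := ℝ).2 (coverUnion_ncard_le two_ne_zero le_rfl hfin (k := 1)).2
  rw [Nat.cast_sum] at hle
  calc _ ≤ _ := hle
    _ ≤ ∑ F ∈ hfin.toFinset, B * (Y ^ (1 / 2 : ℝ) * |(fieldDiscr F : ℝ)| ^ (-(1 / 2) : ℝ) +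
          Y * |(fieldDiscr F : ℝ)| ^ (-(3 / 2) : ℝ)) := by
      refine Finset.sum_le_sum fun F hF => ?_
      have hF' := hfin.mem_toFinset.1 hF
      exact hB F hF'.1 Y hF'.2
    _ ≤ B * (Y ^ (1 / 2 : ℝ) * (C₁ * Y ^ (a - 1 / 2)) + Y * C₂) := by
      rw [← Finset.mul_sum, Finset.sum_add_distrib, ← Finset.mul_sum, ← Finset.mul_sum]
      gcongr
    _ = B * (C₁ * (Y ^ (1 / 2 : ℝ) * Y ^ (a - 1 / 2)) + Y * C₂) := by ring
    _ = _ := by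
      rw [← Real.rpow_add (by linarith), add_sub_cancel, ha1, Real.rpow_one]
      ring

theorem exists_ncard_coverUnion_le {d k : ℕ} (hd : 2 ≤ d) (hk : 1 ≤ k) (hc : CountBound d) :
    ∃ A : ℝ, 0 < A ∧ ∀ Y : ℝ, 1 ≤ Y → (coverUnion d (d * (k + 1)) Y).Finite ∧
      ((coverUnion d (d * (k + 1)) Y).ncard : ℝ) ≤
        A * Y ^ (((d * (k + 1) : ℕ) + 4 : ℝ) / 8) := by
  have hfin : ∀ Y : ℝ, 1 ≤ Y → (coverUnion d (d * (k + 1)) Y).Finite := fun Y hY =>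
    (coverUnion_ncard_le (by omega) hk (hc.choose_spec.2 Y hY).1).1
  obtain ⟨A, hA0, hA⟩ : ∃ A : ℝ, 0 < A ∧ ∀ Y : ℝ, 1 ≤ Y →
      ((coverUnion d (d * (k + 1)) Y).ncard : ℝ) ≤
        A * Y ^ (((d * (k + 1) : ℕ) + 4 : ℝ) / 8) := by
    rcases hd.eq_or_lt with rfl | hd
    · rcases hk.eq_or_lt with rfl | hk
      · obtain ⟨A, hA0, hA⟩ := exists_ncard_coverUnion_two_four_le hc
        refine ⟨A, hA0, fun Y hY => (hA Y hY).trans (le_of_eq ?_)⟩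
        norm_num
      · exact exists_ncard_coverUnion_le_of_two hk hc
    · exact exists_ncard_coverUnion_le_of_three_le hd hk hc
  exact ⟨A, hA0, fun Y hY => ⟨hfin Y hY, hA Y hY⟩⟩

theorem fieldSet_one_subset (Y : ℝ) : fieldSet 1 Y ⊆ {⊥} := fun _ hF =>
  IntermediateField.finrank_eq_one_iff.1 hF.1

theorem countBound_one : CountBound 1 := by
  refine ⟨1, one_pos, fun Y hY => ⟨(Set.finite_singleton _).subset (fieldSet_one_subset Y), ?_⟩⟩
  have h1 : (fieldSet 1 Y).ncard ≤ 1 := by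
    have h := Set.ncard_le_ncard (fieldSet_one_subset Y)
    rwa [Set.ncard_singleton] at h
  rw [one_mul]
  exact (Nat.cast_le_one.2 h1).trans (Real.one_le_rpow hY (by positivity))

theorem exists_ncard_coverUnion_one_le {k : ℕ} (hk : 1 ≤ k) :
    ∃ A : ℝ, 0 < A ∧ ∀ Y : ℝ, 1 ≤ Y → (coverUnion 1 (1 * (k + 1)) Y).Finite ∧
      ((coverUnion 1 (1 * (k + 1)) Y).ncard : ℝ) ≤
        A * Y ^ (((1 * (k + 1) : ℕ) + 2 : ℝ) / 4) := by
  obtain ⟨B, hB0, hB⟩ := exists_ncard_coverSet_le one_ne_zero hk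
  refine ⟨B, hB0, fun Y hY => ?_⟩
  obtain ⟨A, -, hA⟩ := countBound_one
  have hfin := (hA Y hY).1
  obtain ⟨h1, h2⟩ := coverUnion_ncard_le one_ne_zero hk hfin
  refine ⟨h1, ?_⟩
  have h3 : hfin.toFinset ⊆ {⊥} := by
    intro F hF
    simpa using fieldSet_one_subset Y (hfin.mem_toFinset.1 hF)
  have h4 : ∀ F ∈ hfin.toFinset, ((coverSet F (1 * (k + 1)) Y).ncard : ℝ) ≤
      B * Y ^ (((1 * (k + 1) : ℕ) + 2 : ℝ) / 4) := by
    intro F hF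
    have hF' := hfin.mem_toFinset.1 hF
    have hD := discr_ne_zero_of_finrank (K := F) (by rw [hF'.1]; omega)
    refine (hB F hF'.1 Y hF'.2).trans ?_
    have h5 : (((1 * (k + 1) : ℕ) + 2 : ℝ) / 4) = ((k : ℝ) + 3) / 4 := by
      push_cast
      ring
    rw [h5]
    gcongr
    exact div_le_self (by linarith) hD
  refine (Nat.cast_le.2 h2).trans ?_
  rw [Nat.cast_sum]
  refine (Finset.sum_le_card_nsmul _ _ _ h4).trans ?_
  rw [nsmul_eq_mul]
  refine mul_le_of_le_one_left (by positivity) ?_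
  exact_mod_cast (Finset.card_le_card h3).trans (by simp)

theorem exists_ncard_le_of_subset_coverUnion {e n : ℕ} (hn : n ≠ 0)
    {S : ℝ → Set (IntermediateField ℚ Qbar)} {α : ℝ}
    (hS : ∀ Y, ∀ K ∈ S Y, Module.finrank ℚ K = n ∧ |(fieldDiscr K : ℝ)| ≤ Y ∧
      ∃ F : IntermediateField ℚ Qbar, e ≤ Module.finrank ℚ F ∧ F ⋖ K)
    (hU : ∀ d k, e ≤ d → d ≠ 0 → 1 ≤ k → n = d * (k + 1) → ∃ A : ℝ, 0 < A ∧ ∀ Y : ℝ, 1 ≤ Y →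
      (coverUnion d n Y).Finite ∧ ((coverUnion d n Y).ncard : ℝ) ≤ A * Y ^ α) :
    ∃ A : ℝ, 0 < A ∧ ∀ Y : ℝ, 1 ≤ Y → (S Y).Finite ∧ ((S Y).ncard : ℝ) ≤ A * Y ^ α := by
  classical
  let J : Finset ℕ := (Finset.range n).filter fun d =>
    e ≤ d ∧ d ≠ 0 ∧ ∃ k, 1 ≤ k ∧ n = d * (k + 1)
  have hJ : ∀ d, ∃ A : ℝ, 0 < A ∧ (d ∈ J → ∀ Y : ℝ, 1 ≤ Y →
      (coverUnion d n Y).Finite ∧ ((coverUnion d n Y).ncard : ℝ) ≤ A * Y ^ α) := by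
    intro d
    by_cases hd : d ∈ J
    · obtain ⟨-, he, hd0, k, hk, hnk⟩ := Finset.mem_filter.1 hd
      obtain ⟨A, hA0, hA⟩ := hU d k he hd0 hk hnk
      exact ⟨A, hA0, fun _ => hA⟩
    · exact ⟨1, one_pos, fun h => absurd h hd⟩
  choose A hA0 hA using hJ
  refine ⟨1 + ∑ d ∈ J, A d, add_pos_of_pos_of_nonneg one_pos
    (Finset.sum_nonneg fun d _ => (hA0 d).le), fun Y hY => ?_⟩
  have hsub : S Y ⊆ ⋃ d ∈ J, coverUnion d n Y := by
    intro K hK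
    obtain ⟨h1, h2, F, hF, hcov⟩ := hS Y K hK
    have := finiteDimensional_of_finrank_ne_zero (K := K) (by rw [h1]; exact hn)
    obtain ⟨hF0, k, hk, hnk⟩ := finrank_eq_mul_of_covBy hcov.lt
    rw [h1] at hnk
    simp only [Set.mem_iUnion]
    refine ⟨Module.finrank ℚ F, Finset.mem_filter.2 ⟨?_, hF, hF0, k, hk, hnk⟩,
      h1, h2, F, rfl, hcov⟩
    rw [Finset.mem_range]
    have := Nat.pos_of_ne_zero hF0
    nlinarith
  have hfin : (⋃ d ∈ J, coverUnion d n Y).Finite :=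
    J.finite_toSet.biUnion fun d hd => (hA d hd Y hY).1
  refine ⟨hfin.subset hsub, ?_⟩
  have hle := (Set.ncard_le_ncard hsub hfin).trans (Finset.set_ncard_biUnion_le J _)
  refine (Nat.cast_le.2 hle).trans ?_
  rw [Nat.cast_sum, add_mul, Finset.sum_mul]
  refine (Finset.sum_le_sum fun d hd => (hA d hd Y hY).2).trans ?_
  exact le_add_of_nonneg_left (by positivity)

theorem countBound (n : ℕ) (hn : n ≠ 0) : CountBound n := by
  induction n using Nat.strong_induction_on with
  | _ n ih =>
    rcases eq_or_ne n 1 with rfl | h1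
    · exact countBound_one
    refine exists_ncard_le_of_subset_coverUnion (e := 1) hn (fun Y K hK => ⟨hK.1, hK.2, ?_⟩) ?_
    · have := finiteDimensional_of_finrank_ne_zero (K := K) (by rw [hK.1]; exact hn)
      have hbot : ⊥ < K := by
        rw [bot_lt_iff_ne_bot]
        rintro rfl
        exact h1 (hK.1.symm.trans IntermediateField.finrank_bot)
      obtain ⟨F, -, hcov⟩ := exists_le_covBy hbot
      exact ⟨F, Nat.one_le_iff_ne_zero.2 (finrank_eq_mul_of_covBy hcov.lt).1, hcov⟩
    · rintro d k - hd0 hk rfl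
      rcases eq_or_ne d 1 with rfl | hd1
      · exact exists_ncard_coverUnion_one_le hk
      · have hlt : d < d * (k + 1) := by
          have := Nat.pos_of_ne_zero hd0
          nlinarith
        obtain ⟨A, hA0, hA⟩ := exists_ncard_coverUnion_le (by omega) hk (ih d hlt hd0)
        refine ⟨A, hA0, fun Y hY => ⟨(hA Y hY).1, (hA Y hY).2.trans ?_⟩⟩
        refine mul_le_mul_of_nonneg_left (Real.rpow_le_rpow_of_exponent_le hY ?_) hA0.le
        have : (0 : ℝ) ≤ (d * (k + 1) : ℕ) := Nat.cast_nonneg _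
        linarith

end

theorem exists_bot_lt_lt_of_isImprimitiveSub_range {k E β : Type*} [Field k] [Field E]
    [Algebra k E] [IsGalois k E] [Finite β] (L : IntermediateField k E) [FiniteDimensional k L]
    (P : (E ≃ₐ[k] E) →* Equiv.Perm β) (x₀ : β)
    (hfix : ∀ τ, P τ x₀ = x₀ ↔ τ ∈ L.fixingSubgroup) (hP : IsImprimitiveSub P.range) :
    ∃ F : IntermediateField k E, ⊥ < F ∧ F < L := by
  obtain ⟨htrans, m, R, hm, hne, ⟨i, hi⟩, hpart, hperm⟩ := hP
  obtain ⟨j₀, hj₀, hj₀u⟩ := hpart x₀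
  have huniq : ∀ {x a b}, x ∈ R a → x ∈ R b → a = b := fun ha hb => (hpart _).unique ha hb
  have hblock : ∀ τ, ∀ b ∈ R j₀, P τ b ∈ R j₀ → (fun x => P τ x) '' R j₀ = R j₀ := by
    intro τ b hb hτb
    obtain ⟨j, hj⟩ := hperm (P τ) (⟨τ, rfl⟩) j₀
    have hjj : j = j₀ := huniq (hj ▸ Set.mem_image_of_mem (fun x => P τ x) hb) hτb
    rw [hj, hjj]
  obtain ⟨y₀, hy₀, hy₀x⟩ : ∃ y ∈ R j₀, y ≠ x₀ := by
    obtain ⟨x, hx, y, hy, hxy⟩ := (Set.one_lt_ncard (Set.toFinite (R i))).1 hi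
    obtain ⟨σ, hσ, hσx⟩ := htrans x x₀
    obtain ⟨j, hj⟩ := hperm σ hσ i
    have h1 : x₀ ∈ R j := hj ▸ ⟨x, hx, hσx⟩
    refine ⟨σ y, ?_, fun h => hxy (σ.injective (hσx.trans h.symm))⟩
    rw [← hj₀u j h1, ← hj]
    exact Set.mem_image_of_mem _ hy
  obtain ⟨z, hz⟩ : ∃ z, z ∉ R j₀ := by
    have : Nontrivial (Fin m) := Fin.nontrivial_iff_two_le.2 hm
    obtain ⟨j₁, hj₁⟩ := exists_ne j₀
    obtain ⟨z, hz⟩ := hne j₁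
    exact ⟨z, fun h => hj₁ (huniq hz h)⟩
  let H : Subgroup (E ≃ₐ[k] E) :=
    { carrier := {τ | P τ x₀ ∈ R j₀}
      one_mem' := by simpa using hj₀
      mul_mem' := by
        intro σ τ hσ hτ
        change P (σ * τ) x₀ ∈ R j₀
        rw [map_mul, Equiv.Perm.mul_apply]
        rw [← hblock σ x₀ hj₀ hσ]
        exact Set.mem_image_of_mem _ hτ
      inv_mem' := by
        intro τ hτ
        have h : x₀ ∈ (fun x => P τ x) '' R j₀ := by rwa [hblock τ x₀ hj₀ hτ]
        obtain ⟨b, hb, hbx⟩ := h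
        change P τ⁻¹ x₀ ∈ R j₀
        rw [map_inv, ← hbx]
        exact (Equiv.symm_apply_apply (P τ) b).symm ▸ hb }
  have hle : L.fixingSubgroup ≤ H := by
    intro τ hτ
    change P τ x₀ ∈ R j₀
    rwa [(hfix τ).2 hτ]
  have hopen : IsOpen (H : Set (E ≃ₐ[k] E)) :=
    Subgroup.isOpen_mono hle L.fixingSubgroup_isOpen
  let H' : ClosedSubgroup (E ≃ₐ[k] E) := ⟨H, H.isClosed_of_isOpen hopen⟩
  have hH : (IntermediateField.fixedField H).fixingSubgroup = H :=
    InfiniteGalois.fixingSubgroup_fixedField H'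
  refine ⟨IntermediateField.fixedField H, ?_, ?_⟩
  · rw [bot_lt_iff_ne_bot]
    intro h
    rw [h, IntermediateField.fixingSubgroup_bot] at hH
    obtain ⟨σ, hσ, hσx⟩ := htrans x₀ z
    obtain ⟨τ, rfl⟩ := hσ
    have : τ ∈ H := hH ▸ Subgroup.mem_top τ
    exact hz (hσx ▸ this)
  · refine lt_of_le_of_ne ?_ ?_
    · rw [← InfiniteGalois.fixedField_fixingSubgroup L]
      exact IntermediateField.fixedField_antitone hle
    · intro h
      rw [h] at hH
      obtain ⟨σ, hσ, hσx⟩ := htrans x₀ y₀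
      obtain ⟨τ, rfl⟩ := hσ
      have : τ ∈ H := by
        change P τ x₀ ∈ R j₀
        rwa [hσx]
      rw [← hH, ← hfix, hσx] at this
      exact hy₀x this

theorem exists_bot_lt_lt_of_isImprimitiveSub {n : ℕ} {K : IntermediateField ℚ Qbar}
    [FiniteDimensional ℚ K] {G : Subgroup (Equiv.Perm (Fin n))} (hK : HasGalGroup n K G)
    (hG : IsImprimitiveSub G) : ∃ F : IntermediateField ℚ Qbar, ⊥ < F ∧ F < K := by
  obtain ⟨e, he⟩ := hK
  let P : (Qbar ≃ₐ[ℚ] Qbar) →* Equiv.Perm (Fin n) :=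
    (e.permCongrHom : Equiv.Perm (K →ₐ[ℚ] Qbar) →* Equiv.Perm (Fin n)).comp (galAct K)
  have hPG : P.range = G := by
    ext σ
    exact (he σ).symm
  let v : K →ₐ[ℚ] Qbar := (algebraMap K Qbar).toRatAlgHom
  have hPv : ∀ τ, P τ (e v) = e (galAct K τ v) := fun τ =>
    congrArg (fun w => e (galAct K τ w)) (e.symm_apply_apply v)
  have : Algebra.IsAlgebraic ℚ Qbar := AlgebraicClosure.isAlgebraic ℚ
  have : IsAlgClosure ℚ Qbar := ⟨inferInstance, inferInstance⟩
  refine exists_bot_lt_lt_of_isImprimitiveSub_range K P (e v) (fun τ => ?_) (hPG ▸ hG)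
  rw [hPv, e.apply_eq_iff_eq, IntermediateField.mem_fixingSubgroup_iff]
  exact ⟨fun h x hx => DFunLike.congr_fun h ⟨x, hx⟩, fun h => AlgHom.ext fun x => h x x.2⟩

/-- For `n ≥ 2` and `G` an imprimitive transitive subgroup of `Sₙ`,
`F_n(X;G) ≪_n X^{(n+4)/8}`. -/
theorem imprimitive_count (n : ℕ) (hn : 2 ≤ n)
    (G : Subgroup (Equiv.Perm (Fin n)))
    (himpr : IsImprimitiveSub G) :
    ∃ c : ℝ, 0 < c ∧ ∀ X : ℝ, 2 ≤ X →
      (FnG n X G : ℝ) ≤ c * X ^ (((n : ℝ) + 4) / 8) := by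
  obtain ⟨c, hc0, hc⟩ := exists_ncard_le_of_subset_coverUnion (e := 2) (n := n) (by omega)
    (S := fun X => {K | Module.finrank ℚ K = n ∧ |(fieldDiscr K : ℝ)| ≤ X ∧ HasGalGroup n K G})
    (α := ((n : ℝ) + 4) / 8)
    (by
      rintro X K ⟨hK, hX, hG⟩
      have := finiteDimensional_of_finrank_ne_zero (K := K) (by omega)
      obtain ⟨E, hE, hEK⟩ := exists_bot_lt_lt_of_isImprimitiveSub hG himpr
      obtain ⟨F, hEF, hcov⟩ := exists_le_covBy hEK
      refine ⟨hK, hX, F, ?_, hcov⟩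
      have h0 := (finrank_eq_mul_of_covBy hcov.lt).1
      have h1 : Module.finrank ℚ F ≠ 1 := fun h =>
        (hE.trans_le hEF).ne' (IntermediateField.finrank_eq_one_iff.1 h)
      omega)
    (by
      rintro d k hd hd0 hk rfl
      exact exists_ncard_coverUnion_le hd hk (countBound d hd0))
  exact ⟨c, hc0, fun X hX => (hc X (by linarith)).2⟩
end

section
/- Let K be a primitive number field of degree n ≥ 2, with ring of integers O_K and discriminant Δ_K. Then there is a constant c(n), depending only on n, and an element α ∈ O_K whose minimal polynomial over ℚ has the form x^n + a_2 x^{n−2} + a_3 x^{n−3} + ⋯ + a_n ∈ ℤ[x] (i.e., the coefficient of x^{n−1} is zero), with |a_j| ≤ c(n) · |Δ_K|^{j/(2n−2)} for all 2 ≤ j ≤ n. -/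
open Polynomial

namespace NumberField.mixedEmbedding

open InfinitePlace MeasureTheory

open scoped Classical NNReal

variable (K : Type*) [Field K] [NumberField K]

/-- The real linear form on the mixed space extending the trace of `K` over `ℚ`. -/
noncomputable def traceForm : mixedSpace K →ₗ[ℝ] ℝ where
  toFun x := ∑ w, x.1 w + ∑ w, 2 * (x.2 w).re
  map_add' x y := by
    simp only [Prod.fst_add, Prod.snd_add, Pi.add_apply, Complex.add_re, mul_add,
      Finset.sum_add_distrib]
    ring
  map_smul' c x := by
    simp [Finset.mul_sum, mul_add, mul_left_comm]

variable {K}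

theorem traceForm_apply (x : mixedSpace K) :
    traceForm K x = ∑ w, x.1 w + ∑ w, 2 * (x.2 w).re := rfl

theorem measurable_traceForm : Measurable (traceForm K) :=
  (traceForm K).continuous_of_finiteDimensional.measurable

theorem traceForm_mixedEmbedding (x : K) :
    traceForm K (mixedEmbedding K x) = (Algebra.trace ℚ K x : ℝ) := by
  have h := congrArg Complex.re (trace_eq_sum_embeddings (K := ℚ) ℂ (x := x))
  rw [eq_ratCast, Complex.ratCast_re] at h
  have (w : InfinitePlace K) (φ : K →+* ℂ) (hφ : φ ∈ ({φ | InfinitePlace.mk φ = w} : Finset (K →+* ℂ))) :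
      (φ x).re = (w.embedding x).re := by
    obtain rfl := (Finset.mem_filter.mp hφ).2
    rcases embedding_mk_eq φ with h | h <;> simp [h]
  rw [h, ← Fintype.sum_equiv (RingHom.equivRatAlgHom K ℂ) (fun f => f x)
    (fun φ => φ x) fun _ => by simp [RingHom.equivRatAlgHom_apply], Complex.re_sum,
    ← Finset.sum_fiberwise Finset.univ InfinitePlace.mk (fun φ : K →+* ℂ => (φ x).re),
    Finset.sum_congr rfl fun w _ => Finset.sum_congr rfl (this w)]
  simp_rw [Finset.sum_const, card_filter_mk_eq]
  rw [sum_eq_sum_add_sum, traceForm_apply]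
  congr 1
  · refine Finset.sum_congr rfl fun w _ => ?_
    rw [mult_isReal, mixedEmbedding_apply_isReal, one_smul, ← embedding_of_isReal_apply w.2,
      Complex.ofReal_re]
  · refine Finset.sum_congr rfl fun w _ => ?_
    rw [mult_isComplex, mixedEmbedding_apply_isComplex, nsmul_eq_mul, Nat.cast_ofNat]

theorem abs_traceForm_le {B : ℝ≥0} {x : mixedSpace K} (hx : x ∈ convexBodyLT K fun _ => B) :
    |traceForm K x| ≤ Module.finrank ℚ K * B := by
  simp only [Set.mem_prod, Set.mem_pi, Set.mem_univ, mem_ball_zero_iff, forall_true_left] at hx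
  rw [traceForm_apply, ← card_add_two_mul_card_eq_rank]
  refine (abs_add_le _ _).trans ?_
  push_cast
  rw [add_mul]
  refine add_le_add ?_ ?_
  · refine (Finset.abs_sum_le_sum_abs _ _).trans ((Finset.sum_le_card_nsmul _ _ (B : ℝ)
      fun w _ => (hx.1 w).le).trans ?_)
    simp [nrRealPlaces]
  · refine (Finset.abs_sum_le_sum_abs _ _).trans ((Finset.sum_le_card_nsmul _ _ (2 * B : ℝ)
      fun w _ => ?_).trans ?_)
    · rw [abs_mul, abs_two]
      gcongr
      exact (Complex.abs_re_le_norm _).trans (hx.2 w).le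
    · simp only [Finset.card_univ, nsmul_eq_mul, nrComplexPlaces]
      exact le_of_eq (by ring)

/-- If a box in the mixed space has large volume, then so does one of its slabs
`⌊traceForm K x⌋ = k`. -/
theorem exists_lt_volume_slab {B : ℝ≥0} {N : ℕ} {c : ENNReal} (hN : Module.finrank ℚ K * B ≤ N)
    (h : (2 * N + 1) * c < volume (convexBodyLT K fun _ => B)) :
    ∃ k : ℤ, c < volume ((convexBodyLT K fun _ => B) ∩ {x | ⌊traceForm K x⌋ = k}) := by
  contrapose! h
  have hsub : (convexBodyLT K fun _ => B) ⊆ ⋃ k ∈ Finset.Icc (-N : ℤ) N,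
      ((convexBodyLT K fun _ => B) ∩ {x | ⌊traceForm K x⌋ = k}) := by
    intro x hx
    have hx' := abs_le.mp ((abs_traceForm_le hx).trans (by exact_mod_cast hN : _ ≤ (N : ℝ)))
    refine Set.mem_biUnion (x := ⌊traceForm K x⌋) ?_ ⟨hx, rfl⟩
    rw [Finset.coe_Icc]
    refine ⟨Int.le_floor.mpr (by simpa using hx'.1), ?_⟩
    exact_mod_cast (Int.floor_le _).trans hx'.2
  refine (measure_mono hsub).trans ((measure_biUnion_finset_le _ _).trans
    ((Finset.sum_le_card_nsmul _ _ c fun k _ => h k).trans ?_))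
  rw [nsmul_eq_mul, Int.card_Icc, show (N + 1 - -N : ℤ).toNat = 2 * N + 1 by omega]
  push_cast
  rfl

/-- A nonzero algebraic integer of trace zero which is small at all infinite places. -/
theorem exists_ne_zero_trace_eq_zero_lt {B : ℝ≥0} {N : ℕ} (hN : Module.finrank ℚ K * B ≤ N)
    (h : (2 * N + 1) * NNReal.sqrt ‖discr K‖₊ < B ^ Module.finrank ℚ K) :
    ∃ a : 𝓞 K, a ≠ 0 ∧ Algebra.trace ℚ K a = 0 ∧ ∀ w : InfinitePlace K, w a < 2 * B := by
  have hvol : (2 * N + 1) * volume (ZSpan.fundamentalDomain (latticeBasis K)) <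
      volume (convexBodyLT K fun _ => B) := by
    rw [volume_fundamentalDomain_latticeBasis, convexBodyLT_volume, Finset.prod_pow_eq_pow_sum,
      sum_mult_eq]
    calc _ ≤ (2 * N + 1) * (1 * (NNReal.sqrt ‖discr K‖₊ : ENNReal)) := by
          gcongr
          exact pow_le_one₀ (by positivity) (by simp)
      _ < ((B ^ Module.finrank ℚ K : ℝ≥0) : ENNReal) := by
          rw [one_mul]; exact_mod_cast h
      _ ≤ _ := by
          rw [← ENNReal.coe_mul]
          exact_mod_cast le_mul_of_one_le_left zero_le (one_le_convexBodyLTFactor K)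
  obtain ⟨k, hk⟩ := exists_lt_volume_slab hN hvol
  have h_fund := ZSpan.isAddFundamentalDomain' (latticeBasis K) volume
  have : Countable (Submodule.span ℤ (Set.range (latticeBasis K))).toAddSubgroup := by
    change Countable (Submodule.span ℤ (Set.range (latticeBasis K)))
    infer_instance
  have hmeas : MeasurableSet ((convexBodyLT K fun _ => B) ∩ {x | ⌊traceForm K x⌋ = k}) :=
    ((MeasurableSet.univ_pi fun _ => measurableSet_ball).prod
      (MeasurableSet.univ_pi fun _ => measurableSet_ball)).inter
      (measurable_traceForm.floor (measurableSet_singleton k))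
  obtain ⟨x, y, hxy, hdisj⟩ :=
    exists_pair_mem_lattice_not_disjoint_vadd h_fund hmeas.nullMeasurableSet hk
  obtain ⟨_, ⟨u, ⟨hu, hu'⟩, rfl⟩, v, ⟨hv, hv'⟩, huv⟩ := Set.not_disjoint_iff.mp hdisj
  have hsub : (x - y : mixedSpace K) = v - u := by
    rw [sub_eq_sub_iff_add_eq_add, add_comm v]
    exact huv.symm
  have hmem := (x - y).2
  rw [Submodule.mem_toAddSubgroup, mem_span_latticeBasis] at hmem
  obtain ⟨a, ha⟩ := hmem
  replace ha : mixedEmbedding K a = v - u := ha.trans hsub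
  refine ⟨a, ?_, ?_, ?_⟩
  · rintro rfl
    rw [← hsub] at ha
    exact hxy (Subtype.ext (sub_eq_zero.mp (by simpa using ha.symm)))
  · have h1 := traceForm_mixedEmbedding (a : K)
    rw [ha, map_sub] at h1
    have h2 : |traceForm K v - traceForm K u| < 1 :=
      Int.abs_sub_lt_one_of_floor_eq_floor (hv'.trans hu'.symm)
    obtain ⟨z, hz⟩ := IsIntegrallyClosed.isIntegral_iff.mp
      (Algebra.isIntegral_trace (L := ℚ) a.isIntegral_coe)
    rw [h1, ← hz, eq_intCast, Rat.cast_intCast] at h2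
    have h3 : z = 0 := Int.abs_lt_one_iff.mp (by exact_mod_cast h2)
    rw [← hz, h3, map_zero]
  · have : mixedEmbedding K a ∈ convexBodyLT K fun _ => 2 * B := by
      rw [ha]
      simp only [Set.mem_prod, Set.mem_pi, Set.mem_univ, mem_ball_zero_iff,
        forall_true_left] at hu hv ⊢
      refine ⟨fun w => ?_, fun w => ?_⟩
      · refine (norm_sub_le _ _).trans_lt ?_
        push_cast
        linarith [hu.1 w, hv.1 w]
      · refine (norm_sub_le _ _).trans_lt ?_
        push_cast
        linarith [hu.2 w, hv.2 w]
    exact_mod_cast (convexBodyLT_mem K _).mp this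

end NumberField.mixedEmbedding

namespace NumberField

variable {K : Type*} [Field K] [NumberField K]

theorem adjoin_simple_ne_bot_of_trace_eq_zero {x : K} (hx : x ≠ 0)
    (htr : Algebra.trace ℚ K x = 0) : IntermediateField.adjoin ℚ {x} ≠ ⊥ := by
  rw [ne_eq, IntermediateField.adjoin_simple_eq_bot_iff, IntermediateField.mem_bot]
  rintro ⟨q, rfl⟩
  rw [Algebra.trace_algebraMap, smul_eq_zero] at htr
  rcases htr with h | h
  · exact Module.finrank_pos.ne' h
  · exact hx (by rw [h, map_zero])

theorem abs_coeff_minpoly_le {x : K} {B : ℝ} (hB : ∀ w : InfinitePlace K, w x ≤ B) (i : ℕ) :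
    |(((minpoly ℚ x).coeff i : ℚ) : ℝ)| ≤
      B ^ ((minpoly ℚ x).natDegree - i) * (minpoly ℚ x).natDegree.choose i := by
  have hx := Algebra.IsIntegral.isIntegral (R := ℚ) x
  have := coeff_le_of_roots_le (f := algebraMap ℚ ℂ) (B := B) i (minpoly.monic hx)
    (IsAlgClosed.splits _) fun z hz => by
      classical
      rw [← Multiset.mem_toFinset] at hz
      obtain ⟨φ, rfl⟩ := (Embeddings.range_eval_eq_rootSet_minpoly K ℂ x).symm.subset hz
      exact hB (InfinitePlace.mk φ)
  simpa using this

end NumberField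

open NumberField mixedEmbedding in
/-- (Traceless Schmidt lemma; Lemke Oliver–Thorne.) Let `K` be a
primitive number field of degree `n ≥ 2`. Then there is `α` in the ring of integers
of `K` whose minimal polynomial over `ℚ` has the form
`xⁿ + a₂ xⁿ⁻² + ⋯ + aₙ ∈ ℤ[x]` with `|aⱼ| ≤ c(n)·|Δ_K|^{j/(2n−2)}` for `2 ≤ j ≤ n`,
where `c(n)` depends only on `n`. -/
theorem traceless_schmidt_lemma (n : ℕ) (hn : 2 ≤ n) :
    ∃ c : ℝ, 0 < c ∧
      ∀ (K : Type) [Field K] [NumberField K],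
        Module.finrank ℚ K = n →
        (∀ E : IntermediateField ℚ K, E = ⊥ ∨ E = ⊤) →
        ∃ (α : K) (a : ℕ → ℤ), IsIntegral ℤ α ∧
          minpoly ℚ α =
            X ^ n + ∑ j ∈ Finset.Icc 2 n, C ((a j : ℚ)) * X ^ (n - j) ∧
          ∀ j ∈ Finset.Icc 2 n,
            |(a j : ℝ)| ≤
              c * |(NumberField.discr K : ℝ)| ^ ((j : ℝ) / (2 * (n : ℝ) - 2)) := by
  refine ⟨(2 * (5 * n + 1)) ^ n * 2 ^ n, by positivity, fun K _ _ hdeg hprim => ?_⟩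
  have hn' : (0 : ℝ) < 2 * n - 2 := by
    have : (2 : ℝ) ≤ n := by exact_mod_cast hn
    linarith
  have hdisc : (1 : ℝ) ≤ |(discr K : ℝ)| := by
    exact_mod_cast Int.one_le_abs (discr_ne_zero K)
  set D : NNReal := (‖discr K‖₊) ^ ((1 : ℝ) / (2 * n - 2)) with hD
  have hDpow (j : ℕ) : (D : ℝ) ^ j = |(discr K : ℝ)| ^ ((j : ℝ) / (2 * n - 2)) := by
    rw [hD, NNReal.coe_rpow, coe_nnnorm, Int.norm_eq_abs, ← Real.rpow_mul_natCast (by positivity)]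
    congr 1
    ring
  have hD1 : 1 ≤ D := by
    rw [← NNReal.coe_le_coe, ← pow_one (D : ℝ), hDpow]
    exact Real.one_le_rpow hdisc (by positivity)
  have hDsqrt : NNReal.sqrt ‖discr K‖₊ = D ^ (n - 1) := by
    rw [← NNReal.coe_inj, NNReal.coe_pow, hDpow, Real.coe_sqrt, coe_nnnorm, Int.norm_eq_abs,
      Real.sqrt_eq_rpow, Nat.cast_sub (by omega), Nat.cast_one]
    congr 1
    rw [div_eq_div_iff two_ne_zero hn'.ne']
    ring
  set B : NNReal := (5 * n + 1) * D with hB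
  have hvol : (2 * ⌈(n * B : NNReal)⌉₊ + 1) * NNReal.sqrt ‖discr K‖₊ < B ^ n := by
    have hceil := (Nat.ceil_lt_add_one (zero_le (a := (n * B : NNReal)))).le
    have hnB : 1 ≤ n * B := one_le_mul (by exact_mod_cast (by omega : 1 ≤ n))
      (one_le_mul le_add_self hD1)
    calc _ ≤ (2 * (n * B + 1) + 1) * D ^ (n - 1) := by rw [hDsqrt]; gcongr
      _ ≤ (5 * (n * B)) * D ^ (n - 1) := by
        gcongr
        rw [← NNReal.coe_le_coe] at hnB ⊢
        push_cast at hnB ⊢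
        linarith
      _ = (5 * n) * B * D ^ (n - 1) := by ring
      _ < (5 * n + 1) * B * D ^ (n - 1) := by
        gcongr
        exact lt_add_one _
      _ ≤ (5 * n + 1) ^ (n - 1) * B * D ^ (n - 1) := by
        gcongr
        exact le_self_pow₀ le_add_self (by omega)
      _ = B ^ (n - 1 + 1) := by
        rw [pow_succ, hB, mul_pow]
        ring
      _ = B ^ n := by rw [Nat.sub_add_cancel (by omega)]
  obtain ⟨a, ha0, htr, hlt⟩ := exists_ne_zero_trace_eq_zero_lt (K := K) (B := B)
    (by rw [hdeg]; exact Nat.le_ceil _) (hdeg ▸ hvol)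
  have ha0' : (a : K) ≠ 0 := by simpa using ha0
  have hint : IsIntegral ℤ (a : K) := a.2
  have htop := (hprim (IntermediateField.adjoin ℚ {(a : K)})).resolve_left
    (adjoin_simple_ne_bot_of_trace_eq_zero ha0' htr)
  have hnd : (minpoly ℚ (a : K)).natDegree = n := by
    rw [← IntermediateField.adjoin.finrank (Algebra.IsIntegral.isIntegral _), htop,
      IntermediateField.finrank_top', hdeg]
  have hcoeff (i : ℕ) : (((minpoly ℤ (a : K)).coeff i : ℤ) : ℚ) = (minpoly ℚ (a : K)).coeff i := by
    rw [minpoly.isIntegrallyClosed_eq_field_fractions' ℚ hint, coeff_map, eq_intCast]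
  have hnext : (minpoly ℚ (a : K)).coeff (n - 1) = 0 := by
    rw [trace_eq_finrank_mul_minpoly_nextCoeff, mul_neg, neg_eq_zero, mul_eq_zero] at htr
    have := htr.resolve_left (by exact_mod_cast Module.finrank_pos.ne')
    rwa [nextCoeff_of_natDegree_pos (by omega), hnd] at this
  refine ⟨a, fun j => (minpoly ℤ (a : K)).coeff (n - j), hint, ?_, fun j hj => ?_⟩
  · simp_rw [hcoeff]
    conv_lhs => rw [(minpoly.monic (Algebra.IsIntegral.isIntegral (a : K))).as_sum, hnd]
    obtain ⟨m, rfl⟩ : ∃ m, n = m + 1 := ⟨n - 1, by omega⟩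
    rw [Finset.sum_range_succ, ← Nat.add_sub_cancel m 1, hnext, Nat.add_sub_cancel, C_0, zero_mul,
      add_zero]
    congr 1
    refine Finset.sum_nbij' (fun i => m + 1 - i) (fun j => m + 1 - j) ?_ ?_ ?_ ?_ ?_
    · intro i hi
      simp only [Finset.mem_range, Finset.mem_Icc] at hi ⊢
      omega
    · intro j hj
      simp only [Finset.mem_range, Finset.mem_Icc] at hj ⊢
      omega
    · intro i hi
      have := Finset.mem_range.mp hi
      omega
    · intro j hj
      have := Finset.mem_Icc.mp hj
      omega
    · intro i hi
      rw [Nat.sub_sub_self (by have := Finset.mem_range.mp hi; omega)]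
  · obtain ⟨hj2, hjn⟩ := Finset.mem_Icc.mp hj
    have h := abs_coeff_minpoly_le (fun w => (hlt w).le) (n - j)
    rw [← hcoeff, hnd, Rat.cast_intCast, Nat.sub_sub_self hjn] at h
    refine h.trans ?_
    rw [← hDpow, hB]
    push_cast
    calc _ = (2 * (5 * n + 1)) ^ j * (n.choose (n - j)) * (D : ℝ) ^ j := by
          rw [← mul_assoc, mul_pow _ (D : ℝ)]
          ring
      _ ≤ _ := by
        gcongr
        · nlinarith
        · exact_mod_cast Nat.choose_le_two_pow n (n - j)
end

section
/- Let n ≥ 2 and let G be a primitive transitive subgroup of S_n. Then there is a constant C = C(n) such that for all X ≥ 2, F_n(X;G) is at most the number of irreducible monic polynomials x^n + a_2 x^{n−2} + a_3 x^{n−3} + ⋯ + a_n ∈ ℤ[x] whose Galois group over ℚ (acting on the roots) is conjugate in S_n to G and whose coefficients satisfy |a_j| ≤ C · X^{j/(2n−2)} for 2 ≤ j ≤ n. -/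
open Polynomial

attribute [local instance] Polynomial.Gal.splits_ℚ_ℂ

/-- Under the identification `e` of the complex roots of `f ∈ ℚ[x]` with `Fin n`, the
image of the Galois group of `f` over `ℚ` in `Perm (Fin n)` is exactly `G`. -/
def QGalGroupIs {n : ℕ} (f : Polynomial ℚ) (e : f.rootSet ℂ ≃ Fin n)
    (G : Subgroup (Equiv.Perm (Fin n))) : Prop :=
  ∀ σ : Equiv.Perm (Fin n),
    σ ∈ G ↔ ∃ g : f.Gal, Equiv.permCongr e (Polynomial.Gal.galActionHom f ℂ g) = σ

section
open IntermediateField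

instance : Algebra.IsAlgebraic ℚ Qbar := AlgebraicClosure.isAlgebraic ℚ

instance : IsAlgClosure ℚ Qbar := ⟨inferInstance, inferInstance⟩

theorem minpoly_int_map_rat {L : Type*} [Field L] [Algebra ℚ L] {α : L} (hα : IsIntegral ℤ α) :
    (minpoly ℤ α).map (Int.castRingHom ℚ) = minpoly ℚ α :=
  (minpoly.isIntegrallyClosed_eq_field_fractions' ℚ hα).symm

theorem qGalGroupIs_minpoly {n : ℕ} {K : IntermediateField ℚ Qbar} [FiniteDimensional ℚ K]
    {G : Subgroup (Equiv.Perm (Fin n))} (hG : HasGalGroup n K G) {α : K} (hα : ℚ⟮α⟯ = ⊤) :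
    ∃ e : (minpoly ℚ α).rootSet ℂ ≃ Fin n, QGalGroupIs (minpoly ℚ α) e G := by
  obtain ⟨e, he⟩ := hG
  set p := minpoly ℚ α with hp
  have : Fact ((p.map (algebraMap ℚ Qbar)).Splits) := ⟨IsAlgClosed.splits _⟩
  have hinj := (Field.primitive_element_iff_algHom_eq_of_eval' ℚ Qbar
    (fun _ => IsAlgClosed.splits _) α).1 hα
  have hrange : Set.range (fun ι : K →ₐ[ℚ] Qbar => ι α) = p.rootSet Qbar :=
    Algebra.IsAlgebraic.range_eval_eq_rootSet_minpoly Qbar α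
  let r : (K →ₐ[ℚ] Qbar) ≃ p.rootSet Qbar :=
    (Equiv.ofInjective _ hinj).trans (Equiv.setCongr hrange)
  have hr (ι : K →ₐ[ℚ] Qbar) : (r ι : Qbar) = ι α := rfl
  let t : p.rootSet Qbar ≃ p.rootSet ℂ :=
    (Gal.rootsEquivRoots p Qbar).symm.trans (Gal.rootsEquivRoots p ℂ)
  have ht (h : p.Gal) (x : p.rootSet Qbar) : t (h • x) = h • t x := by
    simp [t, Gal.smul_def]
  have hgr (g : Qbar ≃ₐ[ℚ] Qbar) (ι : K →ₐ[ℚ] Qbar) :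
      r (galAct K g ι) = Gal.restrict p Qbar g • r ι :=
    Subtype.ext (by rw [Gal.restrict_smul, hr, hr]; rfl)
  have key (g : Qbar ≃ₐ[ℚ] Qbar) :
      Equiv.permCongr ((r.trans t).symm.trans e)
        (Gal.galActionHom p ℂ (Gal.restrict p Qbar g)) = Equiv.permCongr e (galAct K g) := by
    ext i
    have h1 : Gal.galActionHom p ℂ (Gal.restrict p Qbar g) (t (r (e.symm i))) =
        t (r (galAct K g (e.symm i))) := by
      rw [hgr, ht]; rfl
    simp [h1]
  refine ⟨(r.trans t).symm.trans e, fun σ => (he σ).trans ⟨?_, ?_⟩⟩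
  · rintro ⟨g, rfl⟩
    exact ⟨_, key g⟩
  · rintro ⟨h, rfl⟩
    obtain ⟨g, rfl⟩ := Gal.restrict_surjective p Qbar h
    exact ⟨g, (key g).symm⟩

theorem mem_range_of_forall_eval_eq {K : IntermediateField ℚ Qbar} {β : K}
    (h : ∀ ι : K →ₐ[ℚ] Qbar, ι β = β) : β ∈ Set.range (algebraMap ℚ K) := by
  have : (β : Qbar) ∈ (⊥ : IntermediateField ℚ Qbar) :=
    (InfiniteGalois.mem_bot_iff_fixed (β : Qbar)).2 fun g => h (g.toAlgHom.comp K.val)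
  obtain ⟨q, hq⟩ := IntermediateField.mem_bot.1 this
  exact ⟨q, Subtype.ext hq⟩

theorem adjoin_eq_top_of_not_hasBlockSystem {n : ℕ} {K : IntermediateField ℚ Qbar}
    [FiniteDimensional ℚ K] {G : Subgroup (Equiv.Perm (Fin n))} (hG : HasGalGroup n K G)
    (hprim : ¬ HasBlockSystem G) {β : K} (hβ : β ∉ Set.range (algebraMap ℚ K)) :
    ℚ⟮β⟯ = ⊤ := by
  rw [Field.primitive_element_iff_algHom_eq_of_eval' ℚ Qbar (fun _ => IsAlgClosed.splits _)]
  by_contra hinj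
  obtain ⟨e, he⟩ := hG
  let v : Fin n → Qbar := fun i => e.symm i β
  let c := (Set.finite_range v).equivFin
  have hc (i : Fin n) (j) : v i = (c.symm j : Qbar) ↔ c ⟨v i, i, rfl⟩ = j := by
    rw [← Equiv.eq_symm_apply, Subtype.ext_iff]
  refine hprim ⟨_, fun j => {i | v i = c.symm j}, ?_, ?_, ?_, ?_, ?_⟩
  · have hnt : (Set.range v).Nontrivial := by
      by_contra hs
      refine hβ (mem_range_of_forall_eval_eq fun ι => ?_)
      have hv (κ : K →ₐ[ℚ] Qbar) : v (e κ) = κ β := congrArg (· β) (e.symm_apply_apply κ)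
      exact (hv ι).symm.trans
        ((Set.not_nontrivial_iff.1 hs ⟨e ι, rfl⟩ ⟨e K.val, rfl⟩).trans (hv K.val))
    rw [Nat.card_coe_set_eq]
    exact Nat.succ_le_of_lt ((Set.one_lt_ncard (Set.finite_range v)).2 hnt)
  · intro j
    obtain ⟨i, hi⟩ := (c.symm j).2
    exact ⟨i, hi⟩
  · simp only [Function.Injective, not_forall] at hinj
    obtain ⟨ι, κ, heq, hne⟩ := hinj
    refine ⟨c ⟨v (e ι), _, rfl⟩, ?_⟩
    rw [Nat.card_coe_set_eq]
    refine Nat.succ_le_of_lt ((Set.one_lt_ncard (Set.toFinite _)).2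
      ⟨e ι, ?_, e κ, ?_, e.injective.ne hne⟩)
    · exact (hc _ _).2 rfl
    · exact (hc _ _).2 (congrArg c (Subtype.ext (by simpa [v] using heq.symm)))
  · intro i
    exact ⟨c ⟨v i, i, rfl⟩, (hc _ _).2 rfl, fun j hj => ((hc i j).1 hj).symm⟩
  · intro σ hσ i
    obtain ⟨g, rfl⟩ := (he σ).1 hσ
    have hv (x : Fin n) : v (Equiv.permCongr e (galAct K g) x) = g (v x) := by
      simp [v, Equiv.permCongr_apply]; rfl
    obtain ⟨x, hx⟩ := (c.symm i).2
    refine ⟨c ⟨v (Equiv.permCongr e (galAct K g) x), _, rfl⟩, ?_⟩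
    ext y
    obtain ⟨y, rfl⟩ := (Equiv.permCongr e (galAct K g)).surjective y
    simp only [Set.mem_image, Set.mem_ofPred_eq, EmbeddingLike.apply_eq_iff_eq, exists_eq_right,
      Equiv.symm_apply_apply, hv, hx]

end

section
open NumberField NumberField.InfinitePlace NumberField.mixedEmbedding MeasureTheory
open scoped NNReal ENNReal

theorem minkowskiBound_one_le (K : Type*) [Field K] [NumberField K] :
    minkowskiBound K ↑1 ≤
      (((2 : ℝ≥0) ^ Module.finrank ℚ K * NNReal.sqrt ‖discr K‖₊ : ℝ≥0) : ℝ≥0∞) := by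
  rw [minkowskiBound, volume_fundamentalDomain_fractionalIdealLatticeBasis, mixedEmbedding.finrank,
    volume_fundamentalDomain_latticeBasis, Units.val_one, FractionalIdeal.absNorm_one,
    Rat.cast_one, ENNReal.ofReal_one, one_mul, mul_comm, ENNReal.coe_mul, ENNReal.coe_pow,
    ENNReal.coe_ofNat]
  gcongr
  exact mul_le_of_le_one_left' (pow_le_one₀ (by positivity) (by simp))

theorem prod_pow_mult_eq {K : Type*} [Field K] [NumberField K] (w₀ : InfinitePlace K)
    (a b : ℝ≥0) :
    ∏ w : InfinitePlace K, (open scoped Classical in if w = w₀ then a else b) ^ mult w =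
      a ^ mult w₀ * b ^ (Module.finrank ℚ K - mult w₀) := by
  classical
  rw [← Finset.mul_prod_erase _ _ (Finset.mem_univ w₀), if_pos rfl]
  congr 1
  rw [Finset.prod_congr rfl fun w hw => by rw [if_neg (Finset.ne_of_mem_erase hw)],
    Finset.prod_pow_eq_pow_sum, ← sum_mult_eq,
    ← Finset.add_sum_erase _ _ (Finset.mem_univ w₀), Nat.add_sub_cancel_left]

theorem exists_int_eq_of_mem_range {K : Type*} [Field K] [NumberField K] (β : 𝓞 K)
    (h : (β : K) ∈ Set.range (algebraMap ℚ K)) : ∃ m : ℤ, (β : K) = m := by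
  obtain ⟨q, hq⟩ := h
  have hint : IsIntegral ℤ q := by
    rw [← isIntegral_algebraMap_iff (algebraMap ℚ K).injective, hq]
    exact β.isIntegral_coe
  obtain ⟨m, rfl⟩ := IsIntegrallyClosed.isIntegral_iff.mp hint
  exact ⟨m, by rw [← hq]; simp⟩

theorem exists_ringOfIntegers_notMem_range_lt (K : Type*) [Field K] [NumberField K]
    (hn : 2 ≤ Module.finrank ℚ K) {B : ℝ≥0} (hB : 1 ≤ B)
    (h : (2 : ℝ≥0) ^ Module.finrank ℚ K * NNReal.sqrt ‖discr K‖₊ <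
      B ^ (Module.finrank ℚ K - 1)) :
    ∃ β : 𝓞 K, (β : K) ∉ Set.range (algebraMap ℚ K) ∧
      ∀ w : InfinitePlace K, w β ≤ 2 * B := by
  classical
  have hB' : (1 : ℝ) ≤ B := hB
  obtain ⟨w₀⟩ : Nonempty (InfinitePlace K) := inferInstance
  have hM := (minkowskiBound_one_le K).trans_lt (ENNReal.coe_lt_coe.2 h)
  rcases w₀.isReal_or_isComplex with hw | hw
  · obtain ⟨β, hβ, hlt⟩ := exists_ne_zero_mem_ringOfIntegers_lt K
      (f := fun w => if w = w₀ then 1 else B) (by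
        rw [convexBodyLT_volume]
        refine hM.trans_le ?_
        rw [← ENNReal.coe_mul, ENNReal.coe_le_coe, prod_pow_mult_eq, mult_isReal ⟨w₀, hw⟩,
          one_pow, one_mul]
        exact le_mul_of_one_le_left' (one_le_convexBodyLTFactor K))
    refine ⟨β, fun hr => ?_, fun w => (hlt w).le.trans ?_⟩
    · obtain ⟨m, hm⟩ := exists_int_eq_of_mem_range β hr
      have h1 := hlt w₀
      rw [if_pos rfl, hm, ← norm_embedding_eq, map_intCast] at h1
      have : m = 0 := by
        have : |(m : ℝ)| < 1 := by simpa using h1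
        exact Int.abs_lt_one_iff.1 (by exact_mod_cast this)
      exact hβ (by ext; simp [hm, this])
    · split_ifs
      · simp; linarith
      · linarith
  · obtain ⟨β, hβ, hlt, hre, him⟩ := exists_ne_zero_mem_ringOfIntegers_lt' K
      (f := fun w => if w = w₀ then NNReal.sqrt B else B) ⟨w₀, hw⟩ (by
        rw [convexBodyLT'_volume]
        refine hM.trans_le ?_
        rw [← ENNReal.coe_mul, ENNReal.coe_le_coe, prod_pow_mult_eq, mult_isComplex ⟨w₀, hw⟩,
          NNReal.sq_sqrt, ← pow_succ', show Module.finrank ℚ K - 2 + 1 = Module.finrank ℚ K - 1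
            by omega]
        exact le_mul_of_one_le_left' (one_le_convexBodyLT'Factor K))
    refine ⟨β, fun hr => ?_, fun w => ?_⟩
    · obtain ⟨m, hm⟩ := exists_int_eq_of_mem_range β hr
      rw [hm, map_intCast] at hre
      have : m = 0 := by
        have : |(m : ℝ)| < 1 := by simpa using hre
        exact Int.abs_lt_one_iff.1 (by exact_mod_cast this)
      exact hβ (by ext; simp [hm, this])
    · by_cases hww : w = w₀
      · subst hww
        have him' : |(w.embedding (β : K)).im| < B := by
          simpa [← NNReal.coe_pow] using him
        rw [← norm_embedding_eq]
        refine (Complex.norm_le_abs_re_add_abs_im _).trans ?_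
        simp only at hre
        linarith
      · have := hlt w hww
        simp only [hww, if_false] at this
        linarith
end

section
open NumberField IntermediateField
open scoped NNReal

attribute [local instance] Ring.toIntAlgebra

theorem exists_trace_eq_zero_adjoin_eq_top {K : Type*} [Field K] [NumberField K]
    (hn : 2 ≤ Module.finrank ℚ K)
    (hprim : ∀ β : K, β ∉ Set.range (algebraMap ℚ K) → ℚ⟮β⟯ = ⊤) {Y : ℝ} (hY : 1 ≤ Y)
    (hdisc : |(discr K : ℝ)| ≤ (Y ^ (Module.finrank ℚ K - 1)) ^ 2) :
    ∃ α : K, IsIntegral ℤ α ∧ ℚ⟮α⟯ = ⊤ ∧ Algebra.trace ℚ K α = 0 ∧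
      ∀ φ : K →+* ℂ, ‖φ α‖ ≤ 32 * Module.finrank ℚ K * Y := by
  set n := Module.finrank ℚ K with hn'
  have hY0 : 0 ≤ Y := zero_le_one.trans hY
  lift Y to ℝ≥0 using hY0
  obtain ⟨β, hβ, hle⟩ := exists_ringOfIntegers_notMem_range_lt K hn (B := 8 * Y)
    (by rw [← NNReal.coe_le_coe]; push_cast; linarith) (by
      have h1 : NNReal.sqrt ‖discr K‖₊ ≤ Y ^ (n - 1) := by
        rw [NNReal.sqrt_le_iff_le_sq, ← NNReal.coe_le_coe]
        simpa [Int.norm_eq_abs] using hdisc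
      rw [mul_pow]
      refine (mul_le_mul_right h1 _).trans_lt (mul_lt_mul_of_pos_right ?_ ?_)
      · obtain ⟨m, hm⟩ : ∃ m, n = m + 2 := ⟨n - 2, by omega⟩
        rw [← hn', hm, show m + 2 - 1 = m + 1 by omega, pow_add, pow_succ (8 : ℝ≥0)]
        refine mul_lt_mul_of_le_of_lt_of_pos_of_nonneg ?_ (by norm_num) (by positivity)
          (by positivity)
        exact pow_le_pow_left₀ (by positivity) (by norm_num) _
      · exact pow_pos (by rw [← NNReal.coe_pos]; exact zero_lt_one.trans_le hY) _)
  have hle' (φ : K →+* ℂ) : ‖φ β‖ ≤ 16 * Y := by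
    have := hle (InfinitePlace.mk φ)
    rw [InfinitePlace.apply] at this
    push_cast at this
    linarith
  have hn0 : (n : K) ≠ 0 := by exact_mod_cast (by omega : n ≠ 0)
  refine ⟨n * β - algebraMap ℚ K (Algebra.trace ℚ K β), ?_, ?_, ?_, fun φ => ?_⟩
  · have hnat : IsIntegral ℤ (n : K) := by
      simpa using isIntegral_algebraMap (R := ℤ) (A := K) (x := (n : ℤ))
    exact (hnat.mul β.isIntegral_coe).sub (Algebra.isIntegral_trace β.isIntegral_coe).algebraMap
  · refine hprim _ fun ⟨q, hq⟩ => hβ ⟨(q + Algebra.trace ℚ K β) / n, ?_⟩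
    rw [map_div₀, map_add, hq, map_natCast]
    field_simp
    ring
  · rw [map_sub, Algebra.trace_algebraMap, ← nsmul_eq_mul, map_nsmul, sub_self]
  · have htr : φ (algebraMap ℚ K (Algebra.trace ℚ K β)) = ∑ σ : K →ₐ[ℚ] ℂ, σ β := by
      rw [← trace_eq_sum_embeddings ℂ]
      simp
    have hsum : ‖∑ σ : K →ₐ[ℚ] ℂ, σ β‖ ≤ n * (16 * Y) := by
      refine (norm_sum_le_of_le _ fun σ _ => hle' σ.toRingHom).trans_eq ?_
      rw [Finset.sum_const, Finset.card_univ, AlgHom.card, nsmul_eq_mul]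
    rw [map_sub, htr, map_mul, map_natCast]
    refine (norm_sub_le _ _).trans ?_
    rw [norm_mul, Complex.norm_natCast]
    have := mul_le_mul_of_nonneg_left (hle' φ) n.cast_nonneg
    linarith

theorem natDegree_minpoly_int {K : Type*} [Field K] [NumberField K] {α : K}
    (hα : IsIntegral ℤ α) (htop : ℚ⟮α⟯ = ⊤) :
    (minpoly ℤ α).natDegree = Module.finrank ℚ K := by
  rw [← (Field.primitive_element_iff_minpoly_natDegree_eq ℚ α).1 htop,
    ← minpoly_int_map_rat hα, (minpoly.monic hα).natDegree_map]

theorem coeff_minpoly_int_eq_zero {K : Type*} [Field K] [NumberField K] {α : K}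
    (hα : IsIntegral ℤ α) (htop : ℚ⟮α⟯ = ⊤) (htr : Algebra.trace ℚ K α = 0) :
    (minpoly ℤ α).coeff (Module.finrank ℚ K - 1) = 0 := by
  have hdeg := natDegree_minpoly_int hα htop
  rw [trace_eq_finrank_mul_minpoly_nextCoeff, htop, IntermediateField.finrank_top, Nat.cast_one,
    one_mul, neg_eq_zero, ← minpoly_int_map_rat hα,
    nextCoeff_map (Int.castRingHom ℚ).injective_int] at htr
  rw [← hdeg, ← nextCoeff_of_natDegree_pos (hdeg ▸ Module.finrank_pos)]
  exact (map_eq_zero_iff _ (Int.castRingHom ℚ).injective_int).1 htr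

theorem abs_coeff_minpoly_int_le {K : Type*} [Field K] [NumberField K] {α : K}
    (hα : IsIntegral ℤ α) (htop : ℚ⟮α⟯ = ⊤) {R : ℝ} (hR0 : 0 ≤ R)
    (hR : ∀ φ : K →+* ℂ, ‖φ α‖ ≤ R) (k : ℕ) :
    |((minpoly ℤ α).coeff k : ℝ)| ≤ 2 ^ Module.finrank ℚ K * R ^ (Module.finrank ℚ K - k) := by
  have h := coeff_le_of_roots_le (f := Int.castRingHom ℂ) (B := R) k (minpoly.monic hα)
    (IsAlgClosed.splits _) fun z hz => by
      have : z ∈ (minpoly ℚ α).rootSet ℂ := by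
        rw [mem_rootSet', ← minpoly_int_map_rat hα, Polynomial.map_map, aeval_def, eval₂_map]
        rw [mem_roots', IsRoot.def, eval_map] at hz
        exact hz
      rw [← NumberField.Embeddings.range_eval_eq_rootSet_minpoly] at this
      obtain ⟨φ, rfl⟩ := this
      exact hR φ
  rw [natDegree_minpoly_int hα htop, coeff_map, eq_intCast, Complex.norm_intCast] at h
  refine h.trans ?_
  rw [mul_comm]
  gcongr
  exact_mod_cast Nat.choose_le_two_pow _ _

/-- Minimal polynomials over `ℤ` of integral generators of `K`, with vanishing second coefficient
and with coefficients bounded as if all roots had absolute value at most `R`. -/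
def traceZeroMinpolys (n : ℕ) (R : ℝ) (K : IntermediateField ℚ Qbar) : Set ℤ[X] :=
  {f | ∃ α : Qbar, IsIntegral ℤ α ∧ ℚ⟮α⟯ = K ∧ minpoly ℤ α = f ∧ f.coeff (n - 1) = 0 ∧
    ∀ k, |(f.coeff k : ℝ)| ≤ 2 ^ n * R ^ (n - k)}

theorem isIntegral_coe_iff {K : IntermediateField ℚ Qbar} {α : K} :
    IsIntegral ℤ (α : Qbar) ↔ IsIntegral ℤ α :=
  isIntegral_algHom_iff (K.val.restrictScalars ℤ) Subtype.val_injective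

theorem minpoly_int_coe {K : IntermediateField ℚ Qbar} (α : K) :
    minpoly ℤ (α : Qbar) = minpoly ℤ α :=
  minpoly.algHom_eq (K.val.restrictScalars ℤ) Subtype.val_injective α

theorem adjoin_coe_eq_iff {K : IntermediateField ℚ Qbar} {α : K} :
    ℚ⟮(α : Qbar)⟯ = K ↔ ℚ⟮α⟯ = ⊤ := by
  rw [← lift_adjoin_simple]
  exact ⟨fun h => lift_injective K (h.trans (lift_top ℚ K).symm), fun h => h ▸ lift_top ℚ K⟩

theorem traceZeroMinpolys_nonempty {n : ℕ} (hn : 2 ≤ n) {K : IntermediateField ℚ Qbar}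
    {G : Subgroup (Equiv.Perm (Fin n))} (hprim : ¬ HasBlockSystem G)
    (hfin : Module.finrank ℚ K = n) (hG : HasGalGroup n K G) {Y : ℝ} (hY : 1 ≤ Y)
    (hdisc : |(fieldDiscr K : ℝ)| ≤ (Y ^ (n - 1)) ^ 2) :
    (traceZeroMinpolys n (32 * n * Y) K).Nonempty := by
  have : FiniteDimensional ℚ K := .of_finrank_pos (by omega)
  have : NumberField K := ⟨⟩
  rw [fieldDiscr, dif_pos this.to_finiteDimensional] at hdisc
  subst hfin
  obtain ⟨α, hα, htop, htr, hle⟩ := exists_trace_eq_zero_adjoin_eq_top hn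
    (fun β => adjoin_eq_top_of_not_hasBlockSystem hG hprim) hY hdisc
  refine ⟨_, α, isIntegral_coe_iff.2 hα, adjoin_coe_eq_iff.2 htop, rfl, ?_, ?_⟩
  · rw [minpoly_int_coe, coeff_minpoly_int_eq_zero hα htop htr]
  · rw [minpoly_int_coe]
    exact abs_coeff_minpoly_int_le hα htop (by positivity) hle

theorem traceZeroMinpolys_subset_map (n : ℕ) (R : ℝ) (K : IntermediateField ℚ Qbar)
    (g : Qbar ≃ₐ[ℚ] Qbar) :
    traceZeroMinpolys n R K ⊆ traceZeroMinpolys n R (K.map g.toAlgHom) := by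
  rintro _ ⟨α, hα, rfl, rfl, h⟩
  refine ⟨g α, hα.map (g.toAlgHom.restrictScalars ℤ), ?_,
    minpoly.algHom_eq (g.toAlgHom.restrictScalars ℤ) g.injective α, h⟩
  rw [adjoin_map, Set.image_singleton]
  rfl

theorem exists_algEquiv_of_minpoly_int_eq {α β : Qbar} (hα : IsIntegral ℤ α)
    (hβ : IsIntegral ℤ β) (h : minpoly ℤ α = minpoly ℤ β) : ∃ g : Qbar ≃ₐ[ℚ] Qbar, g α = β := by
  refine minpoly.exists_algEquiv_of_root' (Algebra.IsAlgebraic.isAlgebraic α) ?_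
  rw [← minpoly_int_map_rat hα, h, minpoly_int_map_rat hβ, minpoly.aeval]

theorem traceZeroMinpolys_congr (n : ℕ) (R : ℝ) {α β : Qbar} (hα : IsIntegral ℤ α)
    (hβ : IsIntegral ℤ β) (h : minpoly ℤ α = minpoly ℤ β) :
    traceZeroMinpolys n R ℚ⟮α⟯ = traceZeroMinpolys n R ℚ⟮β⟯ := by
  have key {α β : Qbar} (hα : IsIntegral ℤ α) (hβ : IsIntegral ℤ β)
      (h : minpoly ℤ α = minpoly ℤ β) :
      traceZeroMinpolys n R ℚ⟮α⟯ ⊆ traceZeroMinpolys n R ℚ⟮β⟯ := by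
    obtain ⟨g, rfl⟩ := exists_algEquiv_of_minpoly_int_eq hα hβ h
    have := traceZeroMinpolys_subset_map n R ℚ⟮α⟯ g
    rwa [adjoin_map, Set.image_singleton] at this
  exact (key hα hβ h).antisymm (key hβ hα h.symm)

theorem adjoin_zsmul {α : Qbar} {m : ℤ} (hm : m ≠ 0) : ℚ⟮m • α⟯ = ℚ⟮α⟯ := by
  refine le_antisymm (adjoin_simple_le_iff.2 (zsmul_mem (mem_adjoin_simple_self ℚ α) m))
    (adjoin_simple_le_iff.2 ?_)
  have h : (m : Qbar)⁻¹ * (m • α) = α := by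
    rw [zsmul_eq_mul, inv_mul_cancel_left₀ (Int.cast_ne_zero.2 hm)]
  exact (congrArg (· ∈ ℚ⟮m • α⟯) h).mp
    (mul_mem (inv_mem (intCast_mem _ m)) (mem_adjoin_simple_self ℚ (m • α)))

theorem minpoly_int_galois {n : ℕ} {K : IntermediateField ℚ Qbar} [NumberField K]
    {G : Subgroup (Equiv.Perm (Fin n))} (hfin : Module.finrank ℚ K = n)
    (hG : HasGalGroup n K G) {α : Qbar} (hα : IsIntegral ℤ α) (hK : ℚ⟮α⟯ = K) :
    (minpoly ℤ α).natDegree = n ∧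
      Irreducible ((minpoly ℤ α).map (Int.castRingHom ℚ)) ∧
      ∃ e : ((minpoly ℤ α).map (Int.castRingHom ℚ)).rootSet ℂ ≃ Fin n,
        QGalGroupIs ((minpoly ℤ α).map (Int.castRingHom ℚ)) e G := by
  lift α to K using hK ▸ mem_adjoin_simple_self ℚ α
  rw [isIntegral_coe_iff] at hα
  rw [adjoin_coe_eq_iff] at hK
  rw [minpoly_int_coe, minpoly_int_map_rat hα]
  exact ⟨(natDegree_minpoly_int hα hK).trans hfin,
    minpoly.irreducible (Algebra.IsIntegral.isIntegral α), qGalGroupIs_minpoly hG hK⟩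

theorem finite_setOf_abs_coeff_le (n : ℕ) (B : ℕ → ℝ) :
    {f : ℤ[X] | f.natDegree ≤ n ∧ ∀ k ≤ n, |(f.coeff k : ℝ)| ≤ B k}.Finite := by
  refine Set.Finite.of_finite_image
    (f := fun f : ℤ[X] => fun k : Fin (n + 1) => f.coeff k) ?_ ?_
  · refine (Set.Finite.pi' fun k : Fin (n + 1) =>
      Set.finite_Icc (-⌊B k⌋) ⌊B k⌋).subset ?_
    rintro _ ⟨f, ⟨-, hf⟩, rfl⟩ k
    refine abs_le.1 (Int.le_floor.2 ?_)
    exact_mod_cast hf k (Nat.lt_succ_iff.1 k.2)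
  · rintro f ⟨hf, -⟩ g ⟨hg, -⟩ h
    refine (ext_iff_natDegree_le hf hg).2 fun k hk => ?_
    exact congrFun h ⟨k, Nat.lt_succ_of_le hk⟩

theorem exists_injOn_mem_Icc {β : Type*} (s : Finset β) :
    ∃ h : β → ℕ, Set.InjOn h s ∧ ∀ a ∈ s, h a ∈ Set.Icc 1 s.card := by
  classical
  refine ⟨fun a => if ha : a ∈ s then s.equivFin ⟨a, ha⟩ + 1 else 0, fun a ha b hb h => ?_,
    fun a ha => ?_⟩
  · simp only [dif_pos (Finset.mem_coe.1 ha), dif_pos (Finset.mem_coe.1 hb)] at h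
    exact congrArg Subtype.val (s.equivFin.injective (Fin.ext (Nat.succ_injective h)))
  · simp only [dif_pos ha]
    exact ⟨Nat.le_add_left _ _, (s.equivFin ⟨a, ha⟩).2⟩

theorem exists_label_aroots (f : ℤ[X]) :
    ∃ h : Qbar → ℕ, ∀ α ∈ f.aroots Qbar, h α ∈ Set.Icc 1 f.natDegree ∧
      ∀ β ∈ f.aroots Qbar, h α = h β → α = β := by
  classical
  obtain ⟨h, hinj, hle⟩ := exists_injOn_mem_Icc (f.aroots Qbar).toFinset
  have hcard : (f.aroots Qbar).toFinset.card ≤ f.natDegree :=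
    (Multiset.toFinset_card_le _).trans ((card_roots' _).trans natDegree_map_le)
  exact ⟨h, fun α hα => ⟨Set.Icc_subset_Icc_right hcard (hle α (Multiset.mem_toFinset.2 hα)),
    fun β hβ => hinj (Multiset.mem_toFinset.2 hα) (Multiset.mem_toFinset.2 hβ)⟩⟩

theorem coeff_minpoly_zsmul {α : Qbar} (hα : IsIntegral ℤ α) {m : ℤ} (hm : m ≠ 0) (k : ℕ) :
    (minpoly ℤ (m • α)).coeff k =
      (minpoly ℤ α).coeff k * m ^ ((minpoly ℤ α).natDegree - k) := by
  rw [← coeff_scaleRoots, ← IsIntegrallyClosed.minpoly_smul hm hα]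

theorem minpoly_int_coeff_zero_eq_zero {α : Qbar} (hα : IsIntegral ℤ α) :
    (minpoly ℤ α).coeff 0 = 0 ↔ α = 0 := by
  rw [← minpoly.coeff_zero_eq_zero (Algebra.IsIntegral.isIntegral (R := ℚ) α),
    ← minpoly_int_map_rat hα, coeff_map, eq_intCast, Int.cast_eq_zero]

/-- A generator is chosen for each `K`, in such a way that only equal fields share a minimal
polynomial: conjugate fields use the same polynomial in `traceZeroMinpolys`, and distinct roots
of that polynomial are multiplied by distinct integers between `1` and `n`. -/
theorem exists_generator_minpoly_injOn {n : ℕ} (hn : 2 ≤ n) {R : ℝ}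
    {S : Set (IntermediateField ℚ Qbar)} (hS : ∀ K ∈ S, Module.finrank ℚ K = n)
    (hne : ∀ K ∈ S, (traceZeroMinpolys n R K).Nonempty) :
    ∃ γ : IntermediateField ℚ Qbar → Qbar,
      (∀ K ∈ S, IsIntegral ℤ (γ K) ∧ ℚ⟮γ K⟯ = K ∧ (minpoly ℤ (γ K)).coeff (n - 1) = 0 ∧
        ∀ k, |((minpoly ℤ (γ K)).coeff k : ℝ)| ≤ 2 ^ n * (n * R) ^ (n - k)) ∧
      Set.InjOn (fun K => minpoly ℤ (γ K)) S := by
  let F (K : IntermediateField ℚ Qbar) : ℤ[X] := Classical.epsilon (· ∈ traceZeroMinpolys n R K)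
  have hF (K) (hK : K ∈ S) : F K ∈ traceZeroMinpolys n R K := Classical.epsilon_spec (hne K hK)
  choose! α hint hadj hmin hcoeff hle using hF
  choose h hh using exists_label_aroots
  have hdeg (K) (hK : K ∈ S) : (F K).natDegree = n := by
    have h1 := adjoin.finrank (K := ℚ) (Algebra.IsIntegral.isIntegral (α K))
    rwa [hadj K hK, hS K hK, ← minpoly_int_map_rat (hint K hK), hmin K hK,
      (hmin K hK ▸ minpoly.monic (hint K hK) : (F K).Monic).natDegree_map, eq_comm] at h1
  have hroot (K) (hK : K ∈ S) : α K ∈ (F K).aroots Qbar := by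
    rw [← hmin K hK, mem_aroots]
    exact ⟨(minpoly.monic (hint K hK)).ne_zero, minpoly.aeval _ _⟩
  have hlab (K) (hK : K ∈ S) : 1 ≤ h (F K) (α K) ∧ h (F K) (α K) ≤ n :=
    hdeg K hK ▸ (hh (F K) (α K) (hroot K hK)).1
  have hlab0 (K) (hK : K ∈ S) : (h (F K) (α K) : ℤ) ≠ 0 := by
    have := (hlab K hK).1
    omega
  have hγ (K) (hK : K ∈ S) (k : ℕ) : (minpoly ℤ ((h (F K) (α K) : ℤ) • α K)).coeff k =
      (F K).coeff k * (h (F K) (α K) : ℤ) ^ (n - k) := by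
    rw [coeff_minpoly_zsmul (hint K hK) (hlab0 K hK), hmin K hK, hdeg K hK]
  have hγint (K) (hK : K ∈ S) : IsIntegral ℤ ((h (F K) (α K) : ℤ) • α K) :=
    (hint K hK).smul _
  have hγadj (K) (hK : K ∈ S) : ℚ⟮(h (F K) (α K) : ℤ) • α K⟯ = K :=
    (adjoin_zsmul (hlab0 K hK)).trans (hadj K hK)
  refine ⟨fun K => (h (F K) (α K) : ℤ) • α K,
    fun K hK => ⟨hγint K hK, hγadj K hK, ?_, fun k => ?_⟩, fun K hK L hL hKL => ?_⟩
  · rw [hγ K hK, hcoeff K hK, zero_mul]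
  · rw [hγ K hK]
    push_cast
    rw [abs_mul, mul_pow, mul_left_comm, mul_comm, abs_pow, Nat.abs_cast]
    refine mul_le_mul ?_ (hle K hK k) (abs_nonneg _) (by positivity)
    exact pow_le_pow_left₀ (Nat.cast_nonneg _) (Nat.cast_le.2 (hlab K hK).2) _
  · have hT := traceZeroMinpolys_congr n R (hγint K hK) (hγint L hL) hKL
    rw [hγadj K hK, hγadj L hL] at hT
    have hFF : F K = F L := by simp only [F, hT]
    have hc := (hγ K hK 0).symm.trans ((congrArg (coeff · 0) hKL).trans (hγ L hL 0))
    have h0 : (F K).coeff 0 ≠ 0 := by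
      rw [← hmin K hK, Ne, minpoly_int_coeff_zero_eq_zero (hint K hK)]
      intro h0
      have := hadj K hK
      rw [h0, adjoin_zero] at this
      have h1 := hS K hK
      rw [← this, IntermediateField.finrank_bot] at h1
      omega
    rw [← hFF, Nat.sub_zero] at hc
    have hlabel := Nat.pow_left_injective (n := n) (by omega)
      (by exact_mod_cast mul_left_cancel₀ h0 hc)
    have := (hh (F K) (α K) (hroot K hK)).2 (α L) (hFF ▸ hroot L hL) hlabel
    rw [← hadj K hK, ← hadj L hL, this]

end

/-- (Schmidt / Lemke Oliver–Thorne reduction.) For `G` a primitive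
transitive subgroup of `Sₙ`, `F_n(X;G)` is bounded by the number of irreducible monic
polynomials `xⁿ + a₂xⁿ⁻² + ⋯ + aₙ ∈ ℤ[x]` with Galois group conjugate to `G` and
`|a_j| ≤ C·X^{j/(2n−2)}` for `2 ≤ j ≤ n`. -/
theorem count_by_polynomials (n : ℕ) (hn : 2 ≤ n)
    (G : Subgroup (Equiv.Perm (Fin n))) (hprim : IsPrimitiveSub G) :
    ∃ C : ℝ, 0 < C ∧ ∀ X : ℝ, 2 ≤ X →
      FnG n X G ≤
        Nat.card {f : Polynomial ℤ //
          f.Monic ∧ f.natDegree = n ∧ f.coeff (n - 1) = 0 ∧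
          Irreducible (f.map (Int.castRingHom ℚ)) ∧
          (∃ e : (f.map (Int.castRingHom ℚ)).rootSet ℂ ≃ Fin n,
            QGalGroupIs (f.map (Int.castRingHom ℚ)) e G) ∧
          ∀ j ∈ Finset.Icc 2 n,
            |(f.coeff (n - j) : ℝ)| ≤ C * X ^ ((j : ℝ) / (2 * (n : ℝ) - 2))} := by
  refine ⟨2 ^ n * (n * (32 * n)) ^ n, by positivity, fun X hX => ?_⟩
  have hn1 : (0 : ℝ) < 2 * n - 2 := by
    have : (2 : ℝ) ≤ n := by exact_mod_cast hn
    linarith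
  have hX0 : 0 ≤ X := zero_le_two.trans hX
  set Y : ℝ := X ^ (1 / (2 * (n : ℝ) - 2)) with hYdef
  have hY : 1 ≤ Y := Real.one_le_rpow (one_le_two.trans hX) (by positivity)
  have hYpow (j : ℕ) : Y ^ j = X ^ ((j : ℝ) / (2 * (n : ℝ) - 2)) := by
    rw [hYdef, ← Real.rpow_mul_natCast hX0, one_div_mul_eq_div]
  have hYX : (Y ^ (n - 1)) ^ 2 = X := by
    rw [← pow_mul, hYpow, Nat.cast_mul, Nat.cast_sub (by omega)]
    convert Real.rpow_one X
    rw [div_eq_one_iff_eq hn1.ne']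
    push_cast
    ring
  obtain ⟨γ, hγ, hinj⟩ := exists_generator_minpoly_injOn hn (R := 32 * n * Y)
    (S := {K | Module.finrank ℚ K = n ∧ |(fieldDiscr K : ℝ)| ≤ X ∧ HasGalGroup n K G})
    (fun K hK => hK.1)
    (fun K hK => traceZeroMinpolys_nonempty hn hprim.2 hK.1 hK.2.2 hY (hYX.symm ▸ hK.2.1))
  refine Set.ncard_le_ncard_of_injOn _ (fun K hK => ?_) hinj ?_
  · obtain ⟨hint, hadj, hcoeff, hle⟩ := hγ K hK
    have : FiniteDimensional ℚ K := .of_finrank_pos (hK.1 ▸ by omega)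
    have : NumberField K := ⟨⟩
    obtain ⟨hdeg, hirr, hgal⟩ := minpoly_int_galois hK.1 hK.2.2 hint hadj
    refine ⟨minpoly.monic hint, hdeg, hcoeff, hirr, hgal, fun j hj => ?_⟩
    rw [Finset.mem_Icc] at hj
    have hn1 : (1 : ℝ) ≤ n * (32 * n) := by
      exact_mod_cast Nat.mul_pos (by omega) (by omega : 0 < 32 * n)
    refine (hle _).trans ?_
    rw [Nat.sub_sub_self hj.2, ← mul_assoc (n : ℝ), mul_pow, hYpow, ← mul_assoc]
    gcongr
    exact hj.2
  · refine (finite_setOf_abs_coeff_le n fun k =>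
      2 ^ n * (n * (32 * n)) ^ n * X ^ (((n - k : ℕ) : ℝ) / (2 * (n : ℝ) - 2)) + 1).subset
      fun f hf => ⟨hf.2.1.le, fun k hk => ?_⟩
    obtain ⟨hmonic, hdeg, hcoeff, -, -, hle⟩ := hf
    have hC : 0 ≤ 2 ^ n * (n * (32 * n)) ^ n * X ^ (((n - k : ℕ) : ℝ) / (2 * (n : ℝ) - 2)) := by
      positivity
    obtain rfl | hk := hk.eq_or_lt
    · have : f.coeff k = 1 := hdeg ▸ hmonic.coeff_natDegree
      rw [this, Int.cast_one, abs_one]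
      linarith
    obtain rfl | hk' := (Nat.le_sub_one_of_lt hk).eq_or_lt
    · rw [hcoeff, Int.cast_zero, abs_zero]
      linarith
    · have := hle (n - k) (Finset.mem_Icc.2 ⟨by omega, Nat.sub_le _ _⟩)
      rw [Nat.sub_sub_self (by omega)] at this
      linarith
end

section
/- Let F be a field of characteristic zero, let n ≥ 2, and let g(x) = x^n + a_1 x^{n−1} + ⋯ + a_{n−2} x² ∈ F[x]. Then the Galois group of the polynomial g(x) + t x + u over the rational function field F(t,u) in two indeterminates t, u is the full symmetric group S_n. -/
open Polynomial

attribute [local instance] Polynomial.Gal.splits_ℚ_ℂ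

noncomputable section

/-- The Galois group of `f` over `F`, acting on the roots of `f` in a splitting field. -/
def galPermHom {F : Type*} [Field F] (f : Polynomial F) :
    f.Gal →* Equiv.Perm (f.rootSet f.SplittingField) :=
  @Polynomial.Gal.galActionHom F _ f f.SplittingField _ _ ⟨SplittingField.splits f⟩

/-- The Galois group of `f` over `F` is the full symmetric group on the roots of `f`. -/
def GalIsSymm {F : Type*} [Field F] (f : Polynomial F) : Prop :=
  Function.Bijective (galPermHom f)

/-- Under the identification `e` of the roots of `f` with `Fin n`, the image of the
Galois group of `f` over `F` in `Perm (Fin n)` is exactly `G`. -/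
def GalGroupIs {F : Type*} [Field F] {n : ℕ} (f : Polynomial F)
    (e : f.rootSet f.SplittingField ≃ Fin n)
    (G : Subgroup (Equiv.Perm (Fin n))) : Prop :=
  ∀ σ : Equiv.Perm (Fin n),
    σ ∈ G ↔ ∃ g : f.Gal, Equiv.permCongr e (galPermHom f g) = σ

end

noncomputable section

/-- The polynomial `g(x) + t·x + u` over `F(t,u)`, where
`g(x) = xⁿ + a₁xⁿ⁻¹ + ⋯ + a_{n−2}x²` and `F(t,u)` is realized as `F(t)(u)`,
with `t` the variable of the inner function field and `u` that of the outer one. -/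
def twoParamPoly (F : Type*) [Field F] (n : ℕ) (a : ℕ → F) :
    Polynomial (RatFunc (RatFunc F)) :=
  X ^ n +
    (∑ j ∈ Finset.Icc 1 (n - 2),
      C (algebraMap (RatFunc F) (RatFunc (RatFunc F))
          (algebraMap F (RatFunc F) (a j))) * X ^ (n - j)) +
    C (algebraMap (RatFunc F) (RatFunc (RatFunc F)) RatFunc.X) * X +
    C (RatFunc.X : RatFunc (RatFunc F))

theorem RatFunc.ringHom_ext' {K R : Type*} [Field K] [Field R] {φ ψ : RatFunc K →+* R}
    (hC : φ.comp (algebraMap K (RatFunc K)) = ψ.comp (algebraMap K (RatFunc K)))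
    (hX : φ RatFunc.X = ψ RatFunc.X) : φ = ψ := by
  refine IsLocalization.ringHom_ext (nonZeroDivisors K[X]) (Polynomial.ringHom_ext (fun a ↦ ?_) ?_)
  · simpa using RingHom.congr_fun hC a
  · simpa using hX

theorem RatFunc.trdeg_eq_one (K : Type*) [Field K] : Algebra.trdeg K (RatFunc K) = 1 := by
  have : Algebra.IsAlgebraic K[X] (RatFunc K) :=
    (IsFractionRing.comap_isAlgebraic_iff (K := RatFunc K)).mpr inferInstance
  rw [← trdeg_add_eq K K[X] (A := RatFunc K), Polynomial.trdeg_of_isDomain,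
    trdeg_eq_zero, add_zero]

theorem RatFunc.algebraMap_mem_subfield {K L : Type*} [Field K] [Field L] [Algebra (RatFunc K) L]
    (S : Subfield L)
    (hC : ∀ a : K, algebraMap (RatFunc K) L (algebraMap K _ a) ∈ S)
    (hX : algebraMap (RatFunc K) L RatFunc.X ∈ S) (x : RatFunc K) : algebraMap (RatFunc K) L x ∈ S := by
  have h (q : K[X]) : algebraMap (RatFunc K) L (algebraMap _ _ q) ∈ S := by
    induction q using Polynomial.induction_on' with
    | add p q hp hq => simpa using S.add_mem hp hq
    | monomial n a =>
      rw [← Polynomial.C_mul_X_pow_eq_monomial, map_mul, map_mul, map_pow, map_pow, RatFunc.algebraMap_X,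
        RatFunc.algebraMap_C]
      exact S.mul_mem (hC a) (S.pow_mem hX n)
  rw [← RatFunc.num_div_denom x, map_div₀]
  exact S.div_mem (h _) (h _)

open IntermediateField IntermediateField.algebraAdjoinAdjoin in
/-- `F(t)(u)` has transcendence degree two, so a pair in an algebraic extension of it whose
adjunction to `F` contains `t` and `u` is a transcendence basis. -/
theorem isTranscendenceBasis_of_ratFunc_ratFunc {F : Type*} [Field F] {L : Type*} [Field L]
    [Algebra (RatFunc (RatFunc F)) L] [Algebra.IsAlgebraic (RatFunc (RatFunc F)) L]
    [Algebra F L] [IsScalarTower F (RatFunc (RatFunc F)) L] (x : Fin 2 → L)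
    (ht : algebraMap (RatFunc (RatFunc F)) L (algebraMap _ _ (RatFunc.X : RatFunc F)) ∈
      adjoin F (Set.range x))
    (hu : algebraMap (RatFunc (RatFunc F)) L RatFunc.X ∈ adjoin F (Set.range x)) :
    IsTranscendenceBasis F x := by
  let _ : Algebra (RatFunc F) L := ((algebraMap (RatFunc (RatFunc F)) L).comp (algebraMap _ _)).toAlgebra
  have : IsScalarTower (RatFunc F) (RatFunc (RatFunc F)) L := .of_algebraMap_eq' rfl
  have hmem (z) : algebraMap (RatFunc (RatFunc F)) L z ∈ adjoin F (Set.range x) :=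
    RatFunc.algebraMap_mem_subfield (adjoin F (Set.range x)).toSubfield
      (fun a ↦ RatFunc.algebraMap_mem_subfield (adjoin F (Set.range x)).toSubfield
        (fun b ↦ by
          have := (adjoin F (Set.range x)).algebraMap_mem b
          rwa [IsScalarTower.algebraMap_apply F (RatFunc (RatFunc F)) L] at this) ht a) hu z
  let _ : Algebra (RatFunc (RatFunc F)) (adjoin F (Set.range x)) :=
    ((algebraMap (RatFunc (RatFunc F)) L).codRestrict _ hmem).toAlgebra
  have : IsScalarTower (RatFunc (RatFunc F)) (adjoin F (Set.range x)) L := .of_algebraMap_eq' rfl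
  have h1 : Algebra.IsAlgebraic (adjoin F (Set.range x)) L :=
    Algebra.IsAlgebraic.tower_top (K := RatFunc (RatFunc F)) _
  have h2 : Algebra.IsAlgebraic (Algebra.adjoin F (Set.range x)) L :=
    IsFractionRing.comap_isAlgebraic_iff.mpr h1
  refine (Algebra.IsAlgebraic.isTranscendenceBasis_of_lift_le_trdeg_of_finite F x ?_)
  have hk : Algebra.trdeg F (RatFunc (RatFunc F)) = 2 := by
    rw [← trdeg_add_eq F (RatFunc F), RatFunc.trdeg_eq_one, RatFunc.trdeg_eq_one, one_add_one_eq_two]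
  have hL := lift_trdeg_add_eq F (RatFunc (RatFunc F)) L
  rw [hk, trdeg_eq_zero] at hL
  have : Algebra.trdeg F L = 2 := by
    rw [← Cardinal.lift_inj, ← hL]; simp
  simp [this]

/-- Galois automorphisms are transitive on pairs of distinct roots of `p + t x + u`. -/
theorem exists_gal_map_pair {F : Type*} [Field F] {L : Type*} [Field L]
    [Algebra (RatFunc (RatFunc F)) L] [Normal (RatFunc (RatFunc F)) L]
    [Algebra F L] [IsScalarTower F (RatFunc (RatFunc F)) L] (p : F[X]) {t u : L}
    (ht : t = algebraMap (RatFunc (RatFunc F)) L (algebraMap _ _ (RatFunc.X : RatFunc F)))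
    (hu : u = algebraMap (RatFunc (RatFunc F)) L RatFunc.X) {a b c d : L} (hab : a ≠ b) (hcd : c ≠ d)
    (ha : aeval a p + t * a + u = 0) (hb : aeval b p + t * b + u = 0)
    (hc : aeval c p + t * c + u = 0) (hd : aeval d p + t * d + u = 0) :
    ∃ σ : Gal(L/RatFunc (RatFunc F)), σ a = c ∧ σ b = d := by
  have hsolve {R : Type _} [Field R] [Algebra F R] {a b t u : R} (hab : a ≠ b)
      (ha : aeval a p + t * a + u = 0)
      (hb : aeval b p + t * b + u = 0) :
      t = - (aeval a p - aeval b p) / (a - b) ∧ u = -(aeval a p + t * a) := by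
    refine ⟨?_, by linear_combination ha⟩
    rw [eq_div_iff (sub_ne_zero.mpr hab)]
    linear_combination ha - hb
  have hind {a b : L} (hab : a ≠ b)
      (ha : aeval a p + t * a + u = 0)
      (hb : aeval b p + t * b + u = 0) : IsTranscendenceBasis F ![a, b] := by
    have ham : a ∈ IntermediateField.adjoin F (Set.range ![a, b]) :=
      IntermediateField.subset_adjoin _ _ ⟨0, rfl⟩
    have hbm : b ∈ IntermediateField.adjoin F (Set.range ![a, b]) :=
      IntermediateField.subset_adjoin _ _ ⟨1, rfl⟩
    have hp {x : L} (hx : x ∈ IntermediateField.adjoin F (Set.range ![a, b])) :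
      aeval x p ∈ IntermediateField.adjoin F (Set.range ![a, b]) := by
      have := (aeval (⟨x, hx⟩ : IntermediateField.adjoin F (Set.range ![a, b])) p).2
      rwa [← IntermediateField.aeval_coe] at this
    obtain ⟨h1, h2⟩ := hsolve hab ha hb
    have htm : t ∈ IntermediateField.adjoin F (Set.range ![a, b]) := by
      rw [h1]
      exact div_mem (neg_mem (sub_mem (hp ham) (hp hbm))) (sub_mem ham hbm)
    refine isTranscendenceBasis_of_ratFunc_ratFunc _ (ht ▸ htm) (hu ▸ ?_)
    rw [h2]
    exact neg_mem (add_mem (hp ham) (mul_mem htm ham))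
  have := (hind hab ha hb).isAlgebraic_field
  have hab' := (hind hab ha hb).1
  let φ : IntermediateField.adjoin F (Set.range ![a, b]) →ₐ[F] L :=
    (IntermediateField.val _).comp ((hind hcd hc hd).1.aevalEquivField.toAlgHom.comp
      hab'.aevalEquivField.symm.toAlgHom)
  have hφ (i : Fin 2) : φ ⟨![a, b] i, IntermediateField.subset_adjoin _ _ ⟨i, rfl⟩⟩ =
      ![c, d] i := by
    have h : hab'.aevalEquivField (algebraMap (MvPolynomial (Fin 2) F) _ (MvPolynomial.X i)) =
        ⟨![a, b] i, IntermediateField.subset_adjoin _ _ ⟨i, rfl⟩⟩ :=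
      Subtype.ext ((hab'.aevalEquivField_algebraMap_apply_coe _).trans (MvPolynomial.aeval_X _ _))
    simp only [φ, ← h, AlgHom.comp_apply]
    refine Eq.trans (congrArg (fun z ↦ ((hind hcd hc hd).1.aevalEquivField z : L))
      (hab'.aevalEquivField.symm_apply_apply _)) ?_
    exact ((hind hcd hc hd).1.aevalEquivField_algebraMap_apply_coe _).trans
      (MvPolynomial.aeval_X _ _)
  obtain ⟨Φ, hΦ⟩ := IsAlgClosed.surjective_domRestrict_of_isAlgebraic (E := L)
    ((IsScalarTower.toAlgHom F L (AlgebraicClosure L)).comp φ)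
  have hΦ' (i : Fin 2) : Φ (![a, b] i) = algebraMap L (AlgebraicClosure L) (![c, d] i) := by
    rw [← hφ i]
    exact DFunLike.congr_fun hΦ ⟨![a, b] i, _⟩
  have hΦa : Φ a = algebraMap L _ c := hΦ' 0
  have hΦb : Φ b = algebraMap L _ d := hΦ' 1
  have htu : Φ t = algebraMap L _ t ∧ Φ u = algebraMap L _ u := by
    have hi := (algebraMap L (AlgebraicClosure L)).injective
    have e1 := congrArg Φ ha
    have e2 := congrArg Φ hb
    have e3 := congrArg (algebraMap L (AlgebraicClosure L)) hc
    have e4 := congrArg (algebraMap L (AlgebraicClosure L)) hd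
    simp only [map_add, map_mul, map_zero, ← aeval_algHom_apply, ← aeval_algebraMap_apply, hΦa, hΦb]
      at e1 e2 e3 e4
    have h1 := hsolve (hi.ne hcd) e1 e2
    have h2 := hsolve (hi.ne hcd) e3 e4
    have h3 := h1.1.trans h2.1.symm
    exact ⟨h3, by rw [h1.2, h2.2, h3]⟩
  have hcomp : (Φ : L →+* AlgebraicClosure L).comp (algebraMap (RatFunc (RatFunc F)) L) =
      (algebraMap L (AlgebraicClosure L)).comp (algebraMap (RatFunc (RatFunc F)) L) := by
    refine RatFunc.ringHom_ext' (RatFunc.ringHom_ext' ?_ ?_) ?_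
    · ext z
      simp only [RingHom.comp_apply, RingHom.coe_coe,
        ← IsScalarTower.algebraMap_apply F (RatFunc F) (RatFunc (RatFunc F)),
        ← IsScalarTower.algebraMap_apply F (RatFunc (RatFunc F)) L,
        ← IsScalarTower.algebraMap_apply F L (AlgebraicClosure L), Φ.commutes]
    · simpa [ht] using htu.1
    · simpa [hu] using htu.2
  let Ψ : L →ₐ[RatFunc (RatFunc F)] AlgebraicClosure L :=
    { toRingHom := Φ, commutes' := RingHom.congr_fun hcomp }
  have hΨ (x y : L) (h : Φ x = algebraMap L _ y) : Ψ.restrictNormal' L x = y := by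
    apply (algebraMap L (AlgebraicClosure L)).injective
    rw [← h]
    exact AlgHom.restrictNormal_commutes Ψ L x
  exact ⟨Ψ.restrictNormal' L, hΨ _ _ hΦa, hΨ _ _ hΦb⟩

open TensorProduct in
theorem exists_derivation_ratFunc_X_eq_one (E : Type*) [Field E] [CharZero E] (L : Type*) [Field L]
    [Algebra (RatFunc E) L] [Algebra.IsAlgebraic (RatFunc E) L] [Algebra E L] [IsScalarTower E (RatFunc E) L] :
    ∃ D : Derivation E L L, D (algebraMap (RatFunc E) L RatFunc.X) = 1 := by
  let _ : Algebra E[X] L := ((algebraMap (RatFunc E) L).comp (algebraMap E[X] (RatFunc E))).toAlgebra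
  have : IsScalarTower E[X] (RatFunc E) L := .of_algebraMap_eq' rfl
  have : IsScalarTower E E[X] L := .of_algebraMap_eq' <| by
    rw [IsScalarTower.algebraMap_eq E (RatFunc E) L, IsScalarTower.algebraMap_eq E[X] (RatFunc E) L,
      IsScalarTower.algebraMap_eq E E[X] (RatFunc E), RingHom.comp_assoc]
  have : CharZero (RatFunc E) := charZero_of_injective_algebraMap (algebraMap E (RatFunc E)).injective
  have := Algebra.FormallyEtale.of_isSeparable (RatFunc E) L
  have : Algebra.FormallyEtale E[X] (RatFunc E) :=
    Algebra.FormallyEtale.of_isLocalization (nonZeroDivisors E[X])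
  have : Algebra.FormallyEtale E[X] L := Algebra.FormallyEtale.comp _ (RatFunc E) _
  let d : Derivation E E[X] L := Polynomial.mkDerivation E 1
  let φ : Ω[L⁄E] →ₗ[L] L := (d.liftKaehlerDifferential.liftBaseChange L).comp
    (KaehlerDifferential.tensorKaehlerEquivOfFormallyEtale E E[X] L).symm.toLinearMap
  refine ⟨φ.compDer (KaehlerDifferential.D E L), ?_⟩
  have := KaehlerDifferential.tensorKaehlerEquivOfFormallyEtale_symm_D_algebraMap E E[X] L X
  rw [IsScalarTower.algebraMap_apply E[X] (RatFunc E) L, RatFunc.algebraMap_X] at this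
  exact (congrArg (d.liftKaehlerDifferential.liftBaseChange L) this).trans (by simp [d])

theorem aeval_derivative_ne_zero (E : Type*) [Field E] [CharZero E] (L : Type*) [Field L]
    [Algebra (RatFunc E) L] [Algebra.IsAlgebraic (RatFunc E) L] [Algebra E L] [IsScalarTower E (RatFunc E) L]
    (q : E[X]) (x : L) (h : aeval x q + algebraMap (RatFunc E) L RatFunc.X = 0) :
    aeval x (derivative q) ≠ 0 := by
  obtain ⟨D, hD⟩ := exists_derivation_ratFunc_X_eq_one E L
  intro h0
  have := congrArg D h
  simp [Derivation.map_aeval, hD, h0] at this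

/-- No horizontal line is tangent to `p + t x` at two points when `t` is an indeterminate. -/
theorem eq_of_bitangent (E : Type*) [Field E] [CharZero E] (L : Type*) [Field L]
    [Algebra (RatFunc E) L] [Algebra.IsAlgebraic (RatFunc E) L] [Algebra E L] [IsScalarTower E (RatFunc E) L]
    (p : E[X]) (x y : L)
    (hx : aeval x (derivative p) + algebraMap (RatFunc E) L RatFunc.X = 0)
    (hy : aeval y (derivative p) + algebraMap (RatFunc E) L RatFunc.X = 0)
    (h : aeval x p + algebraMap (RatFunc E) L RatFunc.X * x =
      aeval y p + algebraMap (RatFunc E) L RatFunc.X * y) : x = y := by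
  obtain ⟨D, hD⟩ := exists_derivation_ratFunc_X_eq_one E L
  have := congrArg D h
  simp only [map_add, Derivation.map_aeval, Derivation.leibniz, smul_eq_mul, hD] at this
  linear_combination this - D x * hx + D y * hy

theorem Equiv.Perm.closure_eq_top_of_two_transitive {α : Type*} [Finite α] [DecidableEq α]
    (G : Subgroup (Equiv.Perm α))
    (h2 : ∀ a b c d : α, a ≠ b → c ≠ d → ∃ σ ∈ G, σ a = c ∧ σ b = d)
    {τ : Equiv.Perm α} (hτ : τ ∈ G) (hs : τ.IsSwap) : G = ⊤ := by
  rw [eq_top_iff, ← Equiv.Perm.closure_isSwap, Subgroup.closure_le]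
  rintro _ ⟨c, d, hcd, rfl⟩
  obtain ⟨a, b, hab, rfl⟩ := hs
  obtain ⟨σ, hσ, rfl, rfl⟩ := h2 a b c d hab hcd
  rw [Equiv.swap_apply_apply]
  exact G.mul_mem (G.mul_mem hσ hτ) (G.inv_mem hσ)

theorem Equiv.Perm.isSwap_of_card_fixed {α : Type*} [Fintype α] [DecidableEq α] (σ : Equiv.Perm α) (h1 : σ ≠ 1)
    (s : Finset α) (hs : ∀ x ∈ s, σ x = x) (hc : Fintype.card α ≤ s.card + 2) : σ.IsSwap := by
  rw [← Equiv.Perm.card_support_eq_two]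
  refine le_antisymm ?_ (Equiv.Perm.two_le_card_support_of_ne_one h1)
  have : σ.support ⊆ sᶜ := fun x hx ↦ by
    rw [Finset.mem_compl]; exact fun h ↦ Equiv.Perm.mem_support.mp hx (hs x h)
  have := Finset.card_le_card this
  rw [Finset.card_compl] at this
  omega

/-- If the Galois group is `2`-transitive on the roots and some nontrivial element fixes all but at
most two roots, then it is the full symmetric group. -/
theorem galIsSymm_of_swap {k : Type*} [Field k] (f : k[X])
    (h2 : ∀ a b c d : f.rootSet f.SplittingField, a ≠ b → c ≠ d → ∃ σ : f.Gal,
      σ • a = c ∧ σ • b = d)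
    (hs : ∃ σ : f.Gal, (MulAction.toPerm σ : Equiv.Perm (f.rootSet f.SplittingField)) ≠ 1 ∧
      ∃ s : Finset (f.rootSet f.SplittingField),
      (∀ x ∈ s, σ • x = x) ∧ f.natDegree ≤ s.card + 2) : GalIsSymm f := by
  classical
  have : Fact ((f.map (algebraMap k f.SplittingField)).Splits) := ⟨SplittingField.splits f⟩
  refine ⟨Gal.galActionHom_injective f f.SplittingField, ?_⟩
  let N : f.Gal →* Equiv.Perm (f.rootSet f.SplittingField) := MulAction.toPermHom _ _
  have hN : N.range = ⊤ := by
    obtain ⟨σ, h1, s, hs, hc⟩ := hs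
    refine Equiv.Perm.closure_eq_top_of_two_transitive _ (fun a b c d hab hcd ↦ ?_)
      (τ := N σ) ⟨σ, rfl⟩ (Equiv.Perm.isSwap_of_card_fixed _ h1 s hs ?_)
    · obtain ⟨σ, hσ⟩ := h2 a b c d hab hcd
      exact ⟨N σ, ⟨σ, rfl⟩, hσ⟩
    · refine le_trans ?_ hc
      rw [← Nat.card_eq_fintype_card]
      exact f.ncard_rootSet_le f.SplittingField
  let e := Gal.rootsEquivRoots f f.SplittingField
  intro τ
  obtain ⟨σ, hσ⟩ := MonoidHom.range_eq_top.mp hN (e.symm.permCongr τ)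
  refine ⟨σ, Equiv.ext fun x ↦ ?_⟩
  change e (N σ (e.symm x)) = τ x
  simp [hσ]

/-- If `f` does not split over an extension `K`, some nontrivial element of its Galois group fixes
at least as many roots as `f` has in any prescribed finite set of roots in `K`. -/
theorem exists_gal_moving {k K : Type*} [Field k] [Field K] [CharZero K] [Algebra k K] (f : k[X])
    (hf0 : f ≠ 0) (hK : ¬ (f.map (algebraMap k K)).Splits) (S : Finset K)
    (hS : ∀ x ∈ S, aeval x f = 0) :
    ∃ σ : f.Gal, (MulAction.toPerm σ : Equiv.Perm (f.rootSet f.SplittingField)) ≠ 1 ∧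
      ∃ s : Finset (f.rootSet f.SplittingField),
      (∀ x ∈ s, σ • x = x) ∧ s.card = S.card := by
  classical
  let L := AlgebraicClosure K
  let j : f.SplittingField →ₐ[k] L := IsSplittingField.lift _ f (IsAlgClosed.splits _)
  let _ : Algebra f.SplittingField L := j.toRingHom.toAlgebra
  have : IsScalarTower k f.SplittingField L := .of_algebraMap_eq' j.comp_algebraMap.symm
  have hroot : ∀ x : L, aeval x f = 0 → ∃ y : f.rootSet f.SplittingField, j y = x := by
    intro x hx
    have := (SplittingField.splits f).image_rootSet j
    have hx' : x ∈ f.rootSet L := mem_rootSet.mpr ⟨hf0, hx⟩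
    rw [← this] at hx'
    obtain ⟨y, hy, rfl⟩ := hx'
    exact ⟨⟨y, hy⟩, rfl⟩
  obtain ⟨α, hα, hαK⟩ : ∃ α : L, aeval α f = 0 ∧ α ∉ Set.range (algebraMap K L) := by
    by_contra! h
    refine hK ?_
    refine (IsAlgClosed.splits ((f.map (algebraMap k K)).map (algebraMap K L))).of_splits_map _ fun a ha ↦ ?_
    rw [mem_roots', IsRoot, eval_map_algebraMap, aeval_map_algebraMap] at ha
    exact h a ha.2
  obtain ⟨σ, hσ⟩ : ∃ σ : Gal(L/K), σ α ≠ α := by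
    by_contra! h
    exact hαK ((InfiniteGalois.mem_range_algebraMap_iff_fixed α).mpr h)
  let τ : f.Gal := (σ.restrictScalars k).restrictNormal f.SplittingField
  have hτ : ∀ x : f.SplittingField, j (τ x) = σ (j x) := fun x ↦
    (σ.restrictScalars k).restrictNormal_commutes f.SplittingField x
  have hτ' : ∀ x : f.rootSet f.SplittingField, j ↑(τ • x) = σ (j x) := fun x ↦ hτ x
  refine ⟨τ, fun h ↦ ?_, ?_⟩
  · obtain ⟨y, hy⟩ := hroot α hα
    have := hτ' y
    rw [show τ • y = y from congrArg (· y) h, hy] at this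
    exact hσ this.symm
  · have hS' : ∀ x : S, ∃ y : f.rootSet f.SplittingField, j y = algebraMap K L x := fun x ↦
      hroot _ (by rw [aeval_algebraMap_apply, hS x x.2, map_zero])
    choose g hg using hS'
    have hginj : Function.Injective g := fun x y hxy ↦ by
      have : algebraMap K L x = algebraMap K L y := by rw [← hg, ← hg, hxy]
      exact Subtype.ext ((algebraMap K L).injective this)
    refine ⟨Finset.univ.image g, ?_, by simp [Finset.card_image_of_injective _ hginj]⟩
    simp only [Finset.mem_image, Finset.mem_univ, true_and, forall_exists_index, forall_apply_eq_imp_iff]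
    intro x
    apply Subtype.ext
    apply j.injective
    exact (hτ' _).trans (by rw [hg, AlgEquiv.commutes]; exact (hg x).symm)

theorem natDegree_le_card_simple_roots_add_two {k : Type*} [Field k] [IsAlgClosed k] [DecidableEq k] (q : k[X])
    (y : k) (h2 : (derivative (derivative q)).eval y ≠ 0)
    (hb : ∀ b, q.eval b = 0 → b ≠ y → (derivative q).eval b ≠ 0) :
    q.natDegree ≤ (q.roots.toFinset.erase y).card + 2 := by
  have h1 : ∀ b ∈ q.roots.toFinset.erase y, q.roots.count b ≤ 1 := fun b h ↦ by
    rw [Finset.mem_erase, Multiset.mem_toFinset, mem_roots'] at h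
    rw [count_roots]
    by_contra! hlt
    exact hb b h.2.2 h.1 (isRoot_iterate_derivative_of_lt_rootMultiplicity hlt)
  have hy : q.roots.count y ≤ 2 := by
    rw [count_roots]
    by_contra! hlt
    exact h2 (isRoot_iterate_derivative_of_lt_rootMultiplicity hlt)
  rw [(IsAlgClosed.splits q).natDegree_eq_card_roots,
    ← Multiset.sum_count_eq_card (s := insert y (q.roots.toFinset.erase y)) (m := q.roots),
    Finset.sum_insert (Finset.notMem_erase _ _), add_comm]
  · exact add_le_add ((Finset.sum_le_sum h1).trans (by simp)) hy
  · intro a ha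
    by_cases h : a = y <;> simp [h, ha]

open scoped PowerSeries in
/-- A simple root of `q` lifts to a power series root of `q + x`. -/
theorem exists_powerSeries_root {k : Type*} [Field k] (q : k[X]) (hq : q.Monic) (h0 : q.natDegree ≠ 0)
    (b : k) (hb : q.eval b = 0) (hb' : (derivative q).eval b ≠ 0) :
    ∃ r : k⟦X⟧, (q.map (PowerSeries.C (R := k)) + Polynomial.C PowerSeries.X).eval r = 0 ∧
      PowerSeries.constantCoeff r = b := by
  have : HenselianRing k⟦X⟧ (Ideal.span {(PowerSeries.X : k⟦X⟧)}) := inferInstance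
  obtain ⟨r, hr, hrb⟩ := this.is_henselian (q.map (PowerSeries.C (R := k)) + Polynomial.C PowerSeries.X)
    ((hq.map _).add_of_left (degree_C_le.trans_lt (by
      rw [hq.degree_map, ← natDegree_pos_iff_degree_pos]; omega)))
    (PowerSeries.C b) (by
      simp [eval_map_apply, hb])
    (by
      simp only [derivative_add, derivative_map, Polynomial.derivative_C, add_zero, eval_map_apply]
      exact ((Ne.isUnit hb').map _).map _)
  refine ⟨r, hr, ?_⟩
  rw [Ideal.mem_span_singleton, PowerSeries.X_dvd_iff] at hrb
  simpa [sub_eq_zero] using hrb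

open scoped PowerSeries in
/-- If `q` has a multiple root, then `q + x` has no complete set of roots in `k((x))`. -/
theorem not_splits_of_double_root {k : Type*} [Field k] (q : k[X]) (hq : q.Monic) (h0 : q.natDegree ≠ 0)
    (y : k) (hy : q.eval y = 0) (hy' : (derivative q).eval y = 0) (K : Type*) [Field K] [Algebra k⟦X⟧ K]
    [IsFractionRing k⟦X⟧ K] :
    ¬ ((q.map (PowerSeries.C (R := k)) + Polynomial.C PowerSeries.X).map (algebraMap k⟦X⟧ K)).Splits := by
  intro hsp
  set Q := q.map (PowerSeries.C (R := k)) + Polynomial.C PowerSeries.X with hQ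
  have hQm : Q.Monic := (hq.map _).add_of_left (degree_C_le.trans_lt (by
      rw [hq.degree_map, ← natDegree_pos_iff_degree_pos]; omega))
  have hroot : ∀ r : k⟦X⟧, Q.eval r = 0 → IsUnit (PowerSeries.C y - r) := by
    intro r hr
    rw [PowerSeries.isUnit_iff_constantCoeff, isUnit_iff_ne_zero]
    intro h
    obtain ⟨w, hw⟩ := PowerSeries.X_dvd_iff.mpr h
    obtain ⟨e, he⟩ := (q.map (PowerSeries.C (R := k))).binomExpansion (PowerSeries.C y) (r - PowerSeries.C y)
    rw [derivative_map, eval_map_apply, eval_map_apply, hy, hy'] at he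
    rw [hQ, eval_add, eval_C, show r = PowerSeries.C y + (r - PowerSeries.C y) by ring, he,
      ← neg_sub, hw] at hr
    have h1 : (PowerSeries.X : k⟦X⟧) * (1 + PowerSeries.X * (e * w ^ 2)) = 0 := by
      rw [← hr]; simp; ring
    have h2 := (mul_eq_zero.mp h1).resolve_left PowerSeries.X_ne_zero
    simpa using congrArg PowerSeries.constantCoeff h2
  have heval : Q.eval (PowerSeries.C y) = PowerSeries.X := by
    simp [hQ, eval_map_apply, hy]
  have hprod : algebraMap k⟦X⟧ K PowerSeries.X =
      ((Q.map (algebraMap k⟦X⟧ K)).roots.map fun r ↦ algebraMap _ K (PowerSeries.C y) - r).prod := by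
    rw [← hsp.eval_eq_prod_roots_of_monic (hQm.map _), eval_map_apply, heval]
  have hint : ∀ r ∈ (Q.map (algebraMap k⟦X⟧ K)).roots, ∃ u : k⟦X⟧, IsUnit u ∧
      algebraMap _ K u = algebraMap _ K (PowerSeries.C y) - r := by
    intro r hr
    rw [mem_roots', IsRoot, eval_map_algebraMap] at hr
    obtain ⟨r, rfl⟩ := IsIntegrallyClosed.isIntegral_iff.mp (show IsIntegral k⟦X⟧ r from ⟨Q, hQm, hr.2⟩)
    refine ⟨_, hroot r ?_, map_sub _ _ _⟩
    have := hr.2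
    rwa [aeval_algebraMap_apply, FaithfulSMul.algebraMap_eq_zero_iff] at this
  have key : ∀ s : Multiset K, (∀ r ∈ s, ∃ u : k⟦X⟧, IsUnit u ∧
      algebraMap _ K u = algebraMap _ K (PowerSeries.C y) - r) → ∃ u : k⟦X⟧, IsUnit u ∧
      algebraMap _ K u = (s.map fun r ↦ algebraMap _ K (PowerSeries.C y) - r).prod := by
    intro s
    induction s using Multiset.induction_on with
    | empty => exact fun _ ↦ ⟨1, isUnit_one, by simp⟩
    | cons a s ih =>
      intro h
      obtain ⟨u, hu, hu'⟩ := h a (Multiset.mem_cons_self a s)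
      obtain ⟨v, hv, hv'⟩ := ih fun r hr ↦ h r (Multiset.mem_cons_of_mem hr)
      exact ⟨u * v, hu.mul hv, by simp [hu', hv']⟩
  obtain ⟨u, hu, hu'⟩ := key _ hint
  rw [← hprod] at hu'
  rw [FaithfulSMul.algebraMap_injective k⟦X⟧ K hu'] at hu
  exact PowerSeries.X_prime.not_isUnit hu

/-- `p + t x + u` over `F(t)(u)`. -/
def addTwoParam {F : Type*} [Field F] (p : F[X]) : (RatFunc (RatFunc F))[X] :=
  p.map (algebraMap F (RatFunc (RatFunc F))) +
    C (algebraMap (RatFunc F) (RatFunc (RatFunc F)) RatFunc.X) * X + C RatFunc.X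

theorem degree_C_mul_X_add_C_lt {R : Type*} [CommRing R] [Nontrivial R] {p : R[X]} (hp : p.Monic)
    (h2 : 2 ≤ p.natDegree) (b c : R) : degree (C b * X + C c) < degree p := by
  refine (degree_linear_le).trans_lt ?_
  rw [degree_eq_natDegree hp.ne_zero]
  exact_mod_cast h2

theorem Polynomial.Monic.add_linear {R : Type*} [CommRing R] [Nontrivial R] {p : R[X]} (hp : p.Monic)
    (h2 : 2 ≤ p.natDegree) (b c : R) : (p + C b * X + C c).Monic := by
  rw [add_assoc]
  exact hp.add_of_left (degree_C_mul_X_add_C_lt hp h2 b c)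

theorem Polynomial.Monic.natDegree_add_linear {R : Type*} [CommRing R] [Nontrivial R] {p : R[X]}
    (hp : p.Monic) (h2 : 2 ≤ p.natDegree) (b c : R) :
    (p + C b * X + C c).natDegree = p.natDegree := by
  rw [add_assoc]
  exact natDegree_add_eq_left_of_degree_lt (degree_C_mul_X_add_C_lt hp h2 b c)

section

variable {F : Type*} [Field F] {p : F[X]}

theorem monic_addTwoParam (hp : p.Monic) (h2 : 2 ≤ p.natDegree) : (addTwoParam p).Monic :=
  (hp.map _).add_linear (by rwa [natDegree_map]) _ _

theorem natDegree_addTwoParam (hp : p.Monic) (h2 : 2 ≤ p.natDegree) :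
    (addTwoParam p).natDegree = p.natDegree := by
  rw [addTwoParam, (hp.map _).natDegree_add_linear (by rwa [natDegree_map]), natDegree_map]

theorem aeval_addTwoParam {L : Type*} [Field L] [Algebra (RatFunc (RatFunc F)) L] [Algebra F L]
    [IsScalarTower F (RatFunc (RatFunc F)) L] (p : F[X]) (x : L) :
    aeval x (addTwoParam p) = aeval x p +
      algebraMap (RatFunc (RatFunc F)) L (algebraMap _ _ (RatFunc.X : RatFunc F)) * x +
      algebraMap (RatFunc (RatFunc F)) L RatFunc.X := by
  simp [addTwoParam, aeval_map_algebraMap]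

theorem separable_addTwoParam [CharZero F] (p : F[X]) : (addTwoParam p).Separable := by
  have : CharZero (RatFunc F) := charZero_of_injective_algebraMap (algebraMap F (RatFunc F)).injective
  let q : (RatFunc F)[X] := p.map (algebraMap F (RatFunc F)) + C RatFunc.X * X
  have hq : addTwoParam p = q.map (algebraMap _ _) + C RatFunc.X := by
    simp only [q, addTwoParam, Polynomial.map_add, Polynomial.map_mul, map_C, map_X,
      Polynomial.map_map, ← IsScalarTower.algebraMap_eq]
  refine (isCoprime_iff_aeval_ne_zero_of_isAlgClosed _
    (AlgebraicClosure (RatFunc (RatFunc F))) _ _).mpr fun x ↦ or_iff_not_imp_left.mpr fun hx ↦ ?_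
  rw [not_not] at hx
  simp only [hq, derivative_map, derivative_C, add_zero, map_add, aeval_C,
    aeval_map_algebraMap] at hx ⊢
  exact aeval_derivative_ne_zero (RatFunc F) _ q x hx

theorem card_rootSet_addTwoParam [CharZero F] (hp : p.Monic) (h2 : 2 ≤ p.natDegree) :
    Nat.card ((addTwoParam p).rootSet (addTwoParam p).SplittingField) = p.natDegree := by
  rw [Nat.card_eq_fintype_card, card_rootSet_eq_natDegree (separable_addTwoParam p)
    (SplittingField.splits _), natDegree_addTwoParam hp h2]

theorem exists_gal_addTwoParam_smul_pair (p : F[X])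
    (a b c d : (addTwoParam p).rootSet (addTwoParam p).SplittingField) (hab : a ≠ b) (hcd : c ≠ d) :
    ∃ σ : (addTwoParam p).Gal, σ • a = c ∧ σ • b = d := by
  have h (x : (addTwoParam p).rootSet (addTwoParam p).SplittingField) :=
    (aeval_addTwoParam p x.1).symm.trans (mem_rootSet.mp x.2).2
  obtain ⟨σ, hσ⟩ := exists_gal_map_pair p rfl rfl (Subtype.coe_ne_coe.mpr hab) (Subtype.coe_ne_coe.mpr hcd)
    (h a) (h b) (h c) (h d)
  exact ⟨σ, Subtype.ext hσ.1, Subtype.ext hσ.2⟩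

end

section

open scoped PowerSeries LaurentSeries

/-- The embedding `k(u) → L((x))` with `u ↦ c + x`. -/
def ratFuncToLaurent {k L : Type*} [Field k] [Field L] [Algebra k L] (c : L) :
    RatFunc k →+* LaurentSeries L :=
  IsFractionRing.lift (A := k[X]) (g := ((algebraMap L⟦X⟧ (LaurentSeries L)).comp
    ((Polynomial.coeToPowerSeries.ringHom).comp
      ((taylorAlgHom c : L[X] →+* L[X]).comp (mapRingHom (algebraMap k L))))))
    (by
      simp only [RingHom.coe_comp]
      exact (IsFractionRing.injective L⟦X⟧ (LaurentSeries L)).comp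
        ((Polynomial.coe_injective L).comp ((taylor_injective c).comp
          (Polynomial.map_injective _ (algebraMap k L).injective))))

theorem ratFuncToLaurent_algebraMap {k L : Type*} [Field k] [Field L] [Algebra k L] (c : L) (z : k) :
    ratFuncToLaurent c (algebraMap k (RatFunc k) z) =
      algebraMap L⟦X⟧ (LaurentSeries L) (PowerSeries.C (algebraMap k L z)) := by
  rw [ratFuncToLaurent, RatFunc.algebraMap_eq_C, ← RatFunc.algebraMap_C, IsFractionRing.lift_algebraMap]
  simp

theorem ratFuncToLaurent_X {k L : Type*} [Field k] [Field L] [Algebra k L] (c : L) :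
    ratFuncToLaurent c (RatFunc.X : RatFunc k) =
      algebraMap L⟦X⟧ (LaurentSeries L) (PowerSeries.C c + PowerSeries.X) := by
  rw [ratFuncToLaurent, ← RatFunc.algebraMap_X, IsFractionRing.lift_algebraMap]
  simp [add_comm]

theorem map_addTwoParam_ratFuncToLaurent {F L : Type*} [Field F] [Field L] [Algebra (RatFunc F) L]
    [Algebra F L] [IsScalarTower F (RatFunc F) L] (p : F[X]) (c : L) :
    (addTwoParam p).map (ratFuncToLaurent c) =
      ((p.map (algebraMap F L) + C (algebraMap (RatFunc F) L RatFunc.X) * X + C c).map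
        (PowerSeries.C (R := L)) + C PowerSeries.X).map (algebraMap L⟦X⟧ (LaurentSeries L)) := by
  have : (ratFuncToLaurent c).comp (algebraMap F (RatFunc (RatFunc F))) =
      ((algebraMap L⟦X⟧ (LaurentSeries L)).comp (PowerSeries.C (R := L))).comp (algebraMap F L) := by
    ext1 z
    rw [RingHom.comp_apply, IsScalarTower.algebraMap_apply F (RatFunc F) (RatFunc (RatFunc F)),
      ratFuncToLaurent_algebraMap, ← IsScalarTower.algebraMap_apply]
    rfl
  simp only [addTwoParam, Polynomial.map_add, Polynomial.map_mul, map_C, map_X, Polynomial.map_map,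
    ratFuncToLaurent_algebraMap, ratFuncToLaurent_X, this, map_add]
  rw [RingHom.comp_assoc]
  ring

end

theorem exists_gal_addTwoParam_moving {F : Type*} [Field F] [CharZero F] {p : F[X]} (hp : p.Monic)
    (h2 : 2 ≤ p.natDegree) :
    ∃ σ : (addTwoParam p).Gal,
      (MulAction.toPerm σ : Equiv.Perm ((addTwoParam p).rootSet (addTwoParam p).SplittingField)) ≠ 1 ∧
      ∃ s : Finset ((addTwoParam p).rootSet (addTwoParam p).SplittingField),
        (∀ x ∈ s, σ • x = x) ∧ (addTwoParam p).natDegree ≤ s.card + 2 := by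
  classical
  let L := AlgebraicClosure (RatFunc F)
  have : CharZero (RatFunc F) := charZero_of_injective_algebraMap (algebraMap F (RatFunc F)).injective
  have : CharZero L := charZero_of_injective_algebraMap (algebraMap (RatFunc F) L).injective
  set t := algebraMap (RatFunc F) L RatFunc.X with ht
  obtain ⟨y, hy⟩ : ∃ y : L, aeval y (derivative p) + t = 0 := by
    have hd : ((derivative p).map (algebraMap F L) + C t).natDegree ≠ 0 := by
      rw [natDegree_add_C, natDegree_map, natDegree_derivative]
      omega
    obtain ⟨y, hy⟩ := IsAlgClosed.exists_root ((derivative p).map (algebraMap F L) + C t)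
      (fun h ↦ hd (natDegree_eq_of_degree_eq_some h))
    exact ⟨y, by simpa [eval_map_algebraMap] using hy⟩
  let c := -(aeval y p + t * y)
  let q := p.map (algebraMap F L) + C t * X + C c
  have hpL : 2 ≤ (p.map (algebraMap F L)).natDegree := by rwa [natDegree_map]
  have hq : q.Monic := (hp.map _).add_linear hpL _ _
  have hqn : q.natDegree = p.natDegree := by
    rw [(hp.map _).natDegree_add_linear hpL, natDegree_map]
  have eval_q (x : L) : q.eval x = aeval x p + t * x + c := by
    simp [q, eval_map_algebraMap]
  have eval_q' (x : L) : (derivative q).eval x = aeval x (derivative p) + t := by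
    simp [q, derivative_map, eval_map_algebraMap]
  have eval_q'' (x : L) : (derivative (derivative q)).eval x = aeval x (derivative (derivative p)) := by
    simp [q, derivative_map, eval_map_algebraMap]
  have hqy : q.eval y = 0 := by rw [eval_q]; ring
  have hqy' : (derivative q).eval y = 0 := by rw [eval_q', hy]
  have hsimple (b : L) (hb : q.eval b = 0) (hby : b ≠ y) : (derivative q).eval b ≠ 0 := by
    intro hb'
    rw [eval_q'] at hb'
    rw [eval_q] at hb hqy
    exact hby (eq_of_bitangent F L p b y hb' hy (by linear_combination hb - hqy))
  let _ : Algebra (RatFunc (RatFunc F)) (LaurentSeries L) := (ratFuncToLaurent c).toAlgebra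
  have hmap : (addTwoParam p).map (algebraMap _ (LaurentSeries L)) = _ :=
    map_addTwoParam_ratFuncToLaurent p c
  have hr (b : L) : ∃ r : PowerSeries L, b ∈ q.roots.toFinset.erase y →
      (q.map PowerSeries.C + C PowerSeries.X).eval r = 0 ∧ PowerSeries.constantCoeff r = b := by
    by_cases hb : b ∈ q.roots.toFinset.erase y
    · have hb' := Finset.mem_erase.mp hb
      have hb0 : q.eval b = 0 := (mem_roots'.mp (Multiset.mem_toFinset.mp hb'.2)).2
      obtain ⟨r, h⟩ := exists_powerSeries_root q hq (by omega) b hb0 (hsimple b hb0 hb'.1)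
      exact ⟨r, fun _ ↦ h⟩
    · exact ⟨0, fun h ↦ absurd h hb⟩
  choose r hr using hr
  have : CharZero (LaurentSeries L) :=
    charZero_of_injective_algebraMap (algebraMap L (LaurentSeries L)).injective
  obtain ⟨σ, hσ, s, hs, hcard⟩ := exists_gal_moving (K := LaurentSeries L) (addTwoParam p)
    (monic_addTwoParam hp h2).ne_zero (by
      rw [hmap]
      exact not_splits_of_double_root q hq (by omega) y hqy hqy' _)
    ((q.roots.toFinset.erase y).image fun b ↦ algebraMap (PowerSeries L) (LaurentSeries L) (r b)) (by
      simp only [Finset.forall_mem_image]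
      intro b hb
      rw [← eval_map_algebraMap, hmap, eval_map_algebraMap, aeval_algebraMap_apply]
      refine (congrArg _ ?_).trans (map_zero _)
      exact (hr b hb).1)
  refine ⟨σ, hσ, s, hs, ?_⟩
  rw [hcard, Finset.card_image_of_injOn, natDegree_addTwoParam hp h2, ← hqn]
  · refine natDegree_le_card_simple_roots_add_two q y ?_ hsimple
    rw [eval_q'']
    exact aeval_derivative_ne_zero F L _ y hy
  · intro b hb b' hb' h
    rw [← (hr b hb).2, ← (hr b' hb').2, IsFractionRing.injective _ (LaurentSeries L) h]

theorem twoParamPoly_eq_addTwoParam (F : Type*) [Field F] (n : ℕ) (a : ℕ → F) :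
    twoParamPoly F n a =
      addTwoParam (X ^ n + ∑ j ∈ Finset.Icc 1 (n - 2), C (a j) * X ^ (n - j)) := by
  simp [twoParamPoly, addTwoParam, Polynomial.map_sum, IsScalarTower.algebraMap_apply F (RatFunc F)]

/-- (Cohen.) Over a field `F` of characteristic zero, for
`g(x) = xⁿ + a₁xⁿ⁻¹ + ⋯ + a_{n−2}x²`, the Galois group of `g(x) + t·x + u` over
`F(t,u)` is the full symmetric group `Sₙ` (acting on the `n` roots). -/
theorem two_parameter_symmetric (F : Type*) [Field F] [CharZero F]
    (n : ℕ) (hn : 2 ≤ n) (a : ℕ → F) :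
    Nat.card ((twoParamPoly F n a).rootSet (twoParamPoly F n a).SplittingField) = n ∧
      GalIsSymm (twoParamPoly F n a) := by
  set p : F[X] := X ^ n + ∑ j ∈ Finset.Icc 1 (n - 2), C (a j) * X ^ (n - j) with hp
  have hlt : degree (∑ j ∈ Finset.Icc 1 (n - 2), C (a j) * X ^ (n - j)) < n := by
    refine (degree_sum_le _ _).trans_lt ((Finset.sup_lt_iff (WithBot.bot_lt_coe n)).mpr fun j hj ↦ ?_)
    refine (degree_C_mul_X_pow_le _ _).trans_lt ?_
    have := Finset.mem_Icc.mp hj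
    exact WithBot.coe_lt_coe.mpr (Nat.cast_lt.mpr (by omega))
  have hm : p.Monic := monic_X_pow_add hlt
  have hn' : p.natDegree = n := natDegree_eq_of_degree_eq_some <| by
    rw [hp, degree_add_eq_left_of_degree_lt (by rwa [degree_X_pow]), degree_X_pow]
  rw [twoParamPoly_eq_addTwoParam, ← hp]
  have h2 : 2 ≤ p.natDegree := hn'.symm ▸ hn
  exact ⟨(card_rootSet_addTwoParam hm h2).trans hn', galIsSymm_of_swap _
    (exists_gal_addTwoParam_smul_pair p) (exists_gal_addTwoParam_moving hm h2)⟩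

end
end
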